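/- There is a constant β > 0 such that for every integer n ≥ 16 there exists a simple graph G on n vertices with the property that every obstacle representation of G uses at least β·n / log(log n) obstacles; that is, the maximum obstacle number of n-vertex graphs is Ω(n / log log n). -/

import Mathlib

open scoped Classical

noncomputable section

/-- A simple polygon in the plane, given by `k ≥ 3` pairwise distinct vertices
`p₀, …, p_{k-1}` (indexed cyclically by `ZMod k`): consecutive boundary segments
meet exactly in their shared endpoint, and non-consecutive ones are disjoint. -/
structure SimplePolygon where
  k : ℕ
  three_le : 3 ≤ k
  verts : ZMod k → ℝ × ℝ
  inj : Function.Injective verts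
  consec : ∀ i : ZMod k,
    segment ℝ (verts i) (verts (i + 1)) ∩ segment ℝ (verts (i + 1)) (verts (i + 2)) =
      {verts (i + 1)}
  nonconsec : ∀ i j : ZMod k, j ≠ i → j ≠ i + 1 → i ≠ j + 1 →
    Disjoint (segment ℝ (verts i) (verts (i + 1))) (segment ℝ (verts j) (verts (j + 1)))

/-- The union `C` of the boundary segments of a simple polygon. -/
def SimplePolygon.boundary (P : SimplePolygon) : Set (ℝ × ℝ) :=
  ⋃ i : ZMod P.k, segment ℝ (P.verts i) (P.verts (i + 1))

/-- The simple polygon as a set: the boundary `C` together with the union `B` of all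
bounded connected components of the complement of `C`. -/
def SimplePolygon.toSet (P : SimplePolygon) : Set (ℝ × ℝ) :=
  P.boundary ∪ {x | x ∉ P.boundary ∧ Bornology.IsBounded (connectedComponentIn P.boundaryᶜ x)}

/-- An obstacle representation of a simple graph `G`: an injective placement of the
vertices in general position together with finitely many pairwise disjoint simple
polygons (obstacles) such that edges are unobstructed segments and non-edges are
blocked by some obstacle. -/
structure ObstacleRep {V : Type*} (G : SimpleGraph V) where
  pos : V → ℝ × ℝ
  posInj : Function.Injective pos
  genPos : ∀ u v w : V, u ≠ v → u ≠ w → v ≠ w →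
    ¬ Collinear ℝ ({pos u, pos v, pos w} : Set (ℝ × ℝ))
  numObs : ℕ
  obs : Fin numObs → SimplePolygon
  disj : ∀ i j : Fin numObs, i ≠ j → Disjoint (obs i).toSet (obs j).toSet
  edges_clear : ∀ u v : V, G.Adj u v → ∀ i,
    Disjoint (segment ℝ (pos u) (pos v)) (obs i).toSet
  nonedges_blocked : ∀ u v : V, u ≠ v → ¬ G.Adj u v →
    ∃ i, (segment ℝ (pos u) (pos v) ∩ (obs i).toSet).Nonempty

section

open MvPolynomial in
theorem MvPolynomial.exists_eval_eq_on_finset {σ : Type*} (Y : Finset (σ → ℝ)) (w : (σ → ℝ) → ℝ) :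
    ∃ p : MvPolynomial σ ℝ, ∀ y ∈ Y, eval y p = w y := by
  have sep : ∀ y y' : σ → ℝ, ∃ p : MvPolynomial σ ℝ, y ≠ y' → eval y p = 1 ∧ eval y' p = 0 := by
    intro y y'
    by_cases h : y = y'
    · exact ⟨0, fun h' => absurd h h'⟩
    · obtain ⟨i, hi⟩ := Function.ne_iff.mp h
      refine ⟨C (y i - y' i)⁻¹ * (X i - C (y' i)), fun _ => ⟨?_, by simp⟩⟩
      have : y i - y' i ≠ 0 := sub_ne_zero.mpr hi
      simp [this]
  choose p hp using sep
  refine ⟨∑ y ∈ Y, C (w y) * ∏ y' ∈ Y.erase y, p y y', fun z hz => ?_⟩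
  rw [map_sum, Finset.sum_eq_single z]
  · rw [map_mul, eval_C, map_prod, Finset.prod_eq_one, mul_one]
    intro y' hy'
    exact (hp z y' (Finset.ne_of_mem_erase hy').symm).1
  · intro y hy hyz
    rw [map_mul, map_prod, Finset.prod_eq_zero (Finset.mem_erase.mpr ⟨hyz.symm, hz⟩), mul_zero]
    exact (hp y z hyz).2
  · exact fun h => absurd hz h

open MvPolynomial in
/-- A finite set of solutions of `y i ^ e = g i (y)`, where each `g i` has degree below `e`,
has at most `e ^ |σ|` elements. -/
theorem MvPolynomial.card_le_of_pow_eq {σ : Type*} [Fintype σ] (e : ℕ)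
    (g : σ → MvPolynomial σ ℝ) (hg : ∀ i, (g i).totalDegree < e) (Y : Finset (σ → ℝ))
    (hY : ∀ y ∈ Y, ∀ i, y i ^ e = eval y (g i)) : Y.card ≤ e ^ Fintype.card σ := by
  let mon : (σ → Fin e) → (Y → ℝ) := fun m y => ∏ i, (y : σ → ℝ) i ^ (m i : ℕ)
  let ev : MvPolynomial σ ℝ →ₗ[ℝ] (Y → ℝ) :=
    { toFun := fun p y => eval (y : σ → ℝ) p
      map_add' := fun p q => by ext; simp
      map_smul' := fun c p => by ext; simp [smul_eval] }
  have key : ∀ n : ℕ, ∀ p : MvPolynomial σ ℝ, p.totalDegree ≤ n →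
      ev p ∈ Submodule.span ℝ (Set.range mon) := by
    intro n
    induction n using Nat.strong_induction_on with
    | _ n ih =>
      intro p hp
      rw [p.as_sum, map_sum]
      refine Submodule.sum_mem _ fun s hs => ?_
      have hsn : (s.sum fun _ k => k) ≤ n := (le_totalDegree hs).trans hp
      have hsm : ev (monomial s (coeff s p)) = coeff s p • ev (monomial s 1) := by
        rw [← map_smul, smul_monomial, smul_eq_mul, mul_one]
      rw [hsm]
      refine Submodule.smul_mem _ _ ?_
      by_cases hlt : ∀ i, s i < e
      · refine Submodule.subset_span ⟨fun i => ⟨s i, hlt i⟩, ?_⟩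
        ext y
        simp [mon, ev, eval_monomial, Finsupp.prod_fintype]
      · push Not at hlt
        obtain ⟨i, hi⟩ := hlt
        obtain ⟨s', rfl⟩ : ∃ s', s = s' + Finsupp.single i e :=
          ⟨s - Finsupp.single i e, (tsub_add_cancel_of_le (by simpa using hi)).symm⟩
        have hev : ev (monomial (s' + Finsupp.single i e) 1) = ev (monomial s' 1 * g i) := by
          ext y
          have := hY y y.2 i
          simp only [ev, LinearMap.coe_mk, AddHom.coe_mk, map_mul, ← this]
          rw [← mul_one (1 : ℝ), ← monomial_mul, map_mul]
          simp [eval_monomial]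
        rw [hev]
        have hdeg : (monomial s' (1 : ℝ) * g i).totalDegree < n := by
          refine (totalDegree_mul _ _).trans_lt ?_
          have h1 := hg i
          rw [totalDegree_monomial _ one_ne_zero]
          rw [Finsupp.sum_add_index' (by simp) (by simp), Finsupp.sum_single_index rfl] at hsn
          change s'.sum (fun _ k => k) + (g i).totalDegree < n
          omega
        exact ih _ hdeg _ le_rfl
  have htop : (⊤ : Submodule ℝ (Y → ℝ)) ≤ Submodule.span ℝ (Set.range mon) := by
    intro w _
    obtain ⟨p, hp⟩ := exists_eval_eq_on_finset Y fun y => if h : y ∈ Y then w ⟨y, h⟩ else 0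
    have : ev p = w := by
      ext y
      simpa [ev] using hp y y.2
    exact this ▸ key _ p le_rfl
  have h1 : Module.finrank ℝ (Submodule.span ℝ (Set.range mon)) ≤ _ := finrank_range_le_card mon
  rw [top_le_iff.mp htop, finrank_top] at h1
  simpa using h1

open MvPolynomial in
theorem MvPolynomial.hasDerivAt_eval_update {σ : Type*} (p : MvPolynomial σ ℝ) (y : σ → ℝ) (i : σ) :
    HasDerivAt (fun t => eval (Function.update y i t) p) (eval y (pderiv i p)) (y i) := by
  induction p using MvPolynomial.induction_on with
  | C a => simpa using hasDerivAt_const (y i) a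
  | add p q hp hq => simpa using hp.fun_add hq
  | mul_X p j hp =>
    have hX : HasDerivAt (fun t => eval (Function.update y i t) (X j : MvPolynomial σ ℝ))
        (eval y (pderiv i (X j))) (y i) := by
      by_cases h : j = i
      · subst h
        simpa using hasDerivAt_id' (y j)
      · simpa [Function.update_of_ne h, pderiv_X_of_ne h] using hasDerivAt_const (y i) (y j)
    have := hp.fun_mul hX
    simp only [← map_mul, Function.update_eq_self, ← map_add] at this
    rw [pderiv_mul]
    exact this

open MvPolynomial in
theorem MvPolynomial.totalDegree_pderiv_le {σ : Type*} (i : σ) (p : MvPolynomial σ ℝ) :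
    (pderiv i p).totalDegree ≤ p.totalDegree := by
  conv_lhs => rw [p.as_sum, map_sum]
  refine totalDegree_finsetSum_le fun s hs => ?_
  rw [pderiv_monomial]
  refine (totalDegree_monomial_le _ _).trans ?_
  refine le_trans ?_ (le_totalDegree hs)
  have h : s - Finsupp.single i 1 ≤ s := tsub_le_self
  exact Finsupp.degree_mono h

open MvPolynomial in
theorem MvPolynomial.exists_abs_eval_le {σ : Type*} [Fintype σ] (p : MvPolynomial σ ℝ) (D : ℕ)
    (hp : p.totalDegree ≤ D) :
    ∃ c : ℝ, 0 ≤ c ∧ ∀ y : σ → ℝ, 1 ≤ ‖y‖ → |eval y p| ≤ c * ‖y‖ ^ D := by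
  refine ⟨∑ s ∈ p.support, |coeff s p|, Finset.sum_nonneg fun _ _ => abs_nonneg _, fun y hy => ?_⟩
  rw [eval_eq, Finset.sum_mul]
  refine (Finset.abs_sum_le_sum_abs _ _).trans (Finset.sum_le_sum fun s hs => ?_)
  rw [abs_mul, Finset.abs_prod]
  refine mul_le_mul_of_nonneg_left ?_ (abs_nonneg _)
  calc ∏ i ∈ s.support, |y i ^ s i| ≤ ∏ i ∈ s.support, ‖y‖ ^ s i := by
        refine Finset.prod_le_prod (fun _ _ => abs_nonneg _) fun i _ => ?_
        rw [abs_pow]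
        exact pow_le_pow_left₀ (abs_nonneg _) (norm_le_pi_norm y i) _
    _ = ‖y‖ ^ (s.sum fun _ k => k) := Finset.prod_pow_eq_pow_sum _ _ _
    _ ≤ ‖y‖ ^ D := pow_le_pow_right₀ hy ((le_totalDegree hs).trans hp)

open MvPolynomial in
/-- The number of strict sign patterns realized by finitely many polynomials of bounded degree. -/
theorem MvPolynomial.card_le_of_injOn_signs {ι σ : Type*} [Fintype ι] [Fintype σ]
    (f : ι → MvPolynomial σ ℝ) (d : ℕ) (hd : ∀ i, (f i).totalDegree ≤ d) (T : Finset (σ → ℝ))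
    (hT : ∀ x ∈ T, ∀ i, eval x (f i) ≠ 0)
    (hinj : ∀ x ∈ T, ∀ y ∈ T, (∀ i, 0 < eval x (f i) * eval y (f i)) → x = y) :
    T.card ≤ (2 * (Fintype.card ι * d) + 1) ^ Fintype.card σ := by
  set D := Fintype.card ι * d with hD
  set F : MvPolynomial σ ℝ := ∏ i, f i with hF
  have hFdeg : F.totalDegree ≤ D := by
    refine (totalDegree_finsetProd _ _).trans ?_
    refine (Finset.sum_le_sum fun i _ => hd i).trans ?_
    simp [hD]
  have hFne : ∀ x, eval x F ≠ 0 → ∀ i, eval x (f i) ≠ 0 := by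
    intro x hx i hi
    rw [hF, map_prod, Finset.prod_eq_zero (Finset.mem_univ i) hi] at hx
    exact hx rfl
  set N : (σ → ℝ) → ℝ := fun x => ∑ i, x i ^ (2 * D + 2) with hN
  have hNnn : ∀ x, 0 ≤ N x := fun x =>
    Finset.sum_nonneg fun i _ => (Even.pow_nonneg ⟨D + 1, by ring⟩ _)
  obtain ⟨ε, hε, hεT⟩ : ∃ ε : ℝ, 0 < ε ∧ ∀ x ∈ T, ε * N x < eval x F ^ 2 := by
    have : ∀ x ∈ T, ∃ ε : ℝ, 0 < ε ∧ ∀ ε' ≤ ε, ε' * N x < eval x F ^ 2 := by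
      intro x hx
      have h0 : 0 < eval x F ^ 2 := by
        have : eval x F ≠ 0 := by
          rw [hF, map_prod]
          exact Finset.prod_ne_zero_iff.mpr fun i _ => hT x hx i
        positivity
      have hN1 : 0 < N x + 1 := by linarith [hNnn x]
      refine ⟨eval x F ^ 2 / (N x + 1), by positivity, fun ε' h => ?_⟩
      rw [le_div_iff₀ hN1] at h
      by_cases hε' : 0 < ε'
      · linarith
      · have := mul_nonneg (neg_nonneg.mpr (not_lt.mp hε')) (hNnn x)
        linarith
    choose! δ hδ hδ' using this
    by_cases hne : T.Nonempty
    · refine ⟨T.inf' hne δ, (Finset.lt_inf'_iff _).mpr hδ, fun x hx => ?_⟩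
      exact hδ' x hx _ (Finset.inf'_le _ hx)
    · exact ⟨1, one_pos, fun x hx => absurd ⟨x, hx⟩ hne⟩
  set Ψ : (σ → ℝ) → ℝ := fun x => eval x F ^ 2 - ε * N x with hΨ
  have hΨc : Continuous Ψ := by
    have := MvPolynomial.continuous_eval F
    fun_prop
  have hfar : ∃ R : ℝ, ∀ y, R < ‖y‖ → Ψ y ≤ 0 := by
    obtain ⟨c, hc, hcF⟩ := exists_abs_eval_le F D hFdeg
    refine ⟨max 1 (c ^ 2 / ε), fun y hy => ?_⟩
    have h1 : 1 ≤ ‖y‖ := (le_max_left _ _).trans hy.le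
    have h2 : c ^ 2 ≤ ε * ‖y‖ ^ 2 := by
      have : c ^ 2 / ε ≤ ‖y‖ := (le_max_right _ _).trans hy.le
      rw [div_le_iff₀ hε] at this
      nlinarith
    have h3 : eval y F ^ 2 ≤ c ^ 2 * ‖y‖ ^ (2 * D) := by
      have := pow_le_pow_left₀ (abs_nonneg _) (hcF y h1) 2
      rw [sq_abs] at this
      refine this.trans_eq (by ring)
    have h4 : ‖y‖ ^ (2 * D + 2) ≤ N y := by
      have hσ : Nonempty σ := by
        by_contra h
        rw [not_nonempty_iff] at h
        have : ‖y‖ = 0 := by rw [Subsingleton.elim y 0, norm_zero]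
        linarith
      obtain ⟨i, hi⟩ : ∃ i, ‖y i‖ = ‖y‖ := by
        obtain ⟨i, -, hi⟩ := Finset.exists_mem_eq_sup (Finset.univ : Finset σ)
          Finset.univ_nonempty fun i => ‖y i‖₊
        exact ⟨i, by rw [Pi.norm_def, hi]; rfl⟩
      rw [← hi]
      have hev : Even (2 * D + 2) := ⟨D + 1, by ring⟩
      have : ‖y i‖ ^ (2 * D + 2) = y i ^ (2 * D + 2) := by
        rw [Real.norm_eq_abs, hev.pow_abs]
      rw [this]
      exact Finset.single_le_sum (f := fun i => y i ^ (2 * D + 2))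
        (fun j _ => hev.pow_nonneg _) (Finset.mem_univ i)
    have h5 : c ^ 2 * ‖y‖ ^ (2 * D) ≤ ε * ‖y‖ ^ (2 * D + 2) := by
      have := mul_le_mul_of_nonneg_right h2 (by positivity : 0 ≤ ‖y‖ ^ (2 * D))
      exact this.trans_eq (by ring)
    have h6 := mul_le_mul_of_nonneg_left h4 hε.le
    simp only [hΨ]
    linarith
  obtain ⟨R, hR⟩ := hfar
  have hmax : ∀ x ∈ T, ∃ y : σ → ℝ, (∀ i, 0 < eval x (f i) * eval y (f i)) ∧
      ∀ i, y i ^ (2 * D + 1) =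
        eval y (C (ε * (2 * D + 2))⁻¹ * pderiv i (F ^ 2)) := by
    intro x hx
    have hΨx : 0 < Ψ x := by
      have := hεT x hx
      simp only [hΨ]
      linarith
    let K : Set (σ → ℝ) := {y | ∀ i, 0 ≤ eval x (f i) * eval y (f i)}
    have hK : IsClosed K := by
      simp only [K, Set.ofPred_forall]
      refine isClosed_iInter fun i => isClosed_le continuous_const ?_
      exact continuous_const.mul (MvPolynomial.continuous_eval _)
    have hxK : x ∈ K := fun i => mul_self_nonneg _
    have hxR : x ∈ Metric.closedBall (0 : σ → ℝ) R := by
      rw [mem_closedBall_zero_iff]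
      by_contra h
      linarith [hR x (not_le.mp h)]
    obtain ⟨y, hy, hymax⟩ := ((isCompact_closedBall (0 : σ → ℝ) R).inter_right hK).exists_isMaxOn
      ⟨x, hxR, hxK⟩ hΨc.continuousOn
    have hyx : Ψ x ≤ Ψ y := hymax ⟨hxR, hxK⟩
    have hglob : ∀ z ∈ K, Ψ z ≤ Ψ y := by
      intro z hz
      by_cases hzR : ‖z‖ ≤ R
      · exact hymax ⟨mem_closedBall_zero_iff.mpr hzR, hz⟩
      · linarith [hR z (not_le.mp hzR)]
    have hyF : eval y F ≠ 0 := by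
      intro h0
      have : Ψ y ≤ 0 := by
        simp only [hΨ, h0]
        have := mul_nonneg hε.le (hNnn y)
        linarith
      linarith
    have hpos : ∀ i, 0 < eval x (f i) * eval y (f i) := fun i =>
      lt_of_le_of_ne (hy.2 i) (mul_ne_zero (hT x hx i) (hFne y hyF i)).symm
    refine ⟨y, hpos, fun i => ?_⟩
    have hcont : Continuous fun t : ℝ => Function.update y i t := by fun_prop
    have hloc : IsLocalMax (fun t => Ψ (Function.update y i t)) (y i) := by
      have : ∀ᶠ t in nhds (y i), ∀ j, 0 < eval x (f j) * eval (Function.update y i t) (f j) := by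
        rw [Filter.eventually_all]
        intro j
        have hc : Continuous fun t => eval x (f j) * eval (Function.update y i t) (f j) :=
          continuous_const.mul ((MvPolynomial.continuous_eval _).comp hcont)
        refine hc.continuousAt.eventually_const_lt ?_
        simpa using hpos j
      filter_upwards [this] with t ht
      simpa using hglob _ fun j => (ht j).le
    have hder : HasDerivAt (fun t => Ψ (Function.update y i t))
        (eval y (pderiv i (F ^ 2)) - ε * ((2 * D + 2) * y i ^ (2 * D + 1))) (y i) := by
      have h1 := hasDerivAt_eval_update (F ^ 2) y i
      have h2 : HasDerivAt (fun t => N (Function.update y i t))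
          ((2 * D + 2) * y i ^ (2 * D + 1)) (y i) := by
        have hsplit : (fun t => N (Function.update y i t)) =
            fun t => t ^ (2 * D + 2) + ∑ j ∈ Finset.univ.erase i, y j ^ (2 * D + 2) := by
          funext t
          simp only [hN]
          rw [← Finset.add_sum_erase _ _ (Finset.mem_univ i), Function.update_self]
          congr 1
          refine Finset.sum_congr rfl fun j hj => ?_
          rw [Function.update_of_ne (Finset.ne_of_mem_erase hj)]
        rw [hsplit]
        have := (hasDerivAt_pow (2 * D + 2) (y i)).add_const
          (∑ j ∈ Finset.univ.erase i, y j ^ (2 * D + 2))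
        simpa using this
      have := h1.fun_sub (h2.const_mul ε)
      simpa [hΨ] using this
    have h0 := hloc.hasDerivAt_eq_zero hder
    have hne : (ε * (2 * D + 2)) ≠ 0 := by positivity
    rw [map_mul, eval_C, eq_inv_mul_iff_mul_eq₀ hne]
    linarith
  choose! Y hY1 hY2 using hmax
  have hYinj : Set.InjOn Y T := by
    intro x hx x' hx' h
    refine hinj x hx x' hx' fun i => ?_
    have h1 := hY1 x hx i
    have h2 := hY1 x' hx' i
    rw [← h] at h2
    have h3 := mul_pos h1 h2
    have h4 : eval x (f i) * eval x' (f i) * eval (Y x) (f i) ^ 2 > 0 := by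
      refine h3.trans_eq (by ring)
    exact pos_of_mul_pos_left h4 (sq_nonneg _)
  rw [← Finset.card_image_of_injOn hYinj]
  refine card_le_of_pow_eq (2 * D + 1)
    (fun i => C (ε * (2 * D + 2))⁻¹ * pderiv i (F ^ 2)) (fun i => ?_) _ ?_
  · refine Nat.lt_succ_of_le ((totalDegree_mul _ _).trans ?_)
    rw [totalDegree_C, zero_add]
    refine (totalDegree_pderiv_le _ _).trans ((totalDegree_pow _ _).trans ?_)
    exact Nat.mul_le_mul_left _ hFdeg
  · intro y hy i
    obtain ⟨x, hx, rfl⟩ := Finset.mem_image.mp hy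
    exact hY2 x hx i

theorem sign_eq_of_gap {a b ε : ℝ} (hε : 0 < ε) (ha : 0 < a → ε < a) (ha' : a < 0 → a < -ε)
    (hb : 0 < b → ε < b) (hb' : b < 0 → b < -ε) (h1 : 0 < (a + ε) * (b + ε))
    (h2 : 0 < (a + -ε) * (b + -ε)) : SignType.sign a = SignType.sign b := by
  rcases lt_trichotomy a 0 with h | h | h <;> rcases lt_trichotomy b 0 with h' | h' | h'
  · rw [sign_neg h, sign_neg h']
  · nlinarith [ha' h]
  · nlinarith [ha' h]
  · nlinarith [hb' h']
  · rw [h, h']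
  · nlinarith [hb h']
  · nlinarith [ha h, hb' h']
  · nlinarith [ha h]
  · rw [sign_pos h, sign_pos h']

open MvPolynomial in
/-- The number of sign patterns (with values in `SignType`) of finitely many polynomials of
bounded degree. -/
theorem MvPolynomial.card_le_of_injOn_sign {ι σ : Type*} [Fintype ι] [Fintype σ]
    (f : ι → MvPolynomial σ ℝ) (d : ℕ) (hd : ∀ i, (f i).totalDegree ≤ d) (T : Finset (σ → ℝ))
    (hinj : ∀ x ∈ T, ∀ y ∈ T,
      (∀ i, SignType.sign (eval x (f i)) = SignType.sign (eval y (f i))) → x = y) :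
    T.card ≤ (4 * (Fintype.card ι * d) + 1) ^ Fintype.card σ := by
  obtain ⟨ε, hε, hεT⟩ : ∃ ε : ℝ, 0 < ε ∧ ∀ x ∈ T, ∀ i, eval x (f i) ≠ 0 → ε < |eval x (f i)| := by
    have hfin : {r : ℝ | ∃ x ∈ T, ∃ i, eval x (f i) ≠ 0 ∧ r = |eval x (f i)|}.Finite := by
      refine ((T ×ˢ (Finset.univ : Finset ι)).image fun z => |eval z.1 (f z.2)|).finite_toSet.subset
        ?_
      rintro r ⟨x, hx, i, -, rfl⟩
      simp only [Finset.coe_image, Set.mem_image, Finset.mem_coe, Finset.mem_product]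
      exact ⟨(x, i), ⟨hx, Finset.mem_univ _⟩, rfl⟩
    obtain ⟨ε, h0, h1⟩ := Order.exists_between_finsets (α := ℝ) {0} hfin.toFinset (by
      intro a ha b hb
      simp only [Finset.mem_singleton, Set.Finite.mem_toFinset, Set.mem_ofPred_eq] at ha hb
      obtain ⟨x, -, i, h, rfl⟩ := hb
      rw [ha]
      exact abs_pos.mpr h)
    refine ⟨ε, h0 0 (by simp), fun x hx i h => h1 _ ?_⟩
    simp only [Set.Finite.mem_toFinset, Set.mem_ofPred_eq]
    exact ⟨x, hx, i, h, rfl⟩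
  have key : ∀ x ∈ T, ∀ i, (0 < eval x (f i) → ε < eval x (f i)) ∧
      (eval x (f i) < 0 → eval x (f i) < -ε) := by
    intro x hx i
    refine ⟨fun h => ?_, fun h => ?_⟩
    · simpa [abs_of_pos h] using hεT x hx i h.ne'
    · have := hεT x hx i h.ne
      rw [abs_of_neg h] at this
      linarith
  let g : ι × Bool → MvPolynomial σ ℝ := fun p => f p.1 + C (if p.2 then ε else -ε)
  have hgd : ∀ p, (g p).totalDegree ≤ d := fun p =>
    (totalDegree_add _ _).trans (by simpa using hd p.1)
  have := card_le_of_injOn_signs g d hgd T ?_ ?_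
  · refine this.trans_eq ?_
    rw [Fintype.card_prod, Fintype.card_bool]
    ring_nf
  · rintro x hx ⟨i, b⟩
    have := key x hx i
    rcases lt_trichotomy (eval x (f i)) 0 with h | h | h <;> cases b <;> simp [g] <;> grind
  · intro x hx y hy h
    refine hinj x hx y hy fun i => ?_
    have h1 := h (i, true)
    have h2 := h (i, false)
    have kx := key x hx i
    have ky := key y hy i
    simp only [g, if_true, map_add, eval_C, Bool.false_eq_true, if_false] at h1 h2
    exact sign_eq_of_gap hε kx.1 kx.2 ky.1 ky.2 h1 h2

end

section

/-- Satisfiability of a finite system of strict affine inequalities in one real variable. -/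
theorem exists_forall_affine_pos_iff {J : Type*} (s : Finset J) (α β : J → ℝ) :
    (∃ x : ℝ, ∀ j ∈ s, 0 < α j * x + β j) ↔
      (∀ j ∈ s, α j = 0 → 0 < β j) ∧
      ∀ i ∈ s, ∀ j ∈ s, 0 < α i → α j < 0 → 0 < α i * β j - α j * β i := by
  constructor
  · rintro ⟨x, hx⟩
    refine ⟨fun j hj h => by simpa [h] using hx j hj, fun i hi j hj h h' => ?_⟩
    nlinarith [mul_pos h (hx j hj), mul_pos (neg_pos.mpr h') (hx i hi)]
  · rintro ⟨h0, h1⟩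
    obtain ⟨x, hlo, hhi⟩ := Order.exists_between_finsets (α := ℝ)
      ((s.filter fun j => 0 < α j).image fun j => -β j / α j)
      ((s.filter fun j => α j < 0).image fun j => -β j / α j) (by
        simp only [Finset.mem_image, Finset.mem_filter]
        rintro _ ⟨i, ⟨hi, hi'⟩, rfl⟩ _ ⟨j, ⟨hj, hj'⟩, rfl⟩
        have := h1 i hi j hj hi' hj'
        rw [div_lt_iff₀ hi', ← neg_div_neg_eq (-β j), div_mul_eq_mul_div,
          lt_div_iff₀ (neg_pos.mpr hj')]
        linarith)
    refine ⟨x, fun j hj => ?_⟩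
    rcases lt_trichotomy (α j) 0 with h | h | h
    · have := hhi _ (Finset.mem_image_of_mem _ (Finset.mem_filter.mpr ⟨hj, h⟩))
      rw [← neg_div_neg_eq, lt_div_iff₀ (neg_pos.mpr h)] at this
      linarith
    · simpa [h] using h0 j hj h
    · have := hlo _ (Finset.mem_image_of_mem _ (Finset.mem_filter.mpr ⟨hj, h⟩))
      rw [div_lt_iff₀ h] at this
      linarith

namespace CrossDrawing

/-- The lines attached to a bipartite drawing: one through each cross pair and a vertical one
through each point. -/
abbrev LineIdx (A B : Type) := (A × B) ⊕ (A ⊕ B)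

variable {A B : Type}

section Forms

variable {R : Type} [CommRing R]

/-- Run of the segment `e`, for a drawing with coordinates `x`. -/
def run (x : A ⊕ B → R) (e : A × B) : R := x (Sum.inr e.2) - x (Sum.inl e.1)

/-- The intercept form `y_a x_b - x_a y_b` of the segment `e = (a, b)`. -/
def icpt (x y : A ⊕ B → R) (e : A × B) : R :=
  y (Sum.inl e.1) * x (Sum.inr e.2) - x (Sum.inl e.1) * y (Sum.inr e.2)

/-- Slopes of the affine forms describing the abscissae at which cells exist. -/
def slopeForm (x y : A ⊕ B → R) : ((A × B) × (A × B)) ⊕ ((A ⊕ B) × Bool) → R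
  | Sum.inl (e, e') => run x e * run y e' - run x e' * run y e
  | Sum.inr (_, b) => if b then 1 else -1

/-- Constant terms of the affine forms describing the abscissae at which cells exist. -/
def constForm (x y : A ⊕ B → R) : ((A × B) × (A × B)) ⊕ ((A ⊕ B) × Bool) → R
  | Sum.inl (e, e') => run x e * icpt x y e' - run x e' * icpt x y e
  | Sum.inr (v, b) => if b then -x v else x v

/-- All forms whose signs determine the set of cells. -/
def cellForm (x y : A ⊕ B → R) :
    let J := ((A × B) × (A × B)) ⊕ ((A ⊕ B) × Bool)
    J ⊕ (J ⊕ (J × J)) → R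
  | Sum.inl j => slopeForm x y j
  | Sum.inr (Sum.inl j) => constForm x y j
  | Sum.inr (Sum.inr (i, j)) =>
    slopeForm x y i * constForm x y j - slopeForm x y j * constForm x y i

theorem map_cellForm {R' : Type} [CommRing R'] (φ : R →+* R') (x y : A ⊕ B → R) (k) :
    φ (cellForm x y k) = cellForm (fun v => φ (x v)) (fun v => φ (y v)) k := by
  have hs : ∀ j, φ (slopeForm x y j) = slopeForm (fun v => φ (x v)) (fun v => φ (y v)) j := by
    rintro (⟨e, e'⟩ | ⟨v, b⟩)
    · simp [slopeForm, run]
    · cases b <;> simp [slopeForm]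
  have hc : ∀ j, φ (constForm x y j) = constForm (fun v => φ (x v)) (fun v => φ (y v)) j := by
    rintro (⟨e, e'⟩ | ⟨v, b⟩)
    · simp [constForm, run, icpt]
    · cases b <;> simp [constForm]
  rcases k with j | j | ⟨i, j⟩
  · exact hs j
  · exact hc j
  · simp [cellForm, hs, hc]

end Forms

/-- The functional whose zero set is the line with the given index. -/
def lineFn (P : A ⊕ B → ℝ × ℝ) : LineIdx A B → ℝ × ℝ → ℝ
  | Sum.inl e, p => run (fun v => (P v).1) e * p.2 - run (fun v => (P v).2) e * p.1 -
      icpt (fun v => (P v).1) (fun v => (P v).2) e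
  | Sum.inr v, p => p.1 - (P v).1

/-- A point on none of the lines. -/
def Generic (P : A ⊕ B → ℝ × ℝ) (p : ℝ × ℝ) : Prop := ∀ i, lineFn P i p ≠ 0

/-- The sides of the lines on which a point lies. -/
def side (P : A ⊕ B → ℝ × ℝ) (p : ℝ × ℝ) : LineIdx A B → Bool := fun i => decide (0 < lineFn P i p)

/-- The sign vectors of the cells of the line arrangement. -/
def cells (P : A ⊕ B → ℝ × ℝ) : Set (LineIdx A B → Bool) := {s | ∃ p, Generic P p ∧ side P p = s}

/-- The left points lie to the left of the right points. -/
def LeftRight (P : A ⊕ B → ℝ × ℝ) : Prop := ∀ a b, (P (Sum.inl a)).1 < (P (Sum.inr b)).1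

theorem mem_cells_iff {P : A ⊕ B → ℝ × ℝ} {s : LineIdx A B → Bool} :
    s ∈ cells P ↔ ∃ p, ∀ i, (s i = true → 0 < lineFn P i p) ∧ (s i = false → lineFn P i p < 0) := by
  constructor
  · rintro ⟨p, hp, rfl⟩
    refine ⟨p, fun i => ⟨fun h => by simpa [side] using h, fun h => ?_⟩⟩
    have : lineFn P i p ≤ 0 := by simpa [side] using h
    exact lt_of_le_of_ne this (hp i)
  · rintro ⟨p, hp⟩
    refine ⟨p, fun i => ?_, funext fun i => ?_⟩
    · cases h : s i
      · exact ((hp i).2 h).ne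
      · exact ((hp i).1 h).ne'
    · cases h : s i
      · simpa [side] using ((hp i).2 h).le
      · simpa [side] using (hp i).1 h

variable [Fintype A] [Fintype B]

theorem mem_cells_iff_forms {P : A ⊕ B → ℝ × ℝ} (hP : LeftRight P) {s : LineIdx A B → Bool} :
    s ∈ cells P ↔ ∃ x : ℝ, ∀ j ∈ (Finset.univ.filter
      (Sum.elim (fun e : (A × B) × (A × B) => s (Sum.inl e.1) = true ∧ s (Sum.inl e.2) = false)
        (fun v : (A ⊕ B) × Bool => s (Sum.inr v.1) = v.2))),
      0 < slopeForm (fun v => (P v).1) (fun v => (P v).2) j * x +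
        constForm (fun v => (P v).1) (fun v => (P v).2) j := by
  have hrun : ∀ e : A × B, 0 < run (fun v => (P v).1) e := fun e => sub_pos.mpr (hP e.1 e.2)
  rw [mem_cells_iff]
  constructor
  · rintro ⟨p, hp⟩
    refine ⟨p.1, ?_⟩
    rintro (⟨e, e'⟩ | ⟨v, b⟩) hj
    · simp only [Finset.mem_filter, Finset.mem_univ, true_and, Sum.elim_inl] at hj
      have h1 := (hp (Sum.inl e)).1 hj.1
      have h2 := (hp (Sum.inl e')).2 hj.2
      simp only [lineFn] at h1 h2
      simp only [slopeForm, constForm]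
      nlinarith [mul_pos (hrun e') h1, mul_pos (hrun e) (neg_pos.mpr h2)]
    · simp only [Finset.mem_filter, Finset.mem_univ, true_and, Sum.elim_inr] at hj
      cases b
      · have := (hp (Sum.inr v)).2 hj
        simp only [lineFn] at this
        simp [slopeForm, constForm]
        linarith
      · have := (hp (Sum.inr v)).1 hj
        simp only [lineFn] at this
        simp [slopeForm, constForm]
        linarith
  · rintro ⟨x, hx⟩
    obtain ⟨y, hlo, hhi⟩ := Order.exists_between_finsets (α := ℝ)
      ((Finset.univ.filter fun e : A × B => s (Sum.inl e) = true).image fun e =>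
        (run (fun v => (P v).2) e * x + icpt (fun v => (P v).1) (fun v => (P v).2) e) /
          run (fun v => (P v).1) e)
      ((Finset.univ.filter fun e : A × B => s (Sum.inl e) = false).image fun e =>
        (run (fun v => (P v).2) e * x + icpt (fun v => (P v).1) (fun v => (P v).2) e) /
          run (fun v => (P v).1) e) (by
        simp only [Finset.mem_image, Finset.mem_filter, Finset.mem_univ, true_and]
        rintro _ ⟨e, he, rfl⟩ _ ⟨e', he', rfl⟩
        have := hx (Sum.inl (e, e')) (by simp [he, he'])
        simp only [slopeForm, constForm] at this
        rw [div_lt_div_iff₀ (hrun e) (hrun e')]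
        linarith)
    refine ⟨(x, y), ?_⟩
    rintro (e | v)
    · refine ⟨fun h => ?_, fun h => ?_⟩
      · have := hlo _ (Finset.mem_image_of_mem _ (Finset.mem_filter.mpr ⟨Finset.mem_univ e, h⟩))
        rw [div_lt_iff₀ (hrun e)] at this
        simp only [lineFn]
        linarith
      · have := hhi _ (Finset.mem_image_of_mem _ (Finset.mem_filter.mpr ⟨Finset.mem_univ e, h⟩))
        rw [lt_div_iff₀ (hrun e)] at this
        simp only [lineFn]
        linarith
    · have := hx (Sum.inr (v, s (Sum.inr v))) (by simp)
      refine ⟨fun h => ?_, fun h => ?_⟩ <;>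
      · simp only [slopeForm, constForm, h] at this
        simp only [lineFn]
        simp at this
        linarith

theorem cells_eq_of_sign_eq {P P' : A ⊕ B → ℝ × ℝ} (hP : LeftRight P) (hP' : LeftRight P')
    (h : ∀ k, SignType.sign (cellForm (fun v => (P v).1) (fun v => (P v).2) k) =
      SignType.sign (cellForm (fun v => (P' v).1) (fun v => (P' v).2) k)) :
    cells P = cells P' := by
  have hpos : ∀ a b : ℝ, SignType.sign a = SignType.sign b → (0 < a ↔ 0 < b) := by
    intro a b hab
    rw [← sign_eq_one_iff, ← sign_eq_one_iff, hab]
  have hneg : ∀ a b : ℝ, SignType.sign a = SignType.sign b → (a < 0 ↔ b < 0) := by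
    intro a b hab
    rw [← sign_eq_neg_one_iff, ← sign_eq_neg_one_iff, hab]
  have hzero : ∀ a b : ℝ, SignType.sign a = SignType.sign b → (a = 0 ↔ b = 0) := by
    intro a b hab
    rw [← sign_eq_zero_iff, ← sign_eq_zero_iff (a := b), hab]
  ext s
  rw [mem_cells_iff_forms hP, mem_cells_iff_forms hP', exists_forall_affine_pos_iff,
    exists_forall_affine_pos_iff]
  have hs := fun j => h (Sum.inl j)
  have hc := fun j => h (Sum.inr (Sum.inl j))
  have hd := fun i j => h (Sum.inr (Sum.inr (i, j)))
  simp only [cellForm] at hs hc hd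
  refine and_congr ?_ ?_
  · refine forall₂_congr fun j _ => ?_
    rw [hzero _ _ (hs j), hpos _ _ (hc j)]
  · refine forall₂_congr fun i _ => forall₂_congr fun j _ => ?_
    rw [hpos _ _ (hs i), hneg _ _ (hs j), hpos _ _ (hd i j)]

open MvPolynomial in
/-- The cell sets of left-right drawings take few values. -/
theorem card_cells_le (𝒯 : Finset (Set (LineIdx A B → Bool)))
    (h𝒯 : ∀ S ∈ 𝒯, ∃ P : A ⊕ B → ℝ × ℝ, LeftRight P ∧ cells P = S) {m : ℕ}
    (hm : Fintype.card (((A × B) × (A × B)) ⊕ ((A ⊕ B) × Bool)) ≤ m) :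
    𝒯.card ≤ (20 * (2 * m + m ^ 2) + 1) ^ (2 * Fintype.card (A ⊕ B)) := by
  choose! P hP hPS using h𝒯
  let z : Set (LineIdx A B → Bool) → ((A ⊕ B) × Bool → ℝ) :=
    fun S v => if v.2 then (P S v.1).2 else (P S v.1).1
  let x : A ⊕ B → MvPolynomial ((A ⊕ B) × Bool) ℝ := fun v => X (v, false)
  let y : A ⊕ B → MvPolynomial ((A ⊕ B) × Bool) ℝ := fun v => X (v, true)
  have heval : ∀ S k, eval (z S) (cellForm x y k) =
      cellForm (fun v => (P S v).1) (fun v => (P S v).2) k := by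
    intro S k
    rw [map_cellForm]
    simp [x, y, z]
  have hx : ∀ v, (x v).totalDegree ≤ 1 := fun v => (totalDegree_X _).le
  have hy : ∀ v, (y v).totalDegree ≤ 1 := fun v => (totalDegree_X _).le
  have hsub : ∀ (p q : MvPolynomial ((A ⊕ B) × Bool) ℝ) (n : ℕ), p.totalDegree ≤ n →
      q.totalDegree ≤ n → (p - q).totalDegree ≤ n := fun p q n hp hq =>
    (totalDegree_sub p q).trans (max_le hp hq)
  have hmul : ∀ (p q : MvPolynomial ((A ⊕ B) × Bool) ℝ) (k l n : ℕ), p.totalDegree ≤ k →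
      q.totalDegree ≤ l → k + l ≤ n → (p * q).totalDegree ≤ n := fun p q k l n hp hq hn =>
    (totalDegree_mul p q).trans ((add_le_add hp hq).trans hn)
  have hrx : ∀ e, (run x e).totalDegree ≤ 1 := fun e => hsub _ _ _ (hx _) (hx _)
  have hry : ∀ e, (run y e).totalDegree ≤ 1 := fun e => hsub _ _ _ (hy _) (hy _)
  have hic : ∀ e, (icpt x y e).totalDegree ≤ 2 := fun e =>
    hsub _ _ _ (hmul _ _ 1 1 _ (hy _) (hx _) le_rfl) (hmul _ _ 1 1 _ (hx _) (hy _) le_rfl)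
  have hs : ∀ j, (slopeForm x y j).totalDegree ≤ 2 := by
    rintro (⟨e, e'⟩ | ⟨v, b⟩)
    · exact hsub _ _ _ (hmul _ _ 1 1 _ (hrx _) (hry _) le_rfl)
        (hmul _ _ 1 1 _ (hrx _) (hry _) le_rfl)
    · cases b <;> simp [slopeForm]
  have hc : ∀ j, (constForm x y j).totalDegree ≤ 3 := by
    rintro (⟨e, e'⟩ | ⟨v, b⟩)
    · exact hsub _ _ _ (hmul _ _ 1 2 _ (hrx _) (hic _) le_rfl)
        (hmul _ _ 1 2 _ (hrx _) (hic _) le_rfl)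
    · have := hx v
      cases b <;> simp [constForm] <;> omega
  have hdeg : ∀ k, (cellForm x y k).totalDegree ≤ 5 := by
    rintro (j | j | ⟨i, j⟩)
    · exact (hs j).trans (by norm_num)
    · exact (hc j).trans (by norm_num)
    · exact hsub _ _ _ (hmul _ _ 2 3 _ (hs _) (hc _) le_rfl) (hmul _ _ 2 3 _ (hs _) (hc _) le_rfl)
  have hkey : ∀ S ∈ 𝒯, ∀ S' ∈ 𝒯, (∀ k, SignType.sign (eval (z S) (cellForm x y k)) =
      SignType.sign (eval (z S') (cellForm x y k))) → S = S' := by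
    intro S hS S' hS' h
    rw [← hPS S hS, ← hPS S' hS']
    refine cells_eq_of_sign_eq (hP S hS) (hP S' hS') fun k => ?_
    rw [← heval, ← heval]
    exact h k
  have hzinj : Set.InjOn z 𝒯 := fun S hS S' hS' h => hkey S hS S' hS' fun k => by rw [h]
  rw [← Finset.card_image_of_injOn hzinj]
  refine (card_le_of_injOn_sign (cellForm x y) 5 hdeg _ ?_).trans ?_
  · intro u hu w hw h
    obtain ⟨S, hS, rfl⟩ := Finset.mem_image.mp hu
    obtain ⟨S', hS', rfl⟩ := Finset.mem_image.mp hw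
    rw [hkey S hS S' hS' h]
  · rw [Fintype.card_prod, Fintype.card_bool, mul_comm (Fintype.card (A ⊕ B)) 2]
    refine Nat.pow_le_pow_left ?_ _
    rw [Fintype.card_sum, Fintype.card_sum (α := _ ⊕ _), Fintype.card_prod (_ ⊕ _)]
    set c := Fintype.card (((A × B) × (A × B)) ⊕ ((A ⊕ B) × Bool))
    nlinarith

open MvPolynomial in
/-- A line arrangement has few cells. -/
theorem card_le_of_subset_cells (P : A ⊕ B → ℝ × ℝ) (T : Finset (LineIdx A B → Bool))
    (hT : ∀ s ∈ T, s ∈ cells P) : T.card ≤ (2 * Fintype.card (LineIdx A B) + 1) ^ 2 := by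
  choose! p hp hps using hT
  let z : (LineIdx A B → Bool) → (Bool → ℝ) := fun s b => if b then (p s).2 else (p s).1
  let f : LineIdx A B → MvPolynomial Bool ℝ := fun i => match i with
    | Sum.inl e => C (run (fun v => (P v).1) e) * X true - C (run (fun v => (P v).2) e) * X false -
        C (icpt (fun v => (P v).1) (fun v => (P v).2) e)
    | Sum.inr v => X false - C (P v).1
  have heval : ∀ s i, eval (z s) (f i) = lineFn P i (p s) := by
    rintro s (e | v) <;> simp [f, z, lineFn]
  have hdeg : ∀ i, (f i).totalDegree ≤ 1 := by
    have h1 : ∀ (c : ℝ) (b : Bool), (C c * X b : MvPolynomial Bool ℝ).totalDegree ≤ 1 := fun c b =>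
      (totalDegree_mul _ _).trans (by simp)
    rintro (e | v)
    · exact (totalDegree_sub _ _).trans (max_le ((totalDegree_sub _ _).trans
        (max_le (h1 _ _) (h1 _ _))) (by simp))
    · exact (totalDegree_sub _ _).trans (max_le (by simp) (by simp))
  have hkey : ∀ s ∈ T, ∀ s' ∈ T, (∀ i, 0 < eval (z s) (f i) * eval (z s') (f i)) → s = s' := by
    intro s hs s' hs' h
    rw [← hps s hs, ← hps s' hs']
    funext i
    have := h i
    rw [heval, heval] at this
    simp only [side, decide_eq_decide]
    rcases pos_and_pos_or_neg_and_neg_of_mul_pos this with h | h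
    · exact iff_of_true h.1 h.2
    · exact iff_of_false h.1.not_gt h.2.not_gt
  have hself : ∀ s ∈ T, ∀ i, 0 < eval (z s) (f i) * eval (z s) (f i) := by
    intro s hs i
    rw [heval]
    exact mul_self_pos.mpr (hp s hs i)
  have hzinj : Set.InjOn z T := fun s hs s' hs' h => hkey s hs s' hs' fun i => by
    rw [← h]
    exact hself s hs i
  rw [← Finset.card_image_of_injOn hzinj]
  refine (card_le_of_injOn_signs f 1 hdeg _ ?_ ?_).trans (by simp)
  · intro u hu i
    obtain ⟨s, hs, rfl⟩ := Finset.mem_image.mp hu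
    rw [heval]
    exact hp s hs i
  · intro u hu w hw h
    obtain ⟨s, hs, rfl⟩ := Finset.mem_image.mp hu
    obtain ⟨s', hs', rfl⟩ := Finset.mem_image.mp hw
    rw [hkey s hs s' hs' h]

end CrossDrawing

end

section

theorem isPreconnected_box_diff_center (x : ℝ × ℝ) {r : ℝ} (hr : 0 < r) :
    IsPreconnected (Metric.ball x r \ {x}) := by
  have hconv := convex_ball x r
  let R := Metric.ball x r ∩ {p : ℝ × ℝ | x.1 < p.1}
  let L := Metric.ball x r ∩ {p : ℝ × ℝ | p.1 < x.1}
  let U := Metric.ball x r ∩ {p : ℝ × ℝ | x.2 < p.2}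
  let D := Metric.ball x r ∩ {p : ℝ × ℝ | p.2 < x.2}
  have hR : IsPreconnected R := (hconv.inter
    ((convex_Ioi x.1).linear_preimage (LinearMap.fst ℝ ℝ ℝ))).isPreconnected
  have hL : IsPreconnected L := (hconv.inter
    ((convex_Iio x.1).linear_preimage (LinearMap.fst ℝ ℝ ℝ))).isPreconnected
  have hU : IsPreconnected U := (hconv.inter
    ((convex_Ioi x.2).linear_preimage (LinearMap.snd ℝ ℝ ℝ))).isPreconnected
  have hD : IsPreconnected D := (hconv.inter
    ((convex_Iio x.2).linear_preimage (LinearMap.snd ℝ ℝ ℝ))).isPreconnected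
  have hmem : ∀ s t : ℝ, |s| < r → |t| < r → (x.1 + s, x.2 + t) ∈ Metric.ball x r := by
    intro s t hs ht
    rw [Metric.mem_ball, Prod.dist_eq, Real.dist_eq, Real.dist_eq]
    simpa using ⟨hs, ht⟩
  have h2 : |r / 2| < r := by rw [abs_of_pos (by linarith)]; linarith
  have h2' : |-(r / 2)| < r := by rwa [abs_neg]
  have hRU : IsPreconnected (R ∪ U) := hR.union (x.1 + r / 2, x.2 + r / 2)
    ⟨hmem _ _ h2 h2, by simpa using hr⟩ ⟨hmem _ _ h2 h2, by simpa using hr⟩ hU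
  have hLD : IsPreconnected (L ∪ D) := hL.union (x.1 + -(r / 2), x.2 + -(r / 2))
    ⟨hmem _ _ h2' h2', by simpa using hr⟩ ⟨hmem _ _ h2' h2', by simpa using hr⟩ hD
  have hall := hRU.union (x.1 + r / 2, x.2 + -(r / 2))
    (Or.inl ⟨hmem _ _ h2 h2', by simpa using hr⟩) (Or.inr ⟨hmem _ _ h2 h2', by simpa using hr⟩) hLD
  convert hall using 1
  ext p
  simp only [R, L, U, D, Set.mem_sdiff, Set.mem_singleton_iff, Set.mem_union, Set.mem_inter_iff,
    Set.mem_ofPred_eq, Prod.ext_iff]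
  grind

theorem IsPreconnected.diff_singleton_of_isOpen {U : Set (ℝ × ℝ)} (hU : IsPreconnected U)
    (ho : IsOpen U) (x : ℝ × ℝ) : IsPreconnected (U \ {x}) := by
  by_cases hx : x ∈ U
  swap
  · rwa [Set.sdiff_singleton_eq_self hx]
  obtain ⟨r, hr, hball⟩ := Metric.isOpen_iff.mp ho x hx
  rw [isPreconnected_iff_subset_of_disjoint]
  intro Q₁ Q₂ h₁ h₂ hsub hdisj
  have hB : Metric.ball x r \ {x} ⊆ U \ {x} := Set.sdiff_subset_sdiff_left hball
  have main : ∀ Q₁ Q₂ : Set (ℝ × ℝ), IsOpen Q₁ → IsOpen Q₂ → U \ {x} ⊆ Q₁ ∪ Q₂ →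
      U \ {x} ∩ (Q₁ ∩ Q₂) = ∅ → Metric.ball x r \ {x} ⊆ Q₁ → U \ {x} ⊆ Q₁ := by
    intro Q₁ Q₂ h₁ h₂ hsub hdisj hBQ
    have hcov : U ⊆ (Q₁ ∪ Metric.ball x r) ∪ (Q₂ \ {x}) := by
      intro p hp
      by_cases hpx : p = x
      · exact Or.inl (Or.inr (hpx ▸ Metric.mem_ball_self hr))
      · rcases hsub ⟨hp, hpx⟩ with h | h
        · exact Or.inl (Or.inl h)
        · exact Or.inr ⟨h, hpx⟩
    have hem : U ∩ ((Q₁ ∪ Metric.ball x r) ∩ (Q₂ \ {x})) = ∅ := by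
      rw [Set.eq_empty_iff_forall_notMem]
      rintro p ⟨hpU, hp1, hp2, hpx⟩
      have : p ∈ Q₁ := hp1.elim id fun h => hBQ ⟨h, hpx⟩
      exact Set.eq_empty_iff_forall_notMem.mp hdisj p ⟨⟨hpU, hpx⟩, this, hp2⟩
    rcases isPreconnected_iff_subset_of_disjoint.mp hU _ _ (h₁.union Metric.isOpen_ball)
      (h₂.sdiff isClosed_singleton) hcov hem with h | h
    · rintro p ⟨hp, hpx⟩
      exact (h hp).elim id fun h' => hBQ ⟨h', hpx⟩
    · exact absurd rfl (h hx).2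
  rcases isPreconnected_iff_subset_of_disjoint.mp (isPreconnected_box_diff_center x hr) Q₁ Q₂ h₁ h₂
    (hB.trans hsub) (Set.eq_empty_of_subset_empty (hdisj ▸ Set.inter_subset_inter_left _ hB))
    with h | h
  · exact Or.inl (main Q₁ Q₂ h₁ h₂ hsub hdisj h)
  · refine Or.inr (main Q₂ Q₁ h₂ h₁ (by rwa [Set.union_comm]) (by rwa [Set.inter_comm Q₂]) h)

theorem IsPreconnected.diff_finite_of_isOpen {U : Set (ℝ × ℝ)} (hU : IsPreconnected U)
    (ho : IsOpen U) {X : Set (ℝ × ℝ)} (hX : X.Finite) : IsPreconnected (U \ X) := by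
  induction X, hX using Set.Finite.induction_on with
  | empty => simpa
  | @insert a s _ hs ih =>
    rw [← Set.union_singleton, ← Set.sdiff_sdiff]
    exact ih.diff_singleton_of_isOpen (ho.sdiff hs.isClosed) a

namespace CrossDrawing

variable {A B : Type}

/-- The placements considered: the left points precede the right ones, abscissae are distinct,
and no point lies on the line of a cross pair not containing it. -/
structure Good (P : A ⊕ B → ℝ × ℝ) : Prop where
  leftRight : LeftRight P
  fst_inj : Function.Injective fun v => (P v).1
  off_line : ∀ e : A × B, ∀ v, v ≠ Sum.inl e.1 → v ≠ Sum.inr e.2 → lineFn P (Sum.inl e) (P v) ≠ 0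

/-- The segment drawn for a cross pair. -/
def seg (P : A ⊕ B → ℝ × ℝ) (e : A × B) : Set (ℝ × ℝ) :=
  segment ℝ (P (Sum.inl e.1)) (P (Sum.inr e.2))

/-- The complement of the drawn segments. -/
def free (P : A ⊕ B → ℝ × ℝ) (S : Set (A × B)) : Set (ℝ × ℝ) := (⋃ e ∈ S, seg P e)ᶜ

/-- The crossings of distinct lines. -/
def crossings (P : A ⊕ B → ℝ × ℝ) : Set (ℝ × ℝ) :=
  {p | ∃ i j, i ≠ j ∧ lineFn P i p = 0 ∧ lineFn P j p = 0}

theorem lineFn_combo (P : A ⊕ B → ℝ × ℝ) (i) {s t : ℝ} (h : s + t = 1) (p q : ℝ × ℝ) :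
    lineFn P i (s • p + t • q) = s * lineFn P i p + t * lineFn P i q := by
  obtain rfl : s = 1 - t := by linarith
  rcases i with e | v <;> simp [lineFn] <;> ring

@[fun_prop]
theorem continuous_lineFn (P : A ⊕ B → ℝ × ℝ) (i) : Continuous (lineFn P i) := by
  rcases i with e | v
  · change Continuous fun p : ℝ × ℝ => _ * p.2 - _ * p.1 - _
    fun_prop
  · change Continuous fun p : ℝ × ℝ => p.1 - _
    fun_prop

variable {P : A ⊕ B → ℝ × ℝ}

theorem lineFn_left (e : A × B) : lineFn P (Sum.inl e) (P (Sum.inl e.1)) = 0 := by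
  simp [lineFn, run, icpt]; ring

theorem lineFn_right (e : A × B) : lineFn P (Sum.inl e) (P (Sum.inr e.2)) = 0 := by
  simp [lineFn, run, icpt]; ring

theorem run_pos (hP : LeftRight P) (e : A × B) : 0 < run (fun v => (P v).1) e :=
  sub_pos.mpr (hP e.1 e.2)

theorem mem_seg_iff (hP : LeftRight P) {e : A × B} {p : ℝ × ℝ} :
    p ∈ seg P e ↔ lineFn P (Sum.inl e) p = 0 ∧ (P (Sum.inl e.1)).1 ≤ p.1 ∧
      p.1 ≤ (P (Sum.inr e.2)).1 := by
  have hr := run_pos hP e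
  constructor
  · rintro ⟨s, t, hs, ht, hst, rfl⟩
    rw [lineFn_combo P _ hst, lineFn_left, lineFn_right]
    have := hP e.1 e.2
    obtain rfl : s = 1 - t := by linarith
    simp
    constructor <;> nlinarith
  · rintro ⟨h0, h1, h2⟩
    set xa := (P (Sum.inl e.1)).1 with hxa
    set xb := (P (Sum.inr e.2)).1 with hxb
    have hd : 0 < xb - xa := hr
    refine ⟨(xb - p.1) / (xb - xa), (p.1 - xa) / (xb - xa), div_nonneg (by linarith) hd.le,
      div_nonneg (by linarith) hd.le, ?_, ?_⟩
    · rw [← add_div]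
      rw [div_eq_one_iff_eq hd.ne']
      ring
    · simp only [lineFn, run, icpt, ← hxa, ← hxb] at h0
      ext
      · simp only [Prod.fst_add, Prod.smul_fst, smul_eq_mul, ← hxa, ← hxb]
        field_simp
        ring
      · simp only [Prod.snd_add, Prod.smul_snd, smul_eq_mul]
        field_simp
        linarith

theorem subsingleton_common_zero (hP : Good P) {i j : LineIdx A B} (hij : i ≠ j) :
    {p | lineFn P i p = 0 ∧ lineFn P j p = 0}.Subsingleton := by
  have mixed : ∀ e v, {p | lineFn P (Sum.inl e) p = 0 ∧ lineFn P (Sum.inr v) p = 0}.Subsingleton := by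
    rintro e v p ⟨hp, hp'⟩ q ⟨hq, hq'⟩
    have hr := run_pos hP.leftRight e
    simp only [lineFn] at hp hq hp' hq'
    have h1 : p.1 = q.1 := by linarith
    rw [h1] at hp
    have h2 : run (fun v => (P v).1) e * (p.2 - q.2) = 0 := by linarith
    have h3 : p.2 - q.2 = 0 := (mul_eq_zero.mp h2).resolve_left hr.ne'
    exact Prod.ext h1 (by linarith)
  rcases i with e | v <;> rcases j with e' | v'
  · rintro p ⟨hp, hp'⟩ q ⟨hq, hq'⟩
    by_contra hpq
    have hr := run_pos hP.leftRight e
    have hr' := run_pos hP.leftRight e'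
    have hzero : ∀ w, lineFn P (Sum.inl e') w = 0 → lineFn P (Sum.inl e) w = 0 := by
      intro w hw
      simp only [lineFn] at hp hp' hq hq' hw ⊢
      set X := run (fun v => (P v).1) e
      set X' := run (fun v => (P v).1) e'
      set M := run (fun v => (P v).2) e
      set M' := run (fun v => (P v).2) e'
      set K := icpt (fun v => (P v).1) (fun v => (P v).2) e
      set K' := icpt (fun v => (P v).1) (fun v => (P v).2) e'
      have hd1 : p.1 - q.1 ≠ 0 := by
        intro h
        have h1 : p.1 = q.1 := by linarith
        rw [h1] at hp
        have h2 : X * (p.2 - q.2) = 0 := by linarith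
        have h3 : p.2 - q.2 = 0 := (mul_eq_zero.mp h2).resolve_left hr.ne'
        exact hpq (Prod.ext h1 (by linarith))
      have hM : M * X' = M' * X := by
        have : (p.1 - q.1) * (M * X' - M' * X) = 0 := by
          linear_combination X' * hq - X' * hp + X * hp' - X * hq'
        linarith [(mul_eq_zero.mp this).resolve_left hd1]
      have hK : K * X' = K' * X := by linear_combination (-X') * hp + X * hp' - p.1 * hM
      have : X' * (X * w.2 - M * w.1 - K) = 0 := by
        linear_combination X * hw - w.1 * hM - hK
      exact (mul_eq_zero.mp this).resolve_left hr'.ne'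
    by_cases ha : e'.1 = e.1
    · have hb : e'.2 ≠ e.2 := fun h => hij (by rw [Prod.ext ha h])
      exact hP.off_line e (Sum.inr e'.2) (by simp) (by simpa using hb) (hzero _ (lineFn_right e'))
    · exact hP.off_line e (Sum.inl e'.1) (by simpa using ha) (by simp) (hzero _ (lineFn_left e'))
  · exact mixed e v'
  · intro p hp q hq
    exact mixed e' v ⟨hp.2, hp.1⟩ ⟨hq.2, hq.1⟩
  · rintro p ⟨hp, hp'⟩
    simp only [lineFn] at hp hp'
    exact absurd (hP.fst_inj (show (P v).1 = (P v').1 by linarith)) fun h => hij (by rw [h])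

section Finite
variable [Fintype A] [Fintype B]

theorem finite_crossings (hP : Good P) : (crossings P).Finite := by
  have : crossings P = ⋃ i, ⋃ j, ⋃ _ : i ≠ j, {p | lineFn P i p = 0 ∧ lineFn P j p = 0} := by
    ext p
    simp only [crossings, Set.mem_iUnion, exists_prop, Set.mem_ofPred_eq]
  rw [this]
  exact Set.finite_iUnion fun i => Set.finite_iUnion fun j => Set.finite_iUnion fun h =>
    (subsingleton_common_zero hP h).finite

theorem isOpen_free (P : A ⊕ B → ℝ × ℝ) (S : Set (A × B)) : IsOpen (free P S) := by
  rw [free, isOpen_compl_iff]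
  refine Set.Finite.isClosed_biUnion (Set.toFinite S) fun e _ => ?_
  unfold seg
  rw [segment_eq_image]
  exact (isCompact_Icc.image (by fun_prop)).isClosed

theorem dense_generic (hP : LeftRight P) : Dense {p | Generic P p} := by
  have : {p | Generic P p} = ⋂ i, {p | lineFn P i p ≠ 0} := by
    ext p
    simp [Generic]
  rw [this]
  refine dense_iInter_of_isOpen (fun i => isOpen_ne_fun (continuous_lineFn P i) continuous_const)
    fun i => ?_
  rw [Metric.dense_iff]
  intro p r hr
  by_cases hp : lineFn P i p ≠ 0
  · exact ⟨p, Metric.mem_ball_self hr, hp⟩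
  push Not at hp
  have hr2 : |r| / 2 < r := by rw [abs_of_pos hr]; linarith
  rcases i with e | v
  · refine ⟨(p.1, p.2 + r / 2), ?_, ?_⟩
    · simpa [Metric.mem_ball, Prod.dist_eq, Real.dist_eq] using ⟨hr, hr2⟩
    · have h1 : lineFn P (Sum.inl e) (p.1, p.2 + r / 2) =
          lineFn P (Sum.inl e) p + run (fun v => (P v).1) e * (r / 2) := by
        simp only [lineFn]
        ring
      have h2 : 0 < run (fun v => (P v).1) e * (r / 2) := mul_pos (run_pos hP e) (by linarith)
      change lineFn P (Sum.inl e) _ ≠ 0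
      rw [h1, hp, zero_add]
      exact h2.ne'
  · refine ⟨(p.1 + r / 2, p.2), ?_, ?_⟩
    · simpa [Metric.mem_ball, Prod.dist_eq, Real.dist_eq] using ⟨hr2, hr⟩
    · simp only [lineFn] at hp
      change p.1 + r / 2 - (P v).1 ≠ 0
      linarith

theorem exists_generic_mem (hP : LeftRight P) {U : Set (ℝ × ℝ)} (ho : IsOpen U)
    (hne : U.Nonempty) : ∃ p ∈ U, Generic P p := by
  obtain ⟨p, hp, hp'⟩ := (dense_generic hP).inter_open_nonempty U ho hne
  exact ⟨p, hp, hp'⟩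

end Finite

end CrossDrawing

end

section

namespace CrossDrawing

variable {A B : Type}

/-- The abscissae of the cell lie strictly between those of the endpoints of `e`. -/
def InSeg (s : LineIdx A B → Bool) (e : A × B) : Prop :=
  s (Sum.inr (Sum.inl e.1)) = true ∧ s (Sum.inr (Sum.inr e.2)) = false

/-- The sign vectors differ at exactly one index. -/
def DifferAt (s t : LineIdx A B → Bool) (i : LineIdx A B) : Prop :=
  s i ≠ t i ∧ ∀ k, k ≠ i → s k = t k

/-- Two adjacent cells whose common side is not part of a segment of `S`. -/
def Step (Γ : Set (LineIdx A B → Bool)) (S : Set (A × B)) (s t : LineIdx A B → Bool) : Prop :=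
  s ∈ Γ ∧ t ∈ Γ ∧ ∃ i, DifferAt s t i ∧ ∀ e ∈ S, i = Sum.inl e → ¬ InSeg s e

/-- The segment `t` separates two adjacent cells, one of them reachable from `s₀`. -/
def Hits (Γ : Set (LineIdx A B → Bool)) (S : Set (A × B)) (s₀ : LineIdx A B → Bool)
    (t : A × B) : Prop :=
  ∃ s s', Relation.ReflTransGen (Step Γ S) s₀ s ∧ s ∈ Γ ∧ s' ∈ Γ ∧ DifferAt s s' (Sum.inl t) ∧
    InSeg s t

theorem Step.symm {Γ : Set (LineIdx A B → Bool)} {S : Set (A × B)} {s t : LineIdx A B → Bool}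
    (h : Step Γ S s t) : Step Γ S t s := by
  obtain ⟨hs, ht, i, ⟨h1, h2⟩, h3⟩ := h
  refine ⟨ht, hs, i, ⟨h1.symm, fun k hk => (h2 k hk).symm⟩, fun e he hi hin => h3 e he hi ?_⟩
  subst hi
  exact ⟨(h2 _ (by simp)).trans hin.1, (h2 _ (by simp)).trans hin.2⟩

variable {P : A ⊕ B → ℝ × ℝ}

theorem side_eq_true_iff {p : ℝ × ℝ} {i : LineIdx A B} : side P p i = true ↔ 0 < lineFn P i p := by
  simp [side]

theorem side_eq_false_iff {p : ℝ × ℝ} {i : LineIdx A B} :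
    side P p i = false ↔ lineFn P i p ≤ 0 := by
  simp [side]

theorem lineFn_ne_zero_of_mem_segment {p q w : ℝ × ℝ} (hp : Generic P p) (hq : Generic P q)
    (hw : w ∈ segment ℝ p q) {k : LineIdx A B} (hk : side P p k = side P q k) :
    lineFn P k w ≠ 0 ∧ side P w k = side P p k := by
  obtain ⟨s, t, hs, ht, hst, rfl⟩ := hw
  have h := lineFn_combo P k hst p q
  simp only [side, decide_eq_decide] at hk ⊢
  rw [h]
  rcases lt_or_gt_of_ne (hp k) with hpk | hpk
  · have hqk : lineFn P k q < 0 := lt_of_le_of_ne (not_lt.mp (hk.not.mp hpk.not_gt)) (hq k)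
    have : s * lineFn P k p + t * lineFn P k q < 0 := by
      rcases hs.eq_or_lt with rfl | hs
      · rw [zero_add] at hst
        simpa [hst] using hqk
      · nlinarith [mul_neg_of_pos_of_neg hs hpk, mul_nonpos_of_nonneg_of_nonpos ht hqk.le]
    exact ⟨this.ne, iff_of_false this.not_gt hpk.not_gt⟩
  · have hqk : 0 < lineFn P k q := hk.mp hpk
    have : 0 < s * lineFn P k p + t * lineFn P k q := by
      rcases hs.eq_or_lt with rfl | hs
      · rw [zero_add] at hst
        simpa [hst] using hqk
      · nlinarith [mul_pos hs hpk, mul_nonneg ht hqk.le]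
    exact ⟨this.ne', iff_of_true this hpk⟩

theorem inSeg_side_of_mem_seg (hP : LeftRight P) {e : A × B} {w : ℝ × ℝ} (hw : w ∈ seg P e)
    (ha : lineFn P (Sum.inr (Sum.inl e.1)) w ≠ 0) : InSeg (side P w) e := by
  obtain ⟨-, h1, h2⟩ := (mem_seg_iff hP).mp hw
  simp only [lineFn] at ha
  simp only [InSeg, side_eq_true_iff, side_eq_false_iff, lineFn]
  exact ⟨lt_of_le_of_ne (by linarith) ha.symm, by linarith⟩

theorem segment_subset_free (hP : LeftRight P) {S : Set (A × B)} {p q : ℝ × ℝ}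
    (hp : Generic P p) (hq : Generic P q) {i : LineIdx A B}
    (hi : ∀ k, k ≠ i → side P p k = side P q k) (hS : ∀ e ∈ S, i = Sum.inl e → ¬ InSeg (side P p) e) :
    segment ℝ p q ⊆ free P S := by
  intro w hw hw'
  simp only [Set.mem_iUnion] at hw'
  obtain ⟨e, he, hwe⟩ := hw'
  have hei : i = Sum.inl e := by
    by_contra h
    exact (lineFn_ne_zero_of_mem_segment hp hq hw (hi (Sum.inl e) (Ne.symm h))).1
      ((mem_seg_iff hP).mp hwe).1
  subst hei
  have ha := lineFn_ne_zero_of_mem_segment hp hq hw (hi (Sum.inr (Sum.inl e.1)) (by simp))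
  have hb := lineFn_ne_zero_of_mem_segment hp hq hw (hi (Sum.inr (Sum.inr e.2)) (by simp))
  have := inSeg_side_of_mem_seg hP hwe ha.1
  exact hS e he rfl ⟨ha.2.symm.trans this.1, hb.2.symm.trans this.2⟩

theorem mem_component_of_segment {S : Set (A × B)} {o p q : ℝ × ℝ}
    (hp : p ∈ connectedComponentIn (free P S) o) (h : segment ℝ p q ⊆ free P S) :
    segment ℝ p q ⊆ connectedComponentIn (free P S) o := by
  rw [connectedComponentIn_eq hp]
  exact (convex_segment p q).isPreconnected.subset_connectedComponentIn (left_mem_segment ℝ p q) h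

theorem mem_component_of_reach (hP : LeftRight P) {S : Set (A × B)} {o p₀ : ℝ × ℝ}
    (hp₀ : p₀ ∈ connectedComponentIn (free P S) o) (hg₀ : Generic P p₀)
    {s : LineIdx A B → Bool} (hs : Relation.ReflTransGen (Step (cells P) S) (side P p₀) s) :
    ∀ p, Generic P p → side P p = s → p ∈ connectedComponentIn (free P S) o := by
  induction hs with
  | refl =>
    intro p hp hps
    refine mem_component_of_segment hp₀ ?_ (right_mem_segment ℝ p₀ p)
    intro w hw hw'
    simp only [Set.mem_iUnion] at hw'
    obtain ⟨e, he, hwe⟩ := hw'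
    exact (lineFn_ne_zero_of_mem_segment hg₀ hp hw (congrFun hps.symm (Sum.inl e))).1
      ((mem_seg_iff hP).mp hwe).1
  | tail _ hst ih =>
    rintro q hq rfl
    obtain ⟨⟨p, hp, rfl⟩, -, i, hd, hS⟩ := hst
    exact mem_component_of_segment (ih p hp rfl) (segment_subset_free hP hp hq hd.2 hS)
      (right_mem_segment ℝ p q)

/-- A segment meeting an open set meets it away from a given finite set. -/
theorem exists_mem_seg_diff_finite (hP : LeftRight P) {t : A × B} {U : Set (ℝ × ℝ)} (hU : IsOpen U)
    (h : (seg P t ∩ U).Nonempty) {X : Set (ℝ × ℝ)} (hXfin : X.Finite) :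
    ((seg P t ∩ U) \ X).Nonempty := by
  obtain ⟨w, hwt, hwU⟩ := h
  obtain ⟨z, hz, hzw⟩ : ∃ z ∈ seg P t, z ≠ w := by
    by_cases hw : P (Sum.inl t.1) = w
    · refine ⟨_, right_mem_segment ℝ _ _, fun h => ?_⟩
      have := hP t.1 t.2
      rw [h, hw] at this
      exact lt_irrefl _ this
    · exact ⟨_, left_mem_segment ℝ _ _, hw⟩
  have hc : Continuous fun δ : ℝ => (1 - δ) • w + δ • z := by fun_prop
  have hev : ∀ᶠ δ in nhds (0 : ℝ), (1 - δ) • w + δ • z ∈ U := by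
    refine hc.continuousAt.eventually (hU.mem_nhds ?_)
    simpa using hwU
  obtain ⟨r, hr, hball⟩ := Metric.eventually_nhds_iff.mp hev
  have hinj : Function.Injective fun δ : ℝ => (1 - δ) • w + δ • z := by
    intro δ δ' h
    have h' : (δ - δ') • (z - w) = 0 := by
      have : (1 - δ) • w + δ • z - ((1 - δ') • w + δ' • z) = 0 := sub_eq_zero.mpr h
      rw [← this]
      module
    rcases smul_eq_zero.mp h' with h' | h'
    · linarith
    · exact absurd (sub_eq_zero.mp h') hzw
  have hinf : ((fun δ : ℝ => (1 - δ) • w + δ • z) '' Set.Ioo 0 (min r 1)).Infinite :=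
    (Set.Ioo_infinite (lt_min hr one_pos)).image hinj.injOn
  obtain ⟨_, ⟨δ, hδ, rfl⟩, hX⟩ := hinf.exists_notMem_finite hXfin
  have h1 : δ < r := hδ.2.trans_le (min_le_left _ _)
  have h2 : δ < 1 := hδ.2.trans_le (min_le_right _ _)
  refine ⟨_, ⟨convex_segment _ _ hwt hz (by linarith) hδ.1.le (by ring), hball ?_⟩, hX⟩
  rwa [Real.dist_eq, sub_zero, abs_of_pos hδ.1]

/-- The segments of `G` touched, outside a set `X`, by the component of `o`. -/
def touched (P : A ⊕ B → ℝ × ℝ) (G : Set (A × B)) (o : ℝ × ℝ) (X : Set (ℝ × ℝ)) : Set (A × B) :=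
  {e ∈ G | ∃ r ∈ seg P e, r ∉ X ∧ r ∈ closure (connectedComponentIn (free P G) o)}

theorem free_anti (P : A ⊕ B → ℝ × ℝ) {S G : Set (A × B)} (h : S ⊆ G) : free P G ⊆ free P S :=
  Set.compl_subset_compl.mpr (Set.biUnion_subset_biUnion_left h)

variable [Fintype A] [Fintype B]

/-- Near a point, the nonvanishing functionals keep their sign. -/
theorem eventually_side_eq (P : A ⊕ B → ℝ × ℝ) (w : ℝ × ℝ) :
    ∀ᶠ p in nhds w, ∀ k, lineFn P k w ≠ 0 → lineFn P k p ≠ 0 ∧ side P p k = side P w k := by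
  rw [Filter.eventually_all]
  intro k
  by_cases hk : lineFn P k w = 0
  · simp [hk]
  rcases lt_or_gt_of_ne hk with h | h
  · filter_upwards [(continuous_lineFn P k).continuousAt.eventually_lt_const h] with p hp _
    exact ⟨hp.ne, by simp only [side, decide_eq_decide]; exact iff_of_false hp.not_gt h.not_gt⟩
  · filter_upwards [(continuous_lineFn P k).continuousAt.eventually_const_lt h] with p hp _
    exact ⟨hp.ne', by simp only [side, decide_eq_decide]; exact iff_of_true hp h⟩

theorem reach_of_mem_component (hP : Good P) {S : Set (A × B)} {o p₀ : ℝ × ℝ}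
    (hp₀ : p₀ ∈ connectedComponentIn (free P S) o) (hg₀ : Generic P p₀)
    {p : ℝ × ℝ} (hp : p ∈ connectedComponentIn (free P S) o) (hg : Generic P p) :
    Relation.ReflTransGen (Step (cells P) S) (side P p₀) (side P p) := by
  set F := connectedComponentIn (free P S) o with hF
  have hFo : IsOpen F := (isOpen_free P S).connectedComponentIn
  have hFsub : F ⊆ free P S := connectedComponentIn_subset _ _
  set Q := fun p => Relation.ReflTransGen (Step (cells P) S) (side P p₀) (side P p) with hQ
  have hconn := isPreconnected_connectedComponentIn.diff_finite_of_isOpen hFo (finite_crossings hP)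
  rw [isPreconnected_iff_subset_of_disjoint] at hconn
  have hgX : ∀ p, Generic P p → p ∉ crossings P := fun p hp ⟨i, _, _, h, _⟩ => hp i h
  have hcov : F \ crossings P ⊆ {w | ∀ᶠ p in nhds w, Generic P p → Q p} ∪
      {w | ∀ᶠ p in nhds w, Generic P p → ¬ Q p} := by
    rintro w ⟨hwF, hwX⟩
    have hev := eventually_side_eq P w
    have hpair : ∀ p q, (∀ k, lineFn P k w ≠ 0 → lineFn P k p ≠ 0 ∧ side P p k = side P w k) →
        (∀ k, lineFn P k w ≠ 0 → lineFn P k q ≠ 0 ∧ side P q k = side P w k) →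
        Generic P p → Generic P q → Q p → Q q := by
      intro p q hp hq hgp hgq hQp
      by_cases hpq : side P p = side P q
      · simpa [hQ, hpq] using hQp
      obtain ⟨i, hi⟩ := Function.ne_iff.mp hpq
      have hiw : lineFn P i w = 0 := by
        by_contra h
        exact hi ((hp i h).2.trans (hq i h).2.symm)
      have hother : ∀ k, k ≠ i → lineFn P k w ≠ 0 := fun k hk h => hwX ⟨k, i, hk, h, hiw⟩
      refine hQp.tail ⟨⟨p, hgp, rfl⟩, ⟨q, hgq, rfl⟩, i, ⟨hi, fun k hk =>
        (hp k (hother k hk)).2.trans (hq k (hother k hk)).2.symm⟩, ?_⟩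
      rintro e he rfl ⟨h1, h2⟩
      rw [(hp _ (hother _ (by simp))).2] at h1 h2
      simp only [side_eq_true_iff, side_eq_false_iff, lineFn] at h1 h2
      refine hFsub hwF (Set.mem_biUnion he ((mem_seg_iff hP.leftRight).mpr ⟨hiw, ?_, ?_⟩)) <;>
        linarith
    by_cases hex : ∃ q, (∀ k, lineFn P k w ≠ 0 → lineFn P k q ≠ 0 ∧ side P q k = side P w k) ∧
        Generic P q ∧ Q q
    · obtain ⟨q, hq, hgq, hQq⟩ := hex
      left
      change ∀ᶠ p in nhds w, Generic P p → Q p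
      filter_upwards [hev] with p hp hgp
      exact hpair q p hq hp hgq hgp hQq
    · right
      change ∀ᶠ p in nhds w, Generic P p → ¬ Q p
      filter_upwards [hev] with p hp hgp hQp
      exact hex ⟨p, hp, hgp, hQp⟩
  have hdisj : F \ crossings P ∩ ({w | ∀ᶠ p in nhds w, Generic P p → Q p} ∩
      {w | ∀ᶠ p in nhds w, Generic P p → ¬ Q p}) = ∅ := by
    rw [Set.eq_empty_iff_forall_notMem]
    rintro w ⟨-, h1, h2⟩
    obtain ⟨U, hU, hUo, hwU⟩ := eventually_nhds_iff.mp (Filter.Eventually.and h1 h2)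
    obtain ⟨q, hqU, hq⟩ := exists_generic_mem hP.leftRight hUo ⟨w, hwU⟩
    exact (hU q hqU).2 hq ((hU q hqU).1 hq)
  rcases hconn _ _ isOpen_setOfPred_eventually_nhds isOpen_setOfPred_eventually_nhds hcov hdisj with h | h
  · have := h ⟨hp, hgX p hg⟩
    exact (Filter.Eventually.self_of_nhds this) hg
  · have := h ⟨hp₀, hgX p₀ hg₀⟩
    exact absurd Relation.ReflTransGen.refl ((Filter.Eventually.self_of_nhds this) hg₀)

theorem hits_iff (hP : Good P) {S : Set (A × B)} {o p₀ : ℝ × ℝ}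
    (hp₀ : p₀ ∈ connectedComponentIn (free P S) o) (hg₀ : Generic P p₀) {t : A × B} (ht : t ∉ S) :
    Hits (cells P) S (side P p₀) t ↔ (seg P t ∩ connectedComponentIn (free P S) o).Nonempty := by
  constructor
  · rintro ⟨_, _, hreach, ⟨p, hp, rfl⟩, ⟨q, hq, rfl⟩, hd, hin⟩
    have hsub := mem_component_of_segment
      (mem_component_of_reach hP.leftRight hp₀ hg₀ hreach p hp rfl)
      (segment_subset_free (S := S) hP.leftRight hp hq hd.2
        (fun e he hte => absurd (Sum.inl_injective hte) fun h => ht (h ▸ he)))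
    obtain ⟨w, hw, hw0⟩ : ∃ w ∈ segment ℝ p q, lineFn P (Sum.inl t) w = 0 := by
      have hc := (convex_segment p q).isPreconnected.image _
        (continuous_lineFn P (Sum.inl t)).continuousOn
      have h0 : (0 : ℝ) ∈ lineFn P (Sum.inl t) '' segment ℝ p q := by
        have hpm := Set.mem_image_of_mem (lineFn P (Sum.inl t)) (left_mem_segment ℝ p q)
        have hqm := Set.mem_image_of_mem (lineFn P (Sum.inl t)) (right_mem_segment ℝ p q)
        have hne := hd.1
        simp only [side, ne_eq, decide_eq_decide] at hne
        by_cases h : 0 < lineFn P (Sum.inl t) p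
        · exact hc.ordConnected.out hqm hpm ⟨not_lt.mp fun h' => hne (iff_of_true h h'), h.le⟩
        · refine hc.ordConnected.out hpm hqm ⟨not_lt.mp h, le_of_lt ?_⟩
          by_contra h'
          exact hne (iff_of_false h h')
      exact h0
    refine ⟨w, (mem_seg_iff hP.leftRight).mpr ⟨hw0, ?_⟩, hsub hw⟩
    have ha := (lineFn_ne_zero_of_mem_segment hp hq hw (hd.2 (Sum.inr (Sum.inl t.1)) (by simp))).2
    have hb := (lineFn_ne_zero_of_mem_segment hp hq hw (hd.2 (Sum.inr (Sum.inr t.2)) (by simp))).2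
    have h1 := ha.trans hin.1
    have h2 := hb.trans hin.2
    simp only [side_eq_true_iff, side_eq_false_iff, lineFn] at h1 h2
    constructor <;> linarith
  · intro hne
    have hFo : IsOpen (connectedComponentIn (free P S) o) := (isOpen_free P S).connectedComponentIn
    obtain ⟨w, ⟨hwt, hwF⟩, hwX⟩ := exists_mem_seg_diff_finite hP.leftRight hFo hne (finite_crossings hP)
    have hw0 := ((mem_seg_iff hP.leftRight).mp hwt).1
    have hother : ∀ k, k ≠ Sum.inl t → lineFn P k w ≠ 0 := fun k hk h => hwX ⟨k, _, hk, h, hw0⟩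
    have hev := (eventually_side_eq P w).and (hFo.mem_nhds hwF)
    have hc : Filter.Tendsto (fun δ : ℝ => (w.1, w.2 + δ)) (nhds 0) (nhds w) := by
      have : Continuous fun δ : ℝ => (w.1, w.2 + δ) := by fun_prop
      simpa using this.tendsto 0
    obtain ⟨r, hr, hball⟩ := Metric.eventually_nhds_iff.mp (hc.eventually hev)
    have hup := hball (y := r / 2) (by rw [Real.dist_eq, sub_zero, abs_of_pos] <;> linarith)
    have hdn := hball (y := -(r / 2)) (by
      rw [Real.dist_eq, sub_zero, abs_neg, abs_of_pos] <;> linarith)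
    have hval : ∀ δ : ℝ, lineFn P (Sum.inl t) (w.1, w.2 + δ) = run (fun v => (P v).1) t * δ := by
      intro δ
      simp only [lineFn] at hw0 ⊢
      linarith
    have hrun := run_pos hP.leftRight t
    have hup0 : 0 < lineFn P (Sum.inl t) (w.1, w.2 + r / 2) := by
      rw [hval]
      positivity
    have hdn0 : lineFn P (Sum.inl t) (w.1, w.2 + -(r / 2)) < 0 := by
      rw [hval]
      nlinarith
    have hgup : Generic P (w.1, w.2 + r / 2) := fun k => by
      by_cases hk : k = Sum.inl t
      · rw [hk]; exact hup0.ne'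
      · exact (hup.1 k (hother k hk)).1
    have hgdn : Generic P (w.1, w.2 + -(r / 2)) := fun k => by
      by_cases hk : k = Sum.inl t
      · rw [hk]; exact hdn0.ne
      · exact (hdn.1 k (hother k hk)).1
    refine ⟨_, _, reach_of_mem_component hP hp₀ hg₀ hup.2 hgup, ⟨_, hgup, rfl⟩, ⟨_, hgdn, rfl⟩,
      ⟨?_, fun k hk => (hup.1 k (hother k hk)).2.trans (hdn.1 k (hother k hk)).2.symm⟩, ?_⟩
    · simp [side, hup0, hdn0.le]
    · have := inSeg_side_of_mem_seg hP.leftRight hwt (hother _ (by simp))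
      exact ⟨(hup.1 _ (hother _ (by simp))).2.trans this.1,
        (hup.1 _ (hother _ (by simp))).2.trans this.2⟩

/-- The touched segments of `G` determine the component, up to finitely many points. -/
theorem seg_disjoint_component (hP : LeftRight P) {G S : Set (A × B)} {o : ℝ × ℝ}
    (ho : o ∈ free P G) {X : Set (ℝ × ℝ)} (hX : X.Finite) (hS : touched P G o X ⊆ S) (hSG : S ⊆ G)
    {t : A × B} (ht : t ∈ G) : Disjoint (seg P t) (connectedComponentIn (free P S) o) := by
  set F := connectedComponentIn (free P G) o with hF
  set C := connectedComponentIn (free P S) o with hC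
  have hFo : IsOpen F := (isOpen_free P G).connectedComponentIn
  have hCo : IsOpen C := (isOpen_free P S).connectedComponentIn
  have hFC : F ⊆ C := connectedComponentIn_mono o (free_anti P hSG)
  have hoF : o ∈ F := mem_connectedComponentIn ho
  have hsub : C \ X ⊆ F := by
    have hconn := isPreconnected_iff_subset_of_disjoint.mp
      (isPreconnected_connectedComponentIn.diff_finite_of_isOpen hCo hX) F (closure F)ᶜ hFo
      isClosed_closure.isOpen_compl ?_ ?_
    · refine hconn.resolve_right fun h => ?_
      have hinf : ((F : Set (ℝ × ℝ)) \ X).Nonempty := by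
        rw [Set.nonempty_iff_ne_empty]
        intro h0
        have hfin : F.Finite := hX.subset (Set.sdiff_eq_empty.mp h0)
        exact infinite_of_mem_nhds o (hFo.mem_nhds hoF) hfin
      obtain ⟨p, hpF, hpX⟩ := hinf
      exact h ⟨hFC hpF, hpX⟩ (subset_closure hpF)
    · rintro r ⟨hrC, hrX⟩
      by_cases hrF : r ∈ closure F
      · left
        by_cases hrG : r ∈ free P G
        · have hro : IsOpen (connectedComponentIn (free P G) r) :=
            (isOpen_free P G).connectedComponentIn
          obtain ⟨p, hpr, hpF⟩ := mem_closure_iff.mp hrF _ hro (mem_connectedComponentIn hrG)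
          rw [hF, connectedComponentIn_eq hpF, ← connectedComponentIn_eq hpr]
          exact mem_connectedComponentIn hrG
        · simp only [free, Set.mem_compl_iff, not_not, Set.mem_iUnion] at hrG
          obtain ⟨e, he, hre⟩ := hrG
          exact absurd (Set.mem_biUnion (hS ⟨he, r, hre, hrX, hrF⟩) hre)
            (connectedComponentIn_subset _ _ hrC)
      · exact Or.inr hrF
    · rw [Set.eq_empty_iff_forall_notMem]
      rintro r ⟨-, h1, h2⟩
      exact h2 (subset_closure h1)
  rw [Set.disjoint_iff_inter_eq_empty]
  by_contra hne
  obtain ⟨w, ⟨hwt, hwC⟩, hwX⟩ := exists_mem_seg_diff_finite hP hCo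
    (Set.nonempty_iff_ne_empty.mpr hne) hX
  exact connectedComponentIn_subset _ _ (hsub ⟨hwC, hwX⟩) (Set.mem_biUnion ht hwt)

end CrossDrawing

end

section

/-- Counting the edges of a bipartite graph whose edges carry levels. -/
theorem card_le_of_levels {A B : Type} [Fintype A] [Fintype B] (S : Finset (A × B))
    (γ : A × B → ℕ) (y : A × B → ℝ) (M : ℕ) (hM : ∀ e ∈ S, γ e ≤ M)
    (hrow : ∀ a b b', (a, b) ∈ S → (a, b') ∈ S → γ (a, b) = γ (a, b') → b = b')
    (hcol : ∀ a a' b, (a, b) ∈ S → (a', b) ∈ S → y (a, b) = y (a', b) → a = a')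
    (Lc : ℕ → Prop)
    (hL : ∀ a b b', (a, b) ∈ S → (a, b') ∈ S → Lc (γ (a, b)) → Lc (γ (a, b')) →
      γ (a, b) = γ (a, b'))
    (hR : ∀ a a' b, (a, b) ∈ S → (a', b) ∈ S → ¬ Lc (γ (a, b)) → ¬ Lc (γ (a', b)) →
      γ (a, b) = γ (a', b))
    (hcross : ∀ a a' b b₁ b₂, (a, b) ∈ S → (a', b) ∈ S → (a, b₁) ∈ S → (a', b₂) ∈ S →
      y (a', b) < y (a, b) → γ (a, b) = γ (a', b) → γ (a, b₁) < γ (a, b) →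
      γ (a, b₁) < γ (a', b₂)) :
    S.card ≤ Fintype.card A + Fintype.card A * (Nat.log 2 M + 2) +
      Fintype.card B * (Nat.log 2 M + 1) := by
  let lo : A → ℕ := fun a => sInf {g | ∃ b, (a, b) ∈ S ∧ γ (a, b) = g}
  have hlo : ∀ a b, (a, b) ∈ S → lo a ≤ γ (a, b) := fun a b h => Nat.sInf_le ⟨b, h, rfl⟩
  have hlo' : ∀ a b, (a, b) ∈ S → ∃ b', (a, b') ∈ S ∧ γ (a, b') = lo a := fun a b h =>
    Nat.sInf_mem (s := {g | ∃ b, (a, b) ∈ S ∧ γ (a, b) = g}) ⟨_, b, h, rfl⟩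
  let Dbl : A × B → Prop := fun e => ∀ b, (e.1, b) ∈ S → γ (e.1, b) < γ e →
    2 * (γ (e.1, b) - lo e.1) ≤ γ e - lo e.1
  have h1 : (S.filter fun e => Lc (γ e)).card ≤ Fintype.card A := by
    refine Finset.card_le_card_of_injOn (t := Finset.univ) Prod.fst (fun _ _ => Finset.mem_univ _) ?_
    rintro ⟨a, b⟩ he ⟨a', b'⟩ he' rfl
    simp only [Finset.coe_filter, Set.mem_ofPred_eq] at he he'
    rw [hrow a b b' he.1 he'.1 (hL a b b' he.1 he'.1 he.2 he'.2)]
  have h2 : (S.filter fun e => Dbl e).card ≤ Fintype.card A * (Nat.log 2 M + 2) := by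
    have := Finset.card_le_card_of_injOn (s := S.filter fun e => Dbl e)
      (t := (Finset.univ : Finset A) ×ˢ Finset.range (Nat.log 2 M + 2))
      (fun e => (e.1, if γ e - lo e.1 = 0 then 0 else Nat.log 2 (γ e - lo e.1) + 1)) ?_ ?_
    · simpa using this
    · intro e he
      simp only [Finset.coe_filter, Set.mem_ofPred_eq] at he
      simp only [Finset.coe_product, Finset.coe_univ, Finset.coe_range, Set.mem_prod, Set.mem_univ,
        true_and, Set.mem_Iio]
      have : Nat.log 2 (γ e - lo e.1) ≤ Nat.log 2 M :=
        Nat.log_mono_right ((Nat.sub_le _ _).trans (hM e he.1))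
      split_ifs <;> omega
    · have key : ∀ a b b', (a, b) ∈ S → (a, b') ∈ S → Dbl (a, b') → γ (a, b) < γ (a, b') →
          (if γ (a, b) - lo a = 0 then 0 else Nat.log 2 (γ (a, b) - lo a) + 1) <
          (if γ (a, b') - lo a = 0 then 0 else Nat.log 2 (γ (a, b') - lo a) + 1) := by
        intro a b b' h h' hd hlt
        have h2 := hd b h hlt
        have h3 := hlo a b h
        have h4 := hlo a b' h'
        simp only at h2
        rw [if_neg (show γ (a, b') - lo a ≠ 0 by omega)]
        split_ifs with h0
        · omega
        · have : Nat.log 2 ((γ (a, b) - lo a) * 2) ≤ Nat.log 2 (γ (a, b') - lo a) :=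
            Nat.log_mono_right (by omega)
          rw [Nat.log_mul_base (by norm_num) h0] at this
          omega
      rintro ⟨a, b⟩ he ⟨a', b'⟩ he' heq
      simp only [Finset.coe_filter, Set.mem_ofPred_eq] at he he'
      simp only [Prod.mk.injEq] at heq
      obtain ⟨rfl, heq⟩ := heq
      rcases lt_trichotomy (γ (a, b)) (γ (a, b')) with h | h | h
      · exact absurd heq (key a b b' he.1 he'.1 he'.2 h).ne
      · rw [hrow a b b' he.1 he'.1 h]
      · exact absurd heq (key a b' b he'.1 he.1 he.2 h).ne'
  have h3 : (S.filter fun e => ¬ Lc (γ e) ∧ ¬ Dbl e).card ≤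
      Fintype.card B * (Nat.log 2 M + 1) := by
    have hwit : ∀ e : A × B, ∃ p : ℕ, ¬ Dbl e → (∃ b, (e.1, b) ∈ S ∧ γ (e.1, b) = p) ∧ p < γ e ∧
        γ e - lo e.1 < 2 * (p - lo e.1) := by
      intro e
      by_cases h : Dbl e
      · exact ⟨0, fun h' => absurd h h'⟩
      · simp only [Dbl] at h
        push Not at h
        obtain ⟨b, hb, hlt, hb'⟩ := h
        exact ⟨γ (e.1, b), fun _ => ⟨⟨b, hb, rfl⟩, hlt, hb'⟩⟩
    choose p hp using hwit
    have := Finset.card_le_card_of_injOn (s := S.filter fun e => ¬ Lc (γ e) ∧ ¬ Dbl e)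
      (t := (Finset.univ : Finset B) ×ˢ Finset.range (Nat.log 2 M + 1))
      (fun e => (e.2, Nat.log 2 (γ e - p e))) ?_ ?_
    · simpa using this
    · intro e he
      simp only [Finset.coe_filter, Set.mem_ofPred_eq] at he
      simp only [Finset.coe_product, Finset.coe_univ, Finset.coe_range, Set.mem_prod, Set.mem_univ,
        true_and, Set.mem_Iio]
      have : Nat.log 2 (γ e - p e) ≤ Nat.log 2 M :=
        Nat.log_mono_right ((Nat.sub_le _ _).trans (hM e he.1))
      omega
    · have key : ∀ a a' b, (a, b) ∈ S → (a', b) ∈ S → ¬ Dbl (a, b) → ¬ Dbl (a', b) →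
          γ (a, b) = γ (a', b) → y (a', b) < y (a, b) →
          Nat.log 2 (γ (a', b) - p (a', b)) < Nat.log 2 (γ (a, b) - p (a, b)) := by
        intro a a' b h h' hd hd' hg hlt
        obtain ⟨⟨b₁, hb₁, hpb₁⟩, hp1, hp2⟩ := hp (a, b) hd
        obtain ⟨-, hp1', hp2'⟩ := hp (a', b) hd'
        obtain ⟨b₂, hb₂, hlob₂⟩ := hlo' a' b h'
        have hc := hcross a a' b b₁ b₂ h h' hb₁ hb₂ hlt hg (by simp only at hpb₁; omega)
        simp only at hpb₁ hp2' hp2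
        have : Nat.log 2 ((γ (a', b) - p (a', b)) * 2) ≤ Nat.log 2 (γ (a, b) - p (a, b)) :=
          Nat.log_mono_right (by omega)
        rw [Nat.log_mul_base (by norm_num) (by omega)] at this
        omega
      rintro ⟨a, b⟩ he ⟨a', b'⟩ he' heq
      simp only [Finset.coe_filter, Set.mem_ofPred_eq] at he he'
      simp only [Prod.mk.injEq] at heq
      obtain ⟨rfl, heq⟩ := heq
      have hg := hR a a' b he.1 he'.1 he.2.1 he'.2.1
      rcases lt_trichotomy (y (a, b)) (y (a', b)) with h | h | h
      · exact absurd heq (key a' a b he'.1 he.1 he'.2.2 he.2.2 hg.symm h).ne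
      · rw [hcol a a' b he.1 he'.1 h]
      · exact absurd heq (key a a' b he.1 he'.1 he.2.2 he'.2.2 hg h).ne'
  have hsub : S ⊆ (S.filter fun e => Lc (γ e)) ∪ (S.filter fun e => Dbl e) ∪
      (S.filter fun e => ¬ Lc (γ e) ∧ ¬ Dbl e) := by
    intro e he
    simp only [Finset.mem_union, Finset.mem_filter, he, true_and]
    tauto
  have := (Finset.card_le_card hsub).trans ((Finset.card_union_le _ _).trans
    (Nat.add_le_add_right (Finset.card_union_le _ _) _))
  omega

/-- If a function on a finite set vanishes as soon as its sums over the classes of two partitions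
vanish, then the elements can be charged injectively to their classes. -/
theorem exists_charging {Γ Q₁ Q₂ : Type} [Fintype Γ] [Fintype Q₁] [Fintype Q₂]
    (π₁ : Γ → Q₁) (π₂ : Γ → Q₂)
    (h : ∀ f : Γ → ℝ, (∀ q, ∑ g with π₁ g = q, f g = 0) → (∀ q, ∑ g with π₂ g = q, f g = 0) →
      f = 0) :
    ∃ φ : Γ → Q₁ ⊕ Q₂, Function.Injective φ ∧ ∀ g, φ g = Sum.inl (π₁ g) ∨ φ g = Sum.inr (π₂ g) := by
  have hall := (Finset.all_card_le_biUnion_card_iff_exists_injective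
    fun g : Γ => ({Sum.inl (π₁ g), Sum.inr (π₂ g)} : Finset (Q₁ ⊕ Q₂))).mp ?_
  · obtain ⟨φ, hφ, hφ'⟩ := hall
    exact ⟨φ, hφ, fun g => by simpa using hφ' g⟩
  intro X
  set N := X.biUnion fun g : Γ => ({Sum.inl (π₁ g), Sum.inr (π₂ g)} : Finset (Q₁ ⊕ Q₂)) with hN
  let ext : (X → ℝ) → Γ → ℝ := fun f g => if hg : g ∈ X then f ⟨g, hg⟩ else 0
  let L : (X → ℝ) →ₗ[ℝ] (N → ℝ) :=
    { toFun := fun f n => Sum.elim (fun q => ∑ g with π₁ g = q, ext f g)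
        (fun q => ∑ g with π₂ g = q, ext f g) n.1
      map_add' := by
        intro f f'
        have hadd : ∀ g, ext (f + f') g = ext f g + ext f' g := by
          intro g
          by_cases hg : g ∈ X <;> simp [ext, hg]
        ext ⟨q | q, hq⟩ <;> simp [hadd, Finset.sum_add_distrib]
      map_smul' := by
        intro c f
        have hsmul : ∀ g, ext (c • f) g = c * ext f g := by
          intro g
          by_cases hg : g ∈ X <;> simp [ext, hg]
        ext ⟨q | q, hq⟩ <;> simp [hsmul, Finset.mul_sum] }
  have hinj : Function.Injective L := by
    rw [injective_iff_map_eq_zero]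
    intro f hf
    have h0 : ext f = 0 := by
      refine h _ (fun q => ?_) (fun q => ?_)
      · by_cases hq : Sum.inl q ∈ N
        · exact congrFun hf ⟨_, hq⟩
        · refine Finset.sum_eq_zero fun g hg => dif_neg fun hgX => hq ?_
          simp only [Finset.mem_filter, Finset.mem_univ, true_and] at hg
          rw [hN, Finset.mem_biUnion]
          exact ⟨g, hgX, by simp [hg]⟩
      · by_cases hq : Sum.inr q ∈ N
        · exact congrFun hf ⟨_, hq⟩
        · refine Finset.sum_eq_zero fun g hg => dif_neg fun hgX => hq ?_
          simp only [Finset.mem_filter, Finset.mem_univ, true_and] at hg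
          rw [hN, Finset.mem_biUnion]
          exact ⟨g, hgX, by simp [hg]⟩
    ext g
    have := congrFun h0 g
    simpa [ext] using this
  have := LinearMap.finrank_le_finrank_of_injective hinj
  simpa using this

end

section

/-- Nonvertical lines through pairs of points on the two sides of the vertical axis. -/
structure Fan (A B : Type) where
  xl : A → ℝ
  yl : A → ℝ
  xr : B → ℝ
  yr : B → ℝ
  slope : A × B → ℝ
  y : A × B → ℝ
  xl_neg : ∀ a, xl a < 0
  xr_pos : ∀ b, 0 < xr b
  on_left : ∀ a b, slope (a, b) * xl a + y (a, b) = yl a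
  on_right : ∀ a b, slope (a, b) * xr b + y (a, b) = yr b
  y_row : ∀ a b b', y (a, b) = y (a, b') → b = b'
  y_col : ∀ a a' b, y (a, b) = y (a', b) → a = a'

/-- A preconnected set which avoids the two sides of a wedge up to its apex lies inside the
wedge or outside of it. -/
theorem wedge_dichotomy {Q : Set (ℝ × ℝ)} (hQ : IsPreconnected Q) {x₀ y₀ m y m' y' : ℝ}
    (h : m * x₀ + y = y₀) (h' : m' * x₀ + y' = y₀) (hy : y < y')
    (hav : ∀ p ∈ Q, p.2 = m * p.1 + y → 0 < (p.1 - x₀) * x₀)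
    (hav' : ∀ p ∈ Q, p.2 = m' * p.1 + y' → 0 < (p.1 - x₀) * x₀)
    {p q : ℝ × ℝ} (hp : p ∈ Q) (hq : q ∈ Q) (hpy : m * p.1 + y < p.2) (hpy' : p.2 < m' * p.1 + y') :
    m * q.1 + y < q.2 ∧ q.2 < m' * q.1 + y' := by
  let V₁ : Set (ℝ × ℝ) := {p | m * p.1 + y < p.2} ∩ {p | p.2 < m' * p.1 + y'}
  let V₂ : Set (ℝ × ℝ) := {p | p.2 < m * p.1 + y} ∪ {p | m' * p.1 + y' < p.2} ∪
    {p | 0 < (p.1 - x₀) * x₀}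
  have ho₁ : IsOpen V₁ := (isOpen_lt (by fun_prop) (by fun_prop)).inter
    (isOpen_lt (by fun_prop) (by fun_prop))
  have ho₂ : IsOpen V₂ := ((isOpen_lt (by fun_prop) (by fun_prop)).union
    (isOpen_lt (by fun_prop) (by fun_prop))).union (isOpen_lt (by fun_prop) (by fun_prop))
  have hmx : (m' - m) * x₀ < 0 := by nlinarith
  have hd : ∀ x : ℝ, m' * x + y' - (m * x + y) = (m' - m) * (x - x₀) := by
    intro x; linear_combination h' - h
  have hcov : Q ⊆ V₁ ∪ V₂ := by
    intro p hp
    rcases lt_trichotomy p.2 (m * p.1 + y) with h1 | h1 | h1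
    · exact Or.inr (Or.inl (Or.inl h1))
    · exact Or.inr (Or.inr (hav p hp h1))
    rcases lt_trichotomy p.2 (m' * p.1 + y') with h2 | h2 | h2
    · exact Or.inl ⟨h1, h2⟩
    · exact Or.inr (Or.inr (hav' p hp h2))
    · exact Or.inr (Or.inl (Or.inr h2))
  have hdis : Q ∩ (V₁ ∩ V₂) = ∅ := by
    rw [Set.eq_empty_iff_forall_notMem]
    rintro p ⟨-, ⟨h1, h2⟩, (h3 | h3) | h3⟩
    · exact lt_asymm h1 (show p.2 < m * p.1 + y from h3)
    · exact lt_asymm h2 (show m' * p.1 + y' < p.2 from h3)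
    · have h1 : m * p.1 + y < p.2 := h1
      have h2 : p.2 < m' * p.1 + y' := h2
      have h3 : 0 < (p.1 - x₀) * x₀ := h3
      have := hd p.1
      have h4 : 0 < (m' - m) * (p.1 - x₀) := by linarith
      nlinarith [mul_pos h4 h3, mul_nonneg (sq_nonneg (p.1 - x₀)) (neg_nonneg.mpr hmx.le)]
  rcases isPreconnected_iff_subset_of_disjoint.mp hQ V₁ V₂ ho₁ ho₂ hcov hdis with h | h
  · exact h hq
  · exact (Set.eq_empty_iff_forall_notMem.mp hdis p ⟨hp, ⟨hpy, hpy'⟩, h hp⟩).elim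

/-- In an open preconnected set, a point of an open set `U` can be joined to the frontier of `U`
inside `U`. -/
theorem exists_preconnected_to_frontier {F U : Set (ℝ × ℝ)} (hF : IsOpen F) (hc : IsPreconnected F)
    (hU : IsOpen U) {f : ℝ × ℝ} (hf : f ∈ F) (hfU : f ∈ U) (hFU : ¬ F ⊆ U) :
    ∃ p ∈ F, p ∉ U ∧ p ∈ closure U ∧ ∃ Q ⊆ F ∩ insert p U, IsPreconnected Q ∧ f ∈ Q ∧ p ∈ Q := by
  set C := connectedComponentIn (F ∩ U) f with hC
  have hfC : f ∈ C := mem_connectedComponentIn ⟨hf, hfU⟩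
  have hCs : C ⊆ F ∩ U := connectedComponentIn_subset _ _
  have hCo : IsOpen C := (hF.inter hU).connectedComponentIn
  have hCp : IsPreconnected C := isPreconnected_connectedComponentIn
  have hins : ∀ p ∈ closure C, IsPreconnected (insert p C) := fun p hp =>
    hCp.subset_closure (Set.subset_insert _ _) (Set.insert_subset hp subset_closure)
  by_contra hcon
  have hcl : F ∩ closure C ⊆ C := by
    rintro p ⟨hpF, hpC⟩
    by_cases hpU : p ∈ U
    · exact (hins p hpC).subset_connectedComponentIn (Set.mem_insert_of_mem _ hfC)
        (Set.insert_subset (show p ∈ F ∩ U from ⟨hpF, hpU⟩) hCs) (Set.mem_insert _ _)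
    · exact (hcon ⟨p, hpF, hpU, closure_mono (hCs.trans Set.inter_subset_right) hpC, insert p C,
        Set.insert_subset ⟨hpF, Set.mem_insert _ _⟩ fun q hq =>
          ⟨(hCs hq).1, Set.mem_insert_of_mem _ (hCs hq).2⟩, hins p hpC,
        Set.mem_insert_of_mem _ hfC, Set.mem_insert _ _⟩).elim
  have hcov : F ⊆ C ∪ (closure C)ᶜ := by
    intro p hp
    by_cases h : p ∈ closure C
    · exact Or.inl (hcl (Set.mem_inter hp h))
    · exact Or.inr h
  rcases isPreconnected_iff_subset_of_disjoint.mp hc C (closure C)ᶜ hCo isClosed_closure.isOpen_compl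
    hcov (by
      rw [Set.eq_empty_iff_forall_notMem]
      rintro p ⟨-, h1, h2⟩
      exact h2 (subset_closure h1)) with h | h
  · exact hFU fun p hp => (hCs (h hp)).2
  · exact h hf (subset_closure hfC)

/-- Two points are joined inside the trace of `F` on one side of the vertical axis. -/
def Linked (F : Set (ℝ × ℝ)) (σ : ℝ) (p q : ℝ × ℝ) : Prop :=
  ∃ Q ⊆ F, (∀ r ∈ Q, 0 ≤ σ * r.1) ∧ IsPreconnected Q ∧ p ∈ Q ∧ q ∈ Q

theorem Linked.symm {F σ p q} (h : Linked F σ p q) : Linked F σ q p := by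
  obtain ⟨Q, h1, h2, h3, h4, h5⟩ := h
  exact ⟨Q, h1, h2, h3, h5, h4⟩

theorem Linked.trans {F σ p q r} (h : Linked F σ p q) (h' : Linked F σ q r) : Linked F σ p r := by
  obtain ⟨Q, h1, h2, h3, h4, h5⟩ := h
  obtain ⟨Q', h1', h2', h3', h4', h5'⟩ := h'
  exact ⟨Q ∪ Q', Set.union_subset h1 h1', fun r hr => hr.elim (h2 r) (h2' r),
    h3.union q h5 h4' h3', Or.inl h4, Or.inr h5'⟩

theorem linked_self {F : Set (ℝ × ℝ)} {σ p} (hp : p ∈ F) (hσ : 0 ≤ σ * p.1) : Linked F σ p p :=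
  ⟨{p}, by simpa, by simpa, isPreconnected_singleton, rfl, rfl⟩

theorem exists_linked_axis {F : Set (ℝ × ℝ)} (hF : IsOpen F) (hc : IsPreconnected F) {z₀ : ℝ}
    (hz₀ : (0, z₀) ∈ F) {σ : ℝ} (hσ : σ ≠ 0) {p : ℝ × ℝ} (hp : p ∈ F) (hpσ : 0 ≤ σ * p.1) :
    ∃ z, (0, z) ∈ F ∧ Linked F σ p (0, z) := by
  rcases hpσ.lt_or_eq with h | h
  · obtain ⟨q, hqF, hqU, hqc, Q, hQ, hQp, hpQ, hqQ⟩ := exists_preconnected_to_frontier hF hc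
      (U := {q | 0 < σ * q.1}) (isOpen_lt (by fun_prop) (by fun_prop)) hp h
      fun h => by simpa using h hz₀
    have hq0 : 0 ≤ σ * q.1 := by
      have : closure {q : ℝ × ℝ | 0 < σ * q.1} ⊆ {q | 0 ≤ σ * q.1} :=
        closure_minimal (fun q (hq : 0 < σ * q.1) => show 0 ≤ σ * q.1 from hq.le) (isClosed_le (by fun_prop) (by fun_prop))
      exact this hqc
    have hq1 : q.1 = 0 := by
      have : ¬ 0 < σ * q.1 := hqU
      have : σ * q.1 = 0 := by linarith
      exact (mul_eq_zero.mp this).resolve_left hσ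
    have hq : q = (0, q.2) := Prod.ext hq1 rfl
    refine ⟨q.2, hq ▸ hqF, Q, fun r hr => (hQ hr).1, fun r hr => ?_, hQp, hpQ, hq ▸ hqQ⟩
    rcases (hQ hr).2 with rfl | h
    · exact hq0
    · exact le_of_lt h
  · have hp1 : p.1 = 0 := (mul_eq_zero.mp h.symm).resolve_left hσ
    have hq : p = (0, p.2) := Prod.ext hp1 rfl
    refine ⟨p.2, hq ▸ hp, ?_⟩
    rw [← hq]
    exact linked_self hp hpσ

/-- A function on the trace of `F` on the axis which agrees on linked points is constant. -/
theorem constant_of_linked {F : Set (ℝ × ℝ)} (hF : IsOpen F) (hc : IsPreconnected F)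
    (W : ℝ → ℝ) (hW : ∀ σ : ℝ, (σ = 1 ∨ σ = -1) → ∀ z z', Linked F σ (0, z) (0, z') → W z = W z')
    {z z' : ℝ} (hz : (0, z) ∈ F) (hz' : (0, z') ∈ F) : W z = W z' := by
  let S : Set ℝ := {σ | σ = 1 ∨ σ = -1}
  have hS0 : ∀ σ ∈ S, σ ≠ 0 := by rintro σ (rfl | rfl) <;> norm_num
  let K : ℝ × ℝ → ℝ → Prop := fun p z => ∃ σ ∈ S, Linked F σ p (0, z)
  have hK : ∀ p ∈ F, ∀ z z', K p z → K p z' → W z = W z' := by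
    rintro p hp z z' ⟨σ, hσ, h⟩ ⟨σ', hσ', h'⟩
    by_cases hσσ : σ = σ'
    · subst hσσ
      exact hW σ hσ _ _ (h.symm.trans h')
    · have hp1 : p.1 = 0 := by
        obtain ⟨Q, -, h1, -, h2, -⟩ := h
        obtain ⟨Q', -, h1', -, h2', -⟩ := h'
        have := h1 p h2
        have := h1' p h2'
        rcases hσ with rfl | rfl <;> rcases hσ' with rfl | rfl <;>
          first | (exact absurd rfl hσσ) | linarith
      have hp' : p = (0, p.2) := Prod.ext hp1 rfl
      rw [hp'] at h h'
      rw [← hW σ hσ _ _ h, hW σ' hσ' _ _ h']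
  have hKe : ∀ p ∈ F, ∃ z, K p z := by
    intro p hp
    rcases le_total 0 p.1 with h | h
    · obtain ⟨z, -, hz⟩ := exists_linked_axis hF hc hz (σ := 1) (by norm_num) hp (by linarith)
      exact ⟨z, 1, Or.inl rfl, hz⟩
    · obtain ⟨z, -, hz⟩ := exists_linked_axis hF hc hz (σ := -1) (by norm_num) hp (by linarith)
      exact ⟨z, -1, Or.inr rfl, hz⟩
  have main := hc.induction₂ (fun p q => p ∈ F ∧ q ∈ F ∧ ∀ z z', K p z → K q z' → W z = W z')
    (fun p hp => by
      have hev : ∀ᶠ q in nhds p, q ∈ F ∧ ∃ σ ∈ S, Linked F σ p q := by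
        obtain ⟨r, hr, hball⟩ := Metric.isOpen_iff.mp hF p hp
        have hconv : ∀ σ : ℝ, Convex ℝ {q : ℝ × ℝ | 0 ≤ σ * q.1} := fun σ =>
          convex_halfSpace_ge (f := fun q : ℝ × ℝ => σ * q.1)
            ⟨fun u v => by simp [mul_add], fun t v => by simp; ring⟩ 0
        have hl : ∀ σ : ℝ, ∀ q ∈ Metric.ball p r, 0 ≤ σ * p.1 → 0 ≤ σ * q.1 → Linked F σ p q :=
          fun σ q hq h1 h2 => ⟨Metric.ball p r ∩ {q | 0 ≤ σ * q.1},
            Set.inter_subset_left.trans hball, fun u hu => hu.2,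
            ((convex_ball p r).inter (hconv σ)).isPreconnected, ⟨Metric.mem_ball_self hr, h1⟩,
            ⟨hq, h2⟩⟩
        have hside : ∀ᶠ q in nhds p, ∃ σ ∈ S, 0 ≤ σ * p.1 ∧ 0 ≤ σ * q.1 := by
          rcases lt_trichotomy p.1 0 with h | h | h
          · filter_upwards [(continuous_fst.tendsto p).eventually (gt_mem_nhds h)] with q hq
            exact ⟨-1, Or.inr rfl, by linarith, by linarith⟩
          · refine Filter.Eventually.of_forall fun q => ?_
            rcases le_total 0 q.1 with h' | h'
            · exact ⟨1, Or.inl rfl, by linarith, by linarith⟩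
            · exact ⟨-1, Or.inr rfl, by linarith, by linarith⟩
          · filter_upwards [(continuous_fst.tendsto p).eventually (lt_mem_nhds h)] with q hq
            exact ⟨1, Or.inl rfl, by linarith, by linarith⟩
        filter_upwards [Metric.ball_mem_nhds p hr, hside] with q hq ⟨σ, hσ, h1, h2⟩
        exact ⟨hball hq, σ, hσ, hl σ q hq h1 h2⟩
      filter_upwards [nhdsWithin_le_nhds hev] with q ⟨hq, σ, hσ, hpq⟩
      refine ⟨hp, hq, fun u v hu hv => ?_⟩
      have hpσ : 0 ≤ σ * p.1 := by
        obtain ⟨Q, -, h1, -, h2, -⟩ := hpq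
        exact h1 p h2
      obtain ⟨w, -, hw⟩ := exists_linked_axis hF hc hz (hS0 σ hσ) hp hpσ
      rw [hK p hp u w hu ⟨σ, hσ, hw⟩, hK q hq w v ⟨σ, hσ, hpq.symm.trans hw⟩ hv])
    (fun p q r _ _ _ h h' => ⟨h.1, h'.2.1, fun u v hu hv => by
      obtain ⟨w, hw⟩ := hKe q h.2.1
      rw [h.2.2 u w hu hw, h'.2.2 w v hw hv]⟩)
    (fun p q _ _ h => ⟨h.2.1, h.1, fun u v hu hv => (h.2.2 v u hv hu).symm⟩) hz hz'
  exact main.2.2 z z' ⟨1, Or.inl rfl, linked_self hz (by simp)⟩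
    ⟨1, Or.inl rfl, linked_self hz' (by simp)⟩

end

section

namespace Fan

variable {A B : Type} (Φ : Fan A B)

/-- The height of a line of a fan above a given abscissa. -/
def ht (e : A × B) (x : ℝ) : ℝ := Φ.slope e * x + Φ.y e

theorem ht_lt_ht_of_row {a : A} {b b' : B} (h : Φ.y (a, b) < Φ.y (a, b')) {x : ℝ}
    (hx : Φ.xl a < x) : Φ.ht (a, b) x < Φ.ht (a, b') x := by
  have h1 := Φ.on_left a b
  have h2 := Φ.on_left a b'
  have h3 := Φ.xl_neg a
  have hm : 0 < Φ.slope (a, b') - Φ.slope (a, b) := by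
    by_contra! hcon
    nlinarith
  unfold ht
  nlinarith [mul_pos hm (sub_pos.mpr hx)]

theorem ht_lt_ht_of_col {a a' : A} {b : B} (h : Φ.y (a, b) < Φ.y (a', b)) {x : ℝ}
    (hx : x < Φ.xr b) : Φ.ht (a, b) x < Φ.ht (a', b) x := by
  have h1 := Φ.on_right a b
  have h2 := Φ.on_right a' b
  have h3 := Φ.xr_pos b
  have hm : 0 < Φ.slope (a, b) - Φ.slope (a', b) := by
    by_contra! hcon
    nlinarith
  unfold ht
  nlinarith [mul_pos hm (sub_pos.mpr hx)]

/-- The set `F` avoids the segments spanned by the pairs in `S`, and approaches each of them from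
below, to the left of the axis. -/
structure Touches (F : Set (ℝ × ℝ)) (S : Finset (A × B)) : Prop where
  isOpen : IsOpen F
  isPreconnected : IsPreconnected F
  avoids : ∀ e ∈ S, ∀ p ∈ F, p.2 = Φ.ht e p.1 → p.1 < Φ.xl e.1 ∨ Φ.xr e.2 < p.1
  touches : ∀ e ∈ S, ∃ r, Φ.xl e.1 < r ∧ r < 0 ∧
    (r, Φ.ht e r) ∈ closure (F ∩ {p | p.2 < Φ.ht e p.1})

variable {Φ} {F : Set (ℝ × ℝ)} {S : Finset (A × B)}

theorem continuous_ht (e : A × B) : Continuous (Φ.ht e) := by unfold ht; fun_prop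

theorem Touches.exists_near [Finite A] [Finite B] (h : Φ.Touches F S) {e : A × B} (he : e ∈ S) :
    ∃ r, Φ.xl e.1 < r ∧ r < 0 ∧ ∃ f ∈ F, f.1 < 0 ∧ f.2 < Φ.ht e f.1 ∧
      ∀ e', Φ.ht e' r < Φ.ht e r → Φ.ht e' f.1 < f.2 := by
  obtain ⟨r, h1, h2, h3⟩ := h.touches e he
  refine ⟨r, h1, h2, ?_⟩
  have hev : ∀ᶠ f in nhds ((r, Φ.ht e r) : ℝ × ℝ), f.1 < 0 ∧
      ∀ e', Φ.ht e' r < Φ.ht e r → Φ.ht e' f.1 < f.2 := by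
    refine (continuous_fst.tendsto _ |>.eventually (gt_mem_nhds h2)).and
      (Filter.eventually_all.mpr fun e' => ?_)
    by_cases hlt : Φ.ht e' r < Φ.ht e r
    · have := ((continuous_ht (Φ := Φ) e').comp continuous_fst).tendsto ((r, Φ.ht e r) : ℝ × ℝ)
      filter_upwards [this.eventually_lt (continuous_snd.tendsto _) hlt] with f hf _ using hf
    · exact Filter.Eventually.of_forall fun f hf => absurd hf hlt
  obtain ⟨f, ⟨hf, hf'⟩, hf''⟩ := (mem_closure_iff_frequently.mp h3 |>.and_eventually hev).exists
  exact ⟨f, hf, hf''.1, hf', hf''.2⟩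

theorem Touches.row_wedge (h : Φ.Touches F S) {a : A} {b b' : B} (hb : (a, b) ∈ S)
    (hb' : (a, b') ∈ S) (hy : Φ.y (a, b) < Φ.y (a, b')) {p q : ℝ × ℝ} (hl : Linked F (-1) p q)
    (h1 : Φ.ht (a, b) p.1 < p.2) (h2 : p.2 < Φ.ht (a, b') p.1) :
    Φ.ht (a, b) q.1 < q.2 ∧ q.2 < Φ.ht (a, b') q.1 := by
  obtain ⟨Q, hQF, hQ, hQc, hp, hq⟩ := hl
  have hav : ∀ c, (a, c) ∈ S → ∀ p ∈ Q, p.2 = Φ.ht (a, c) p.1 →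
      0 < (p.1 - Φ.xl a) * Φ.xl a := fun c hc p hp hpy => by
    rcases h.avoids _ hc p (hQF hp) hpy with h' | h'
    · exact mul_pos_of_neg_of_neg (sub_neg.mpr h') (Φ.xl_neg a)
    · have := hQ p hp
      have := Φ.xr_pos c
      simp only at h'
      linarith
  exact wedge_dichotomy hQc (Φ.on_left a b) (Φ.on_left a b') hy (hav b hb) (hav b' hb') hp hq h1 h2

theorem Touches.col_wedge (h : Φ.Touches F S) {a a' : A} {b : B} (hb : (a, b) ∈ S)
    (hb' : (a', b) ∈ S) (hy : Φ.y (a, b) < Φ.y (a', b)) {p q : ℝ × ℝ} (hl : Linked F 1 p q)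
    (h1 : Φ.ht (a, b) p.1 < p.2) (h2 : p.2 < Φ.ht (a', b) p.1) :
    Φ.ht (a, b) q.1 < q.2 ∧ q.2 < Φ.ht (a', b) q.1 := by
  obtain ⟨Q, hQF, hQ, hQc, hp, hq⟩ := hl
  have hav : ∀ c, (c, b) ∈ S → ∀ p ∈ Q, p.2 = Φ.ht (c, b) p.1 →
      0 < (p.1 - Φ.xr b) * Φ.xr b := fun c hc p hp hpy => by
    rcases h.avoids _ hc p (hQF hp) hpy with h' | h'
    · have := hQ p hp
      have := Φ.xl_neg c
      simp only at h'
      linarith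
    · exact mul_pos (sub_pos.mpr h') (Φ.xr_pos b)
  exact wedge_dichotomy hQc (Φ.on_right a b) (Φ.on_right a' b) hy (hav a hb) (hav a' hb') hp hq h1 h2

@[simp] theorem ht_zero (e : A × B) : Φ.ht e 0 = Φ.y e := by simp [ht]

theorem Touches.y_not_mem (h : Φ.Touches F S) {e : A × B} (he : e ∈ S) : (0, Φ.y e) ∉ F := by
  intro hm
  have h1 := Φ.xl_neg e.1
  have h2 := Φ.xr_pos e.2
  rcases h.avoids e he _ hm (by simp) with h' | h' <;> simp only at h' <;> linarith

/-- Without access to the axis, `F` approaches at most one line through each left point. -/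
theorem Touches.card_le_of_no_axis [Fintype A] [Fintype B] (h : Φ.Touches F S)
    (hZ : ∀ z, (0, z) ∉ F) : S.card ≤ Fintype.card A := by
  have hneg : ∀ f ∈ F, f.1 < 0 → ∀ p ∈ F, p.1 < 0 := by
    intro f hf hf0
    have hcov : F ⊆ {p | p.1 < 0} ∪ {p | 0 < p.1} := fun p hp => by
      rcases lt_trichotomy p.1 0 with h' | h' | h'
      · exact Or.inl h'
      · exact (hZ p.2 (by rwa [← h'])).elim
      · exact Or.inr h'
    have hdis : F ∩ ({p | p.1 < 0} ∩ {p | 0 < p.1}) = ∅ := by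
      rw [Set.eq_empty_iff_forall_notMem]
      rintro p ⟨-, h1, h2⟩
      exact lt_asymm (show p.1 < 0 from h1) (show 0 < p.1 from h2)
    rcases isPreconnected_iff_subset_of_disjoint.mp h.isPreconnected _ _
      (isOpen_lt continuous_fst continuous_const) (isOpen_lt continuous_const continuous_fst)
      hcov hdis with h' | h'
    · exact fun p hp => h' hp
    · exact absurd hf0 (lt_asymm (show 0 < f.1 from h' hf))
  have key : ∀ a b b', (a, b) ∈ S → (a, b') ∈ S → ¬ Φ.y (a, b) < Φ.y (a, b') := by
    intro a b b' hb hb' hlt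
    obtain ⟨r, hr, -, f, hf, hf0, hfy, hfr⟩ := h.exists_near hb'
    obtain ⟨r', -, -, f', hf', -, hfy', -⟩ := h.exists_near hb
    have hl : Linked F (-1) f f' := ⟨F, subset_rfl, fun p hp => by
      have := hneg f hf hf0 p hp; linarith, h.isPreconnected, hf, hf'⟩
    exact lt_asymm hfy' (h.row_wedge hb hb' hlt hl (hfr _ (Φ.ht_lt_ht_of_row hlt hr)) hfy).1
  refine Finset.card_le_card_of_injOn (t := Finset.univ) Prod.fst (fun _ _ => Finset.mem_univ _) ?_
  rintro ⟨a, b⟩ hb ⟨a', b'⟩ hb' rfl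
  rw [Φ.y_row a b b' (le_antisymm (not_lt.mp (key _ _ _ hb' hb)) (not_lt.mp (key _ _ _ hb hb')))]

/-- The number of drawn lines separated from a given one by a point of the axis below it. -/
def level (Φ : Fan A B) (F : Set (ℝ × ℝ)) (S : Finset (A × B)) (e : A × B) : ℕ :=
  (S.filter fun e' => ∃ z, (0, z) ∈ F ∧ Φ.y e' < z ∧ z < Φ.y e).card

theorem level_le_card (e : A × B) : Φ.level F S e ≤ S.card := Finset.card_filter_le _ _

theorem level_mono {e e' : A × B} (h : Φ.y e ≤ Φ.y e') : Φ.level F S e ≤ Φ.level F S e' :=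
  Finset.card_le_card (Finset.monotone_filter_right _ fun _ _ ⟨z, h1, h2, h3⟩ =>
    ⟨z, h1, h2, h3.trans_le h⟩)

theorem level_lt_level {e e' : A × B} (he : e ∈ S) {z : ℝ} (hz : (0, z) ∈ F) (h1 : Φ.y e < z)
    (h2 : z < Φ.y e') : Φ.level F S e < Φ.level F S e' := by
  refine Finset.card_lt_card (Finset.ssubset_iff_of_subset ?_ |>.mpr ⟨e, ?_, ?_⟩)
  · exact Finset.monotone_filter_right _ fun _ _ ⟨z', h1', h2', h3'⟩ =>
      ⟨z', h1', h2', h3'.trans (h1.trans h2)⟩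
  · exact Finset.mem_filter.mpr ⟨he, z, hz, h1, h2⟩
  · rintro hm
    obtain ⟨-, z', -, h', h''⟩ := Finset.mem_filter.mp hm
    exact lt_asymm h' h''

theorem exists_of_level_lt (h : Φ.Touches F S) {e e' : A × B} (he : e ∈ S)
    (hlt : Φ.level F S e < Φ.level F S e') : ∃ z, (0, z) ∈ F ∧ Φ.y e < z ∧ z < Φ.y e' := by
  by_contra! hcon
  refine hlt.not_ge (Finset.card_le_card (Finset.monotone_filter_right _ ?_))
  rintro e'' - ⟨z, h1, h2, h3⟩
  refine ⟨z, h1, h2, ?_⟩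
  by_contra! hz
  rcases hz.lt_or_eq with hz | hz
  · exact (hcon z h1 hz).not_gt h3
  · exact h.y_not_mem he (hz ▸ h1)

theorem Touches.y_lt_iff (h : Φ.Touches F S) {e e' : A × B} (he : e ∈ S) (he' : e' ∈ S)
    (hl : Φ.level F S e = Φ.level F S e') {z : ℝ} (hz : (0, z) ∈ F) : Φ.y e < z ↔ Φ.y e' < z := by
  have key : ∀ e e', e ∈ S → e' ∈ S → Φ.level F S e = Φ.level F S e' → Φ.y e < z → Φ.y e' < z := by
    intro e e' he he' hl h1
    by_contra! h2
    rcases h2.lt_or_eq with h2 | h2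
    · exact (level_lt_level he hz h1 h2).ne hl
    · exact h.y_not_mem he' (h2 ▸ hz)
  exact ⟨key e e' he he' hl, key e' e he' he hl.symm⟩

theorem Touches.level_row [Finite A] [Finite B] (h : Φ.Touches F S) {z₀ : ℝ} (hz₀ : (0, z₀) ∈ F)
    {a : A} {b b' : B} (hb : (a, b) ∈ S) (hb' : (a, b') ∈ S)
    (hl : Φ.level F S (a, b) = Φ.level F S (a, b')) : b = b' := by
  have key : ∀ b b', (a, b) ∈ S → (a, b') ∈ S → Φ.level F S (a, b) = Φ.level F S (a, b') →
      ¬ Φ.y (a, b) < Φ.y (a, b') := by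
    intro b b' hb hb' hl hlt
    obtain ⟨r, hr, -, f, hf, hf0, hfy, hfr⟩ := h.exists_near hb'
    obtain ⟨z, hz, hlz⟩ := exists_linked_axis h.isOpen h.isPreconnected hz₀ (σ := -1) (by norm_num)
      hf (by linarith)
    obtain ⟨h1, h2⟩ := h.row_wedge hb hb' hlt hlz (hfr _ (Φ.ht_lt_ht_of_row hlt hr)) hfy
    simp only [ht_zero] at h1 h2
    exact (level_lt_level hb hz h1 h2).ne hl
  exact Φ.y_row a b b' (le_antisymm (not_lt.mp (key _ _ hb' hb hl.symm))
    (not_lt.mp (key _ _ hb hb' hl)))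

theorem Touches.level_cross [Finite A] [Finite B] (h : Φ.Touches F S) {z₀ : ℝ}
    (hz₀ : (0, z₀) ∈ F) {a a' : A} {b b₁ b₂ : B} (hab : (a, b) ∈ S) (ha'b : (a', b) ∈ S)
    (hab₁ : (a, b₁) ∈ S) (ha'b₂ : (a', b₂) ∈ S) (hy : Φ.y (a', b) < Φ.y (a, b))
    (hl : Φ.level F S (a, b) = Φ.level F S (a', b))
    (hl₁ : Φ.level F S (a, b₁) < Φ.level F S (a, b)) :
    Φ.level F S (a, b₁) < Φ.level F S (a', b₂) := by
  have hy₁ : Φ.y (a, b₁) < Φ.y (a, b) := by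
    by_contra! hcon
    exact hl₁.not_ge (level_mono hcon)
  obtain ⟨r, hr, hr0, f, hf, hf0, hfy, hfr⟩ := h.exists_near hab
  obtain ⟨z, hz, hlz⟩ := exists_linked_axis h.isOpen h.isPreconnected hz₀ (σ := -1) (by norm_num)
    hf (by linarith)
  obtain ⟨h1, h2⟩ := h.row_wedge hab₁ hab hy₁ hlz (hfr _ (Φ.ht_lt_ht_of_row hy₁ hr)) hfy
  simp only [ht_zero] at h1 h2
  have h3 : z < Φ.y (a', b) := by
    by_contra! hcon
    rcases hcon.lt_or_eq with hcon | hcon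
    · exact (level_lt_level ha'b hz hcon h2).ne hl.symm
    · exact h.y_not_mem ha'b (hcon ▸ hz)
  have hf' : Φ.ht (a', b) f.1 < f.2 :=
    hfr _ (Φ.ht_lt_ht_of_col hy (hr0.trans (Φ.xr_pos b)))
  refine level_lt_level hab₁ hz h1 ?_
  by_contra! hcon
  rcases hcon.lt_or_eq with hcon | hcon
  · exact lt_asymm hf' (h.row_wedge ha'b₂ ha'b (hcon.trans h3) hlz.symm (by simpa) (by simpa)).2
  · exact h.y_not_mem ha'b₂ (hcon ▸ hz)

end Fan

end

section

theorem sum_ite_eq_zero_of_fiber {Γ Q : Type} [Fintype Γ] [Fintype Q] {π : Γ → Q} {f : Γ → ℝ}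
    (hf : ∀ q, ∑ g with π g = q, f g = 0) (D : Q → Prop) :
    ∑ g, (if D (π g) then f g else 0) = 0 := by
  rw [← Finset.sum_fiberwise (s := Finset.univ) (g := π)]
  refine Finset.sum_eq_zero fun q _ => ?_
  by_cases hD : D q
  · rw [← hf q]
    refine Finset.sum_congr rfl fun g hg => if_pos ?_
    rwa [(Finset.mem_filter.mp hg).2]
  · refine Finset.sum_eq_zero fun g hg => if_neg ?_
    rwa [(Finset.mem_filter.mp hg).2]

namespace Fan

variable {A B : Type} {Φ : Fan A B} {F : Set (ℝ × ℝ)} {S : Finset (A × B)}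

theorem Touches.y_ne (h : Φ.Touches F S) {e : A × B} (he : e ∈ S) {z : ℝ} (hz : (0, z) ∈ F) :
    Φ.y e ≠ z := fun h' => h.y_not_mem he (h' ▸ hz)

theorem Touches.row_between (h : Φ.Touches F S) {z z' : ℝ} (hz : (0, z) ∈ F) (hz' : (0, z') ∈ F)
    (hl : Linked F (-1) (0, z) (0, z')) {a : A} {b b' : B} (hb : (a, b) ∈ S) (hb' : (a, b') ∈ S)
    (hy : z < Φ.y (a, b)) (hy' : Φ.y (a, b) < z') : z < Φ.y (a, b') ∧ Φ.y (a, b') < z' := by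
  constructor
  · by_contra! hcon
    have hcon := hcon.lt_of_ne (h.y_ne hb' hz)
    have := (h.row_wedge hb' hb (hcon.trans hy) hl (by simpa) (by simpa)).2
    simp only [ht_zero] at this
    exact lt_asymm this hy'
  · by_contra! hcon
    have hcon := hcon.lt_of_ne (h.y_ne hb' hz').symm
    have := (h.row_wedge hb hb' (hy'.trans hcon) hl.symm (by simpa) (by simpa)).1
    simp only [ht_zero] at this
    exact lt_asymm this hy

theorem Touches.col_between (h : Φ.Touches F S) {z z' : ℝ} (hz : (0, z) ∈ F) (hz' : (0, z') ∈ F)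
    (hl : Linked F 1 (0, z) (0, z')) {a a' : A} {b : B} (hb : (a, b) ∈ S) (hb' : (a', b) ∈ S)
    (hy : z < Φ.y (a, b)) (hy' : Φ.y (a, b) < z') : z < Φ.y (a', b) ∧ Φ.y (a', b) < z' := by
  constructor
  · by_contra! hcon
    have hcon := hcon.lt_of_ne (h.y_ne hb' hz)
    have := (h.col_wedge hb' hb (hcon.trans hy) hl (by simpa) (by simpa)).2
    simp only [ht_zero] at this
    exact lt_asymm this hy'
  · by_contra! hcon
    have hcon := hcon.lt_of_ne (h.y_ne hb' hz').symm
    have := (h.col_wedge hb hb' (hy'.trans hcon) hl.symm (by simpa) (by simpa)).1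
    simp only [ht_zero] at this
    exact lt_asymm this hy

/-- A point of the axis in `F` separating the lines of level at most `g` from the others. -/
theorem Touches.exists_cut (h : Φ.Touches F S) {e₀ e₁ : A × B} (he₀ : e₀ ∈ S) (he₁ : e₁ ∈ S)
    (hlt : Φ.level F S e₀ < Φ.level F S e₁) :
    ∃ z, (0, z) ∈ F ∧ ∀ e ∈ S, Φ.y e < z ↔ Φ.level F S e ≤ Φ.level F S e₀ := by
  obtain ⟨u, hu, hu'⟩ := (S.filter fun e => Φ.level F S e ≤ Φ.level F S e₀).exists_max_image Φ.y
    ⟨e₀, by simpa using he₀⟩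
  obtain ⟨v, hv, hv'⟩ := (S.filter fun e => Φ.level F S e₀ < Φ.level F S e).exists_min_image Φ.y
    ⟨e₁, by simpa using ⟨he₁, hlt⟩⟩
  simp only [Finset.mem_filter] at hu hv hu' hv'
  obtain ⟨z, hz, h1, h2⟩ := exists_of_level_lt h hu.1 (hu.2.trans_lt hv.2)
  refine ⟨z, hz, fun e he => ?_⟩
  rcases le_or_gt (Φ.level F S e) (Φ.level F S e₀) with h3 | h3
  · exact iff_of_true ((hu' e ⟨he, h3⟩).trans_lt h1) h3
  · exact iff_of_false (h2.trans_le (hv' e ⟨he, h3⟩)).not_gt h3.not_ge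

/-- The bound for the number of segments which a connected set avoids and approaches from below,
to the left of the axis. -/
theorem Touches.card_le [Fintype A] [Fintype B] (h : Φ.Touches F S) :
    S.card ≤ 2 * Fintype.card A + Fintype.card A * (Nat.log 2 S.card + 2) +
      Fintype.card B * (Nat.log 2 S.card + 1) := by
  by_cases hZ : ∀ z, (0, z) ∉ F
  · have := h.card_le_of_no_axis hZ
    nlinarith [Nat.zero_le (Fintype.card A * (Nat.log 2 S.card + 2)),
      Nat.zero_le (Fintype.card B * (Nat.log 2 S.card + 1))]
  push Not at hZ
  obtain ⟨z₀, hz₀⟩ := hZ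
  rcases S.eq_empty_or_nonempty with rfl | hne
  · simp
  set lv := Φ.level F S with hlv
  obtain ⟨em, hem, hmax⟩ := S.exists_max_image lv hne
  set S' := S.filter fun e => lv e ≠ lv em with hS'
  have hSS : S' ⊆ S := Finset.filter_subset _ _
  have htop : (S.filter fun e => lv e = lv em).card ≤ Fintype.card A := by
    refine Finset.card_le_card_of_injOn (t := Finset.univ) Prod.fst
      (fun _ _ => Finset.mem_univ _) ?_
    rintro ⟨a, b⟩ hb ⟨a', b'⟩ hb' rfl
    simp only [Finset.coe_filter, Set.mem_ofPred_eq] at hb hb'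
    rw [h.level_row hz₀ hb.1 hb'.1 (hb.2.trans hb'.2.symm)]
  have hsplit : S.card = (S.filter fun e => lv e = lv em).card + S'.card :=
    (Finset.card_filter_add_card_filter_not _).symm
  let Γ : Type := ↥(S'.image lv)
  let cl : ∀ e ∈ S', Γ := fun e he => ⟨lv e, Finset.mem_image_of_mem lv he⟩
  let r₁ : Γ → Γ → Prop := fun g g' => ∃ a b b', (a, b) ∈ S' ∧ (a, b') ∈ S' ∧
    lv (a, b) = g.1 ∧ lv (a, b') = g'.1
  let r₂ : Γ → Γ → Prop := fun g g' => ∃ a a' b, (a, b) ∈ S' ∧ (a', b) ∈ S' ∧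
    lv (a, b) = g.1 ∧ lv (a', b) = g'.1
  have : Fintype (Quot r₁) := Fintype.ofFinite _
  have : Fintype (Quot r₂) := Fintype.ofFinite _
  obtain ⟨φ, hφ, hφ'⟩ := exists_charging (Quot.mk r₁) (Quot.mk r₂) (by
    intro f hf₁ hf₂
    let Bl : Γ → ℝ → Prop := fun g z => ∃ e ∈ S', lv e = g.1 ∧ Φ.y e < z
    have hBl : ∀ e, ∀ he : e ∈ S', ∀ z, (0, z) ∈ F → (Bl (cl e he) z ↔ Φ.y e < z) :=
      fun e he z hz => ⟨fun ⟨e', he', hl, hy⟩ => (h.y_lt_iff (hSS he') (hSS he) hl hz).mp hy,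
        fun hy => ⟨e, he, rfl, hy⟩⟩
    let W : ℝ → ℝ := fun z => ∑ g, if Bl g z then f g else 0
    have hW' : ∀ σ : ℝ, (σ = 1 ∨ σ = -1) → ∀ z z', Linked F σ (0, z) (0, z') → z < z' →
        W z = W z' := by
      intro σ hσ z z' hl hzz
      have hz : (0, z) ∈ F := by obtain ⟨Q, h1, -, -, h2, -⟩ := hl; exact h1 h2
      have hz' : (0, z') ∈ F := by obtain ⟨Q, h1, -, -, -, h2⟩ := hl; exact h1 h2
      let D : Γ → Prop := fun g => ¬ Bl g z ∧ Bl g z'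
      have hD : ∀ e, ∀ he : e ∈ S', (D (cl e he) ↔ z < Φ.y e ∧ Φ.y e < z') := by
        intro e he
        simp only [D]
        rw [hBl e he z hz, hBl e he z' hz', not_lt]
        exact and_congr_left' ⟨fun h' => h'.lt_of_ne (h.y_ne (hSS he) hz).symm, le_of_lt⟩
      have hDsum : ∑ g, (if D g then f g else 0) = 0 := by
        rcases hσ with rfl | rfl
        · have : ∀ g g', r₂ g g' → D g = D g' := by
            rintro ⟨g, hg⟩ ⟨g', hg'⟩ ⟨a, a', b, hab, hab', rfl, rfl⟩
            refine propext ((hD _ hab).trans (Iff.trans ?_ (hD _ hab').symm))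
            exact ⟨fun h' => h.col_between hz hz' hl (hSS hab) (hSS hab') h'.1 h'.2,
              fun h' => h.col_between hz hz' hl (hSS hab') (hSS hab) h'.1 h'.2⟩
          convert sum_ite_eq_zero_of_fiber hf₂ (Quot.lift D this)
        · have : ∀ g g', r₁ g g' → D g = D g' := by
            rintro ⟨g, hg⟩ ⟨g', hg'⟩ ⟨a, b, b', hab, hab', rfl, rfl⟩
            refine propext ((hD _ hab).trans (Iff.trans ?_ (hD _ hab').symm))
            exact ⟨fun h' => h.row_between hz hz' hl (hSS hab) (hSS hab') h'.1 h'.2,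
              fun h' => h.row_between hz hz' hl (hSS hab') (hSS hab) h'.1 h'.2⟩
          convert sum_ite_eq_zero_of_fiber hf₁ (Quot.lift D this)
      have : W z' = W z + ∑ g, (if D g then f g else 0) := by
        rw [← Finset.sum_add_distrib]
        refine Finset.sum_congr rfl fun g _ => ?_
        have hmono : Bl g z → Bl g z' := fun ⟨e, he, hl, hy⟩ => ⟨e, he, hl, hy.trans hzz⟩
        by_cases h1 : Bl g z <;> by_cases h2 : Bl g z' <;> simp [D, h1, h2]
        exact absurd (hmono h1) h2
      rw [this, hDsum, add_zero]
    have hW : ∀ σ : ℝ, (σ = 1 ∨ σ = -1) → ∀ z z', Linked F σ (0, z) (0, z') → W z = W z' := by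
      intro σ hσ z z' hl
      rcases lt_trichotomy z z' with h' | h' | h'
      · exact hW' σ hσ z z' hl h'
      · rw [h']
      · exact (hW' σ hσ z' z hl.symm h').symm
    have hconst := fun z z' hz hz' =>
      constant_of_linked h.isOpen h.isPreconnected W hW (z := z) (z' := z') hz hz'
    have hcut : ∀ g : Γ, ∃ z, (0, z) ∈ F ∧ W z = ∑ g', if g'.1 ≤ g.1 then f g' else 0 := by
      rintro ⟨g, hg⟩
      obtain ⟨e, he, rfl⟩ := Finset.mem_image.mp hg
      have he' := Finset.mem_filter.mp he
      obtain ⟨z, hz, hcut⟩ := h.exists_cut he'.1 hem ((hmax e he'.1).lt_of_ne he'.2)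
      refine ⟨z, hz, Finset.sum_congr rfl ?_⟩
      rintro ⟨g', hg'⟩ -
      obtain ⟨e', he', rfl⟩ := Finset.mem_image.mp hg'
      exact if_congr ((hBl e' he' z hz).trans (hcut e' (hSS he'))) rfl rfl
    have htot : ∑ g, f g = 0 := by
      simpa using sum_ite_eq_zero_of_fiber hf₁ fun _ => True
    have hU : ∀ g : Γ, ∑ g' : Γ, (if g'.1 ≤ g.1 then f g' else 0) = 0 := by
      intro g
      obtain ⟨gm, -, hgm⟩ := (Finset.univ : Finset Γ).exists_max_image (fun g => g.1)
        ⟨g, Finset.mem_univ _⟩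
      obtain ⟨z, hz, h1⟩ := hcut g
      obtain ⟨z', hz', h2⟩ := hcut gm
      rw [← h1, hconst z z' hz hz', h2, ← htot]
      exact Finset.sum_congr rfl fun g' hg' => if_pos (hgm g' hg')
    have hzero : ∀ n, ∀ g : Γ, g.1 = n → f g = 0 := by
      intro n
      induction n using Nat.strong_induction_on with
      | _ n ih =>
        rintro g rfl
        rw [← hU g, Finset.sum_eq_single g]
        · simp
        · intro g' _ hne
          split_ifs with hle
          · exact ih g'.1 (hle.lt_of_ne fun h' => hne (Subtype.ext h')) g' rfl
          · rfl
        · exact fun h' => absurd (Finset.mem_univ g) h'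
    exact funext fun g => hzero _ g rfl)
  have hmain := card_le_of_levels S' lv Φ.y S.card
    (fun e _ => level_le_card e)
    (fun a b b' hb hb' hl => h.level_row hz₀ (hSS hb) (hSS hb') hl)
    (fun a a' b _ _ hy => Φ.y_col a a' b hy)
    (fun n => ∃ hn : n ∈ S'.image lv, φ ⟨n, hn⟩ = Sum.inl (Quot.mk r₁ ⟨n, hn⟩))
    (by
      rintro a b b' hb hb' ⟨h1, h2⟩ ⟨h3, h4⟩
      have : φ (cl _ hb) = φ (cl _ hb') := by
        refine h2.trans (Eq.trans ?_ h4.symm)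
        exact congrArg _ (Quot.sound ⟨a, b, b', hb, hb', rfl, rfl⟩)
      exact congrArg Subtype.val (hφ this))
    (by
      intro a a' b hb hb' h1 h2
      have h1' : φ (cl _ hb) = Sum.inr (Quot.mk r₂ (cl _ hb)) :=
        (hφ' _).resolve_left fun h' => h1 ⟨_, h'⟩
      have h2' : φ (cl _ hb') = Sum.inr (Quot.mk r₂ (cl _ hb')) :=
        (hφ' _).resolve_left fun h' => h2 ⟨_, h'⟩
      have : φ (cl _ hb) = φ (cl _ hb') := by
        refine h1'.trans (Eq.trans ?_ h2'.symm)
        exact congrArg _ (Quot.sound ⟨a, a', b, hb, hb', rfl, rfl⟩)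
      exact congrArg Subtype.val (hφ this))
    (fun a a' b b₁ b₂ h1 h2 h3 h4 hy hl hl₁ =>
      h.level_cross hz₀ (hSS h1) (hSS h2) (hSS h3) (hSS h4) hy hl hl₁)
  omega

end Fan

end

section

/-- Twice the signed area of a triangle. -/
def orient (u v p : ℝ × ℝ) : ℝ := (v.1 - u.1) * (p.2 - u.2) - (v.2 - u.2) * (p.1 - u.1)

@[fun_prop]
theorem continuous_orient (u v : ℝ × ℝ) : Continuous (orient u v) := by
  unfold orient; fun_prop

/-- The bound for the number of lines a segment-avoiding set approaches in a bipartite pattern. -/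
def touchBound (m n : ℕ) : ℕ :=
  2 * m + m * (Nat.log 2 (m * n) + 2) + n * (Nat.log 2 (m * n) + 1)

theorem card_le_touchBound {A B : Type} [Fintype A] [Fintype B] {c σ τ : ℝ} (hσ : σ * σ = 1)
    (hτ : τ * τ = 1) {u : A → ℝ × ℝ} {v : B → ℝ × ℝ} (hu : ∀ a, σ * ((u a).1 - c) < 0)
    (hv : ∀ b, 0 < σ * ((v b).1 - c))
    (hrow : ∀ a b b', orient (u a) (v b) (v b') = 0 → b = b')
    (hcol : ∀ a a' b, orient (u a) (v b) (u a') = 0 → a = a')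
    {F : Set (ℝ × ℝ)} (ho : IsOpen F) (hc : IsPreconnected F) {S : Finset (A × B)}
    (hav : ∀ e ∈ S, ∀ p ∈ F, orient (u e.1) (v e.2) p = 0 →
      σ * (p.1 - (u e.1).1) < 0 ∨ 0 < σ * (p.1 - (v e.2).1))
    (ht : ∀ e ∈ S, ∃ r, 0 < σ * (r.1 - (u e.1).1) ∧ σ * (r.1 - c) < 0 ∧
      orient (u e.1) (v e.2) r = 0 ∧
      r ∈ closure (F ∩ {p | τ * (σ * orient (u e.1) (v e.2) p) < 0})) :
    S.card ≤ touchBound (Fintype.card A) (Fintype.card B) := by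
  have hd : ∀ a b, 0 < σ * ((v b).1 - (u a).1) := fun a b => by linarith [hu a, hv b]
  have hσ0 : σ ≠ 0 := by rintro rfl; simp at hσ
  have hτ0 : τ ≠ 0 := by rintro rfl; simp at hτ
  have hd0 : ∀ a b, (v b).1 - (u a).1 ≠ 0 := fun a b h => by simpa [h] using hd a b
  let Φ : Fan A B :=
    { xl := fun a => σ * ((u a).1 - c)
      yl := fun a => τ * (u a).2
      xr := fun b => σ * ((v b).1 - c)
      yr := fun b => τ * (v b).2
      slope := fun e => τ * σ * (((v e.2).2 - (u e.1).2) / ((v e.2).1 - (u e.1).1))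
      y := fun e => τ * ((u e.1).2 -
        ((v e.2).2 - (u e.1).2) / ((v e.2).1 - (u e.1).1) * ((u e.1).1 - c))
      xl_neg := hu
      xr_pos := hv
      on_left := fun a b => by
        linear_combination τ * (((v b).2 - (u a).2) / ((v b).1 - (u a).1)) * ((u a).1 - c) * hσ
      on_right := fun a b => by
        have := hd0 a b
        field_simp
        linear_combination ((v b).2 - (u a).2) * ((v b).1 - c) * hσ
      y_row := fun a b b' h => by
        refine hrow a b b' ?_
        have h0 := hd0 a b
        have h0' := hd0 a b'
        have hua : (u a).1 - c ≠ 0 := fun h => by simpa [h] using hu a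
        have h1 := mul_left_cancel₀ hτ0 h
        have h2 := mul_right_cancel₀ hua (sub_right_injective h1)
        simp only at h2
        rw [div_eq_div_iff h0 h0'] at h2
        unfold orient
        linear_combination -h2
      y_col := fun a a' b h => by
        refine hcol a a' b ?_
        have h0 := hd0 a b
        have h0' := hd0 a' b
        have hvb : (v b).1 - c ≠ 0 := fun h => by simpa [h] using hv b
        have h1 := mul_left_cancel₀ hτ0 h
        simp only at h1
        have e1 : ∀ a, (v b).1 - (u a).1 ≠ 0 → (u a).2 - ((v b).2 - (u a).2) /
            ((v b).1 - (u a).1) * ((u a).1 - c) = (v b).2 - ((v b).2 - (u a).2) /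
            ((v b).1 - (u a).1) * ((v b).1 - c) := fun a h => by
          field_simp
          ring
        rw [e1 a h0, e1 a' h0'] at h1
        have h2 := mul_right_cancel₀ hvb (sub_right_injective h1)
        rw [div_eq_div_iff h0 h0'] at h2
        unfold orient
        linear_combination h2 }
  let T : ℝ × ℝ → ℝ × ℝ := fun p => (σ * (p.1 - c), τ * p.2)
  let T' : ℝ × ℝ → ℝ × ℝ := fun p => (c + σ * p.1, τ * p.2)
  have hT : Continuous T := by fun_prop
  have hT' : Continuous T' := by fun_prop
  have hTT' : ∀ p, T (T' p) = p := fun p => by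
    ext
    · simp only [T, T']
      linear_combination p.1 * hσ
    · simp only [T, T']
      linear_combination p.2 * hτ
  have hT'T : ∀ p, T' (T p) = p := fun p => by
    ext
    · simp only [T, T']
      linear_combination (p.1 - c) * hσ
    · simp only [T, T']
      linear_combination p.2 * hτ
  have hkey : ∀ e p, σ * ((v e.2).1 - (u e.1).1) * ((T p).2 - Φ.ht e (T p).1) =
      τ * (σ * orient (u e.1) (v e.2) p) := by
    intro e p
    have := hd0 e.1 e.2
    simp only [Fan.ht, Φ, T, orient]
    field_simp
    linear_combination -((v e.2).2 - (u e.1).2) * (p.1 - c) * hσ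
  have hTouch : Φ.Touches (T' ⁻¹' F) S :=
    { isOpen := ho.preimage hT'
      isPreconnected := by
        convert hc.image T hT.continuousOn using 1
        ext p
        exact ⟨fun hp => ⟨T' p, hp, hTT' p⟩, fun ⟨q, hq, hqp⟩ => by
          rw [← hqp, Set.mem_preimage, hT'T]; exact hq⟩
      avoids := fun e he p hp hpy => by
        have h1 := hkey e (T' p)
        rw [hTT', hpy, sub_self, mul_zero] at h1
        have h2 : orient (u e.1) (v e.2) (T' p) = 0 := by simpa [hτ0, hσ0] using h1.symm
        have h3 : p.1 = σ * ((T' p).1 - c) := (congrArg Prod.fst (hTT' p)).symm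
        rw [h3]
        rcases hav e he _ hp h2 with h | h
        · left; simp only [Φ]; linarith
        · right; simp only [Φ]; linarith
      touches := fun e he => by
        obtain ⟨r, h1, h2, h3, h4⟩ := ht e he
        refine ⟨(T r).1, ?_, h2, ?_⟩
        · simp only [Φ, T]; linarith
        · have h5 := hkey e r
          rw [h3, mul_zero, mul_zero] at h5
          have h6 : (T r).2 - Φ.ht e (T r).1 = 0 :=
            (mul_eq_zero.mp h5).resolve_left (hd e.1 e.2).ne'
          rw [← sub_eq_zero.mp h6]
          change T r ∈ _
          refine map_mem_closure hT h4 fun p hp => ⟨?_, ?_⟩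
          · rw [Set.mem_preimage, hT'T]; exact hp.1
          · have h7 : τ * (σ * orient (u e.1) (v e.2) p) < 0 := hp.2
            rw [← hkey e p] at h7
            exact sub_neg.mp ((pos_iff_neg_of_mul_neg h7).mp (hd e.1 e.2)) }
  have hS : S.card ≤ Fintype.card A * Fintype.card B := by
    simpa using Finset.card_le_univ S
  have hlog := Nat.log_mono_right (b := 2) hS
  refine hTouch.card_le.trans ?_
  unfold touchBound
  gcongr

namespace CrossDrawing

variable {A B : Type} {P : A ⊕ B → ℝ × ℝ}

theorem lineFn_eq_orient (e : A × B) (p : ℝ × ℝ) :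
    lineFn P (Sum.inl e) p = orient (P (Sum.inl e.1)) (P (Sum.inr e.2)) p := by
  simp only [lineFn, run, icpt, orient]
  ring

theorem orient_swap (u v p : ℝ × ℝ) : orient v u p = -orient u v p := by
  unfold orient; ring

/-- Few segments are approached by a component of the complement of a set of segments, outside of
a suitable finite set. -/
theorem exists_finite_card_touched_le [Fintype A] [Fintype B] [Nonempty A] [Nonempty B]
    (hP : Good P) : ∃ X : Set (ℝ × ℝ), X.Finite ∧ ∀ (G : Set (A × B)) (o : ℝ × ℝ),
      (touched P G o X).ncard ≤ 2 * (touchBound (Fintype.card A) (Fintype.card B) +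
        touchBound (Fintype.card B) (Fintype.card A)) := by
  obtain ⟨c, hcl, hcr⟩ : ∃ c, (∀ a, (P (Sum.inl a)).1 < c) ∧ ∀ b, c < (P (Sum.inr b)).1 := by
    obtain ⟨a₀, ha₀⟩ := Finite.exists_max fun a : A => (P (Sum.inl a)).1
    obtain ⟨b₀, hb₀⟩ := Finite.exists_min fun b : B => (P (Sum.inr b)).1
    obtain ⟨c, h1, h2⟩ := exists_between (hP.leftRight a₀ b₀)
    exact ⟨c, fun a => (ha₀ a).trans_lt h1, fun b => h2.trans_le (hb₀ b)⟩
  refine ⟨crossings P ∪ ⋃ e : A × B, {p | p.1 = c ∧ lineFn P (Sum.inl e) p = 0},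
    (finite_crossings hP).union (Set.finite_iUnion fun e => ?_), fun G o => ?_⟩
  · refine Set.Subsingleton.finite fun p hp q hq => ?_
    obtain ⟨hp1, hp2⟩ := hp
    obtain ⟨hq1, hq2⟩ := hq
    have hr := run_pos hP.leftRight e
    refine Prod.ext (hp1.trans hq1.symm) (mul_left_cancel₀ hr.ne' ?_)
    simp only [lineFn] at hp2 hq2
    rw [hp1] at hp2
    rw [hq1] at hq2
    linarith
  set X := crossings P ∪ ⋃ e : A × B, {p | p.1 = c ∧ lineFn P (Sum.inl e) p = 0} with hX
  set F := connectedComponentIn (free P G) o with hF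
  have hFo : IsOpen F := (isOpen_free P G).connectedComponentIn
  have hFc : IsPreconnected F := isPreconnected_connectedComponentIn
  have hFav : ∀ e ∈ G, ∀ p ∈ F, lineFn P (Sum.inl e) p = 0 →
      p.1 < (P (Sum.inl e.1)).1 ∨ (P (Sum.inr e.2)).1 < p.1 := by
    intro e he p hp h0
    by_contra! hcon
    exact (connectedComponentIn_subset _ _ hp) (Set.mem_biUnion he
      ((mem_seg_iff hP.leftRight).mpr ⟨h0, hcon.1, hcon.2⟩))
  let Sp : ℝ → ℝ → Finset (A × B) := fun σ τ => Finset.univ.filter fun e => e ∈ G ∧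
    ∃ r ∈ seg P e, r ∉ X ∧ σ * (r.1 - c) < 0 ∧
      r ∈ closure (F ∩ {p | τ * lineFn P (Sum.inl e) p < 0})
  have hstrict : ∀ e, ∀ r ∈ seg P e, r ∉ X → r.1 ≠ c ∧ (P (Sum.inl e.1)).1 < r.1 ∧
      r.1 < (P (Sum.inr e.2)).1 ∧ lineFn P (Sum.inl e) r = 0 := by
    intro e r hr hrX
    obtain ⟨h0, h1, h2⟩ := (mem_seg_iff hP.leftRight).mp hr
    refine ⟨fun h => hrX (Or.inr (Set.mem_iUnion.mpr ⟨e, h, h0⟩)), h1.lt_of_ne fun h => ?_,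
      h2.lt_of_ne fun h => ?_, h0⟩
    · exact hrX (Or.inl ⟨Sum.inl e, Sum.inr (Sum.inl e.1), by simp, h0, by simp [lineFn, h]⟩)
    · exact hrX (Or.inl ⟨Sum.inl e, Sum.inr (Sum.inr e.2), by simp, h0, by simp [lineFn, h]⟩)
  have hsub : touched P G o X ⊆ ((Sp 1 1 ∪ Sp 1 (-1)) ∪ (Sp (-1) 1 ∪ Sp (-1) (-1)) :
      Finset (A × B)) := by
    rintro e ⟨he, r, hr, hrX, hrF⟩
    obtain ⟨hc, h1, h2, h0⟩ := hstrict e r hr hrX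
    have hmem : ∀ σ τ, e ∈ Sp σ τ ↔ e ∈ G ∧ ∃ r ∈ seg P e, r ∉ X ∧ σ * (r.1 - c) < 0 ∧
      r ∈ closure (F ∩ {p | τ * lineFn P (Sum.inl e) p < 0}) := fun σ τ => by simp [Sp]
    have hcl : r ∈ closure (F ∩ {p | 1 * lineFn P (Sum.inl e) p < 0}) ∨
        r ∈ closure (F ∩ {p | -1 * lineFn P (Sum.inl e) p < 0}) := by
      rw [← Set.mem_union, ← closure_union, ← Set.inter_union_distrib_left,
        mem_closure_iff_frequently]
      have hev : ∀ᶠ p in nhds r, (P (Sum.inl e.1)).1 < p.1 ∧ p.1 < (P (Sum.inr e.2)).1 :=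
        ((continuous_fst.tendsto r).eventually (lt_mem_nhds h1)).and
          ((continuous_fst.tendsto r).eventually (gt_mem_nhds h2))
      refine ((mem_closure_iff_frequently.mp hrF).and_eventually hev).mono ?_
      rintro p ⟨hpF, hp1, hp2⟩
      refine ⟨hpF, ?_⟩
      have hne : lineFn P (Sum.inl e) p ≠ 0 := fun h => by
        rcases hFav e he p hpF h with h' | h'
        · exact lt_asymm h' hp1
        · exact lt_asymm h' hp2
      rcases hne.lt_or_gt with h | h
      · exact Or.inl (show 1 * lineFn P (Sum.inl e) p < 0 by linarith)
      · exact Or.inr (show -1 * lineFn P (Sum.inl e) p < 0 by linarith)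
    simp only [Finset.coe_union, Set.mem_union, Finset.mem_coe, hmem]
    rcases hc.lt_or_gt with hc | hc <;> rcases hcl with hcl | hcl
    · exact Or.inl (Or.inl ⟨he, r, hr, hrX, by linarith, hcl⟩)
    · exact Or.inl (Or.inr ⟨he, r, hr, hrX, by linarith, hcl⟩)
    · exact Or.inr (Or.inl ⟨he, r, hr, hrX, by linarith, hcl⟩)
    · exact Or.inr (Or.inr ⟨he, r, hr, hrX, by linarith, hcl⟩)
  have hoff : ∀ a b v, lineFn P (Sum.inl (a, b)) (P v) = 0 → v = Sum.inl a ∨ v = Sum.inr b := by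
    intro a b v h
    by_contra! hcon
    exact hP.off_line (a, b) v hcon.1 hcon.2 h
  have hbl : ∀ τ, τ * τ = 1 → (Sp 1 τ).card ≤ touchBound (Fintype.card A) (Fintype.card B) := by
    intro τ hτ
    refine card_le_touchBound (c := c) (σ := 1) (by norm_num) hτ (u := fun a => P (Sum.inl a))
      (v := fun b => P (Sum.inr b)) (fun a => by linarith [hcl a]) (fun b => by linarith [hcr b])
      (fun a b b' h => ?_) (fun a a' b h => ?_) hFo hFc (fun e he p hp h => ?_) (fun e he => ?_)
    · have := hoff a b (Sum.inr b') (by rwa [lineFn_eq_orient])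
      simpa [eq_comm] using this
    · have := hoff a b (Sum.inl a') (by rwa [lineFn_eq_orient])
      simpa [eq_comm] using this
    · have := hFav e (Finset.mem_filter.mp he).2.1 p hp (by rwa [lineFn_eq_orient])
      rcases this with h' | h'
      · left; linarith
      · right; linarith
    · obtain ⟨-, -, r, hr, hrX, h1, h2⟩ := Finset.mem_filter.mp he
      obtain ⟨-, h3, -, h0⟩ := hstrict e r hr hrX
      refine ⟨r, by linarith, h1, by rwa [← lineFn_eq_orient], ?_⟩
      simpa only [one_mul, ← lineFn_eq_orient] using h2
  have hbr : ∀ τ, τ * τ = 1 → (Sp (-1) τ).card ≤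
      touchBound (Fintype.card B) (Fintype.card A) := by
    intro τ hτ
    rw [← Finset.card_map (Equiv.prodComm A B).toEmbedding]
    have hm : ∀ e, e ∈ (Sp (-1) τ).map (Equiv.prodComm A B).toEmbedding ↔ e.swap ∈ Sp (-1) τ := by
      simp
    refine card_le_touchBound (c := c) (σ := -1) (by norm_num) hτ (u := fun b => P (Sum.inr b))
      (v := fun a => P (Sum.inl a)) (fun b => by linarith [hcr b]) (fun a => by linarith [hcl a])
      (fun b a a' h => ?_) (fun b b' a h => ?_) hFo hFc (fun e he p hp h => ?_) (fun e he => ?_)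
    · rw [orient_swap, neg_eq_zero] at h
      have := hoff a b (Sum.inl a') (by rwa [lineFn_eq_orient])
      simpa [eq_comm] using this
    · rw [orient_swap, neg_eq_zero] at h
      have := hoff a b (Sum.inr b') (by rwa [lineFn_eq_orient])
      simpa [eq_comm] using this
    · rw [orient_swap, neg_eq_zero] at h
      have := hFav e.swap (Finset.mem_filter.mp ((hm e).mp he)).2.1 p hp
        (by rwa [lineFn_eq_orient])
      simp only [Prod.fst_swap, Prod.snd_swap] at this
      rcases this with h' | h'
      · right; linarith
      · left; linarith
    · obtain ⟨-, -, r, hr, hrX, h1, h2⟩ := Finset.mem_filter.mp ((hm e).mp he)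
      obtain ⟨-, -, h3, h0⟩ := hstrict _ r hr hrX
      simp only [Prod.snd_swap] at h3
      rw [lineFn_eq_orient] at h0
      refine ⟨r, by linarith, h1, by rw [orient_swap, neg_eq_zero]; exact h0, ?_⟩
      convert h2 using 5
      rw [lineFn_eq_orient, orient_swap]
      simp
  refine (Set.ncard_le_ncard hsub (Finset.finite_toSet _)).trans ?_
  rw [Set.ncard_coe_finset]
  refine (Finset.card_union_le _ _).trans ((add_le_add (Finset.card_union_le _ _)
    (Finset.card_union_le _ _)).trans ?_)
  have := hbl 1 (by norm_num)
  have := hbl (-1) (by norm_num)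
  have := hbr 1 (by norm_num)
  have := hbr (-1) (by norm_num)
  omega

end CrossDrawing

end

section

theorem card_filter_card_le {ι : Type} [Fintype ι] (s : ℕ) :
    ((Finset.univ : Finset (Finset ι)).filter fun S => S.card ≤ s).card ≤
      2 ^ (4 * s + (Fintype.card ι / 8 + 1)) := by
  set N := Fintype.card ι with hN
  have h1 : ∑ S : Finset ι, (16⁻¹ : ℝ) ^ S.card = (17 / 16) ^ N := by
    have := Finset.sum_pow_mul_eq_add_pow (16⁻¹ : ℝ) 1 (Finset.univ : Finset ι)
    simp only [one_pow, mul_one, Finset.powerset_univ, Finset.card_univ] at this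
    rw [this]
    norm_num [hN]
  have h2 : (((Finset.univ : Finset (Finset ι)).filter fun S => S.card ≤ s).card : ℝ) *
      (16⁻¹ : ℝ) ^ s ≤ (17 / 16) ^ N := by
    rw [← h1, ← nsmul_eq_mul, ← Finset.sum_const]
    refine (Finset.sum_le_sum fun S hS => ?_).trans
      (Finset.sum_le_univ_sum_of_nonneg fun S => by positivity)
    exact pow_le_pow_of_le_one (by norm_num) (by norm_num) (Finset.mem_filter.mp hS).2
  have h3 : ((17 : ℝ) / 16) ^ N ≤ 2 ^ (N / 8 + 1) := by
    calc ((17 : ℝ) / 16) ^ N ≤ (17 / 16) ^ (8 * (N / 8 + 1)) :=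
          pow_le_pow_right₀ (by norm_num) (by omega)
      _ = ((17 / 16) ^ 8) ^ (N / 8 + 1) := pow_mul _ _ _
      _ ≤ 2 ^ (N / 8 + 1) := pow_le_pow_left₀ (by norm_num) (by norm_num) _
  have h4 : (((Finset.univ : Finset (Finset ι)).filter fun S => S.card ≤ s).card : ℝ) ≤
      2 ^ (4 * s + (N / 8 + 1)) := by
    rw [pow_add, pow_mul]
    have h5 : (16⁻¹ : ℝ) ^ s * (2 ^ 4) ^ s = 1 := by rw [← mul_pow]; norm_num
    calc _ = (((Finset.univ : Finset (Finset ι)).filter fun S => S.card ≤ s).card : ℝ) *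
          (16⁻¹ : ℝ) ^ s * (2 ^ 4) ^ s := by rw [mul_assoc, h5, mul_one]
      _ ≤ 2 ^ (N / 8 + 1) * (2 ^ 4) ^ s := by gcongr; exact h2.trans h3
      _ = _ := mul_comm _ _
  exact_mod_cast h4

namespace CrossDrawing

variable {A B : Type}

/-- A bipartite pattern drawn with straight segments, whose nonedges are the segments met by
one of `h` nonempty connected sets. -/
def Representable (h : ℕ) (G : Finset (A × B)) : Prop :=
  ∃ P : A ⊕ B → ℝ × ℝ, Good P ∧ ∃ O : Fin h → Set (ℝ × ℝ), (∀ j, IsPreconnected (O j)) ∧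
    (∀ j, (O j).Nonempty) ∧ ∀ e, e ∈ G ↔ ∀ j, Disjoint (seg P e) (O j)

variable [Fintype A] [Fintype B]

/-- The pattern reconstructed from its critical edges and a cell for each obstacle. -/
def decode {h : ℕ} (Γ : Set (LineIdx A B → Bool)) (S : Finset (A × B))
    (σ : Fin h → LineIdx A B → Bool) : Finset (A × B) :=
  Finset.univ.filter fun t => t ∈ S ∨ ∀ j, ¬ Hits Γ (↑S) (σ j) t

theorem Representable.exists_decode [Nonempty A] [Nonempty B] {h : ℕ} {G : Finset (A × B)}
    (hG : Representable h G) : ∃ P : A ⊕ B → ℝ × ℝ, LeftRight P ∧ ∃ S : Finset (A × B),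
      S.card ≤ h * (2 * (touchBound (Fintype.card A) (Fintype.card B) +
        touchBound (Fintype.card B) (Fintype.card A))) ∧
      ∃ σ : Fin h → LineIdx A B → Bool, (∀ j, σ j ∈ cells P) ∧ decode (cells P) S σ = G := by
  obtain ⟨P, hP, O, hOc, hOne, hO⟩ := hG
  obtain ⟨X, hX, hXT⟩ := exists_finite_card_touched_le hP
  choose o ho using hOne
  have hOG : ∀ j, O j ⊆ free P ↑G := by
    intro j p hp hp'
    obtain ⟨e, he, hpe⟩ := Set.mem_iUnion₂.mp hp'
    exact Set.disjoint_left.mp ((hO e).mp he j) hpe hp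
  set S : Finset (A × B) := Finset.univ.filter fun e => ∃ j, e ∈ touched P ↑G (o j) X with hS
  have hSG : (S : Set (A × B)) ⊆ ↑G := by
    intro e he
    obtain ⟨-, j, hj⟩ := Finset.mem_filter.mp he
    exact hj.1
  have hfree := free_anti P hSG
  have hOC : ∀ j, O j ⊆ connectedComponentIn (free P ↑S) (o j) := fun j =>
    (hOc j).subset_connectedComponentIn (ho j) ((hOG j).trans hfree)
  have hp : ∀ j, ∃ p ∈ connectedComponentIn (free P ↑S) (o j), Generic P p := fun j =>
    exists_generic_mem hP.leftRight (isOpen_free P _).connectedComponentIn ⟨_, hOC j (ho j)⟩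
  choose p hp hpg using hp
  refine ⟨P, hP.leftRight, S, ?_, fun j => side P (p j), fun j => ⟨p j, hpg j, rfl⟩, ?_⟩
  · have : S ⊆ Finset.univ.biUnion fun j => (touched P ↑G (o j) X).toFinite.toFinset := by
      intro e he
      obtain ⟨-, j, hj⟩ := Finset.mem_filter.mp he
      exact Finset.mem_biUnion.mpr ⟨j, Finset.mem_univ _, (Set.Finite.mem_toFinset _).mpr hj⟩
    refine (Finset.card_le_card this).trans ((Finset.card_biUnion_le_card_mul _ _ _
      fun j _ => ?_).trans_eq (by rw [Finset.card_univ, Fintype.card_fin]))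
    rw [← Set.ncard_eq_toFinset_card]
    exact hXT _ _
  · ext t
    simp only [decode, Finset.mem_filter, Finset.mem_univ, true_and]
    by_cases htS : t ∈ S
    · exact iff_of_true (Or.inl htS) (hSG htS)
    have hhit := fun j => hits_iff hP (hp j) (hpg j) (t := t) (by exact_mod_cast htS)
    constructor
    · rintro (h | h)
      · exact absurd h htS
      · refine (hO t).mpr fun j => ?_
        rw [Set.disjoint_iff_inter_eq_empty, ← Set.not_nonempty_iff_eq_empty]
        exact fun hne => h j ((hhit j).mpr (hne.mono (Set.inter_subset_inter_right _ (hOC j))))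
    · refine fun htG => Or.inr fun j hj => ?_
      have := seg_disjoint_component hP.leftRight (hOG j (ho j)) hX (S := ↑S)
        (fun e he => Finset.mem_coe.mpr (Finset.mem_filter.mpr ⟨Finset.mem_univ _, j, he⟩)) hSG
        (Finset.mem_coe.mpr htG)
      exact Set.not_nonempty_iff_eq_empty.mpr (Set.disjoint_iff_inter_eq_empty.mp this)
        ((hhit j).mp hj)

theorem card_representable_le [Nonempty A] [Nonempty B] (h : ℕ) {m s : ℕ}
    (hm : Fintype.card (((A × B) × (A × B)) ⊕ ((A ⊕ B) × Bool)) ≤ m)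
    (hs : h * (2 * (touchBound (Fintype.card A) (Fintype.card B) +
      touchBound (Fintype.card B) (Fintype.card A))) ≤ s) :
    ((Finset.univ : Finset (Finset (A × B))).filter (Representable h)).card ≤
      (20 * (2 * m + m ^ 2) + 1) ^ (2 * Fintype.card (A ⊕ B)) *
        (2 ^ (4 * s + (Fintype.card (A × B) / 8 + 1)) *
          ((2 * Fintype.card (LineIdx A B) + 1) ^ 2) ^ h) := by
  let 𝒯 : Finset (Set (LineIdx A B → Bool)) := Finset.univ.filter fun Γ =>
    ∃ P : A ⊕ B → ℝ × ℝ, LeftRight P ∧ cells P = Γ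
  let 𝒮 : Finset (Finset (A × B)) := Finset.univ.filter fun S => S.card ≤ s
  have hsub : ((Finset.univ : Finset (Finset (A × B))).filter (Representable h)) ⊆
      𝒯.biUnion fun Γ => 𝒮.biUnion fun S =>
        (Fintype.piFinset fun _ : Fin h => Γ.toFinset).image (decode Γ S) := by
    intro G hG
    obtain ⟨P, hP, S, hS, σ, hσ, rfl⟩ := (Finset.mem_filter.mp hG).2.exists_decode
    refine Finset.mem_biUnion.mpr ⟨cells P, ?_, Finset.mem_biUnion.mpr ⟨S, ?_, ?_⟩⟩
    · exact Finset.mem_filter.mpr ⟨Finset.mem_univ _, P, hP, rfl⟩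
    · exact Finset.mem_filter.mpr ⟨Finset.mem_univ _, hS.trans hs⟩
    · exact Finset.mem_image_of_mem _ (Fintype.mem_piFinset.mpr fun j => Set.mem_toFinset.mpr (hσ j))
  refine (Finset.card_le_card hsub).trans ((Finset.card_biUnion_le_card_mul _ _ _
    fun Γ hΓ => (Finset.card_biUnion_le_card_mul _ _ _ fun S _ => ?_).trans
      (Nat.mul_le_mul_right _ (card_filter_card_le s))).trans
    (Nat.mul_le_mul_right _ (card_cells_le 𝒯 (fun Γ hΓ => (Finset.mem_filter.mp hΓ).2) hm)))
  refine Finset.card_image_le.trans ?_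
  rw [Fintype.card_piFinset, Finset.prod_const, Finset.card_univ, Fintype.card_fin]
  obtain ⟨P, -, rfl⟩ := (Finset.mem_filter.mp hΓ).2
  exact Nat.pow_le_pow_left (card_le_of_subset_cells P _ fun σ hσ => Set.mem_toFinset.mp hσ) _

/-- Few patterns on `2 ^ k + 2 ^ k` vertices are representable with few connected sets. -/
theorem card_representable_fin_le {k h : ℕ} (hh : 1 ≤ h) (hk : 1024 * (k + 1) * h ≤ 2 ^ k) :
    ((Finset.univ : Finset (Finset (Fin (2 ^ k) × Fin (2 ^ k)))).filter (Representable h)).card ≤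
      2 ^ (2 ^ k * 2 ^ k / 2) := by
  set q := 2 ^ k with hq
  have hK : 1024 * (k + 1) ≤ q := le_trans (by nlinarith) hk
  have hq4 : 1024 ≤ q := by nlinarith
  have : NeZero q := ⟨by omega⟩
  refine (card_representable_le h (m := 2 ^ (4 * k + 1)) (s := h * (4 * (q * (4 * k + 5)))) ?_
    ?_).trans ?_
  · simp only [Fintype.card_sum, Fintype.card_prod, Fintype.card_fin, Fintype.card_bool]
    have : 2 ^ (4 * k + 1) = 2 * (q * q * (q * q)) := by rw [hq]; ring
    rw [this]
    nlinarith [mul_le_mul hq4 hq4 (by norm_num) (by omega)]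
  · have : touchBound q q = q * (4 * k + 5) := by
      have : Nat.log 2 (q * q) = 2 * k := by
        rw [hq, ← pow_add, Nat.log_pow (by norm_num)]; ring
      rw [touchBound, this]; ring
    rw [Fintype.card_fin, this]
    exact le_of_eq (by ring)
  · simp only [Fintype.card_sum, Fintype.card_prod, Fintype.card_fin]
    have h1 : 20 * (2 * 2 ^ (4 * k + 1) + (2 ^ (4 * k + 1)) ^ 2) + 1 ≤ 2 ^ (8 * k + 8) := by
      have e1 : 2 ^ (8 * k + 8) = 256 * (q * q * (q * q)) * (q * q * (q * q)) := by rw [hq]; ring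
      have e2 : 2 ^ (4 * k + 1) = 2 * (q * q * (q * q)) := by rw [hq]; ring
      rw [e1, e2]
      have : 1024 ≤ q * q * (q * q) := by nlinarith [mul_le_mul hq4 hq4 (by norm_num) (by omega)]
      nlinarith
    have h2 : (2 * (q * q + (q + q)) + 1) ^ 2 ≤ 2 ^ (4 * k + 6) := by
      have : 2 ^ (4 * k + 6) = (8 * (q * q)) ^ 2 := by rw [hq]; ring
      rw [this]
      exact Nat.pow_le_pow_left (by nlinarith) _
    refine (Nat.mul_le_mul (Nat.pow_le_pow_left h1 _)
      (Nat.mul_le_mul_left _ (Nat.pow_le_pow_left h2 _))).trans ?_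
    rw [← pow_mul, ← pow_mul, ← pow_add, ← pow_add]
    refine Nat.pow_le_pow_right (by norm_num) ?_
    have e3 : (8 * k + 8) * (2 * (q + q)) = 32 * (k + 1) * q := by ring
    have e4 : 32 * (32 * (k + 1) * q) ≤ q * q := by nlinarith
    have e5 : 4 * (h * (4 * (q * (4 * k + 5)))) + (4 * k + 6) * h ≤ 96 * (k + 1) * h * q := by
      have : 0 < h := hh
      nlinarith [mul_pos this (show 0 < q by omega), Nat.zero_le (k * h * q), Nat.zero_le (k * h),
        Nat.mul_le_mul_left h (show 1 ≤ q by omega),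
        Nat.mul_le_mul_left (k * h) (show 1 ≤ q by omega)]
    have e6 : 32 * (96 * (k + 1) * h * q) ≤ 3 * (q * q) := by nlinarith
    have e7 : 1024 ≤ q * q := by nlinarith
    rw [e3]
    omega

end CrossDrawing

end

section

namespace SimplePolygon
open Set

variable (P : SimplePolygon)

theorem neZero_k : NeZero P.k := ⟨by have := P.three_le; omega⟩

theorem isClosed_boundary : IsClosed P.boundary := by
  have := P.neZero_k
  refine isClosed_iUnion_of_finite fun i => ?_
  rw [← convexHull_pair]
  exact ((Set.toFinite _).isCompact_convexHull ℝ).isClosed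

theorem isPreconnected_boundary : IsPreconnected P.boundary := by
  have := P.neZero_k
  refine IsPreconnected.iUnion_of_reflTransGen
    (fun i => (convex_segment _ _).isPreconnected) fun i j => ?_
  have key : ∀ m : ℕ, Relation.ReflTransGen (fun i j : ZMod P.k =>
      (segment ℝ (P.verts i) (P.verts (i + 1)) ∩
        segment ℝ (P.verts j) (P.verts (j + 1))).Nonempty) i (i + m) := by
    intro m
    induction m with
    | zero => simpa using Relation.ReflTransGen.refl
    | succ m ih =>
      refine ih.tail ⟨P.verts (i + m + 1), right_mem_segment _ _ _, ?_⟩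
      rw [Nat.cast_succ, ← add_assoc]
      exact left_mem_segment _ _ _
  have := key (j - i).val
  rwa [ZMod.natCast_val, ZMod.cast_id', id, add_sub_cancel] at this

theorem vert_mem_boundary (i : ZMod P.k) : P.verts i ∈ P.boundary :=
  mem_iUnion.2 ⟨i, left_mem_segment _ _ _⟩

theorem nonempty_toSet : P.toSet.Nonempty := ⟨_, Or.inl (P.vert_mem_boundary 0)⟩

theorem isPreconnected_toSet : IsPreconnected P.toSet := by
  refine isPreconnected_of_forall (P.verts 0) fun y hy => ?_
  rcases hy with hy | ⟨hy, hb⟩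
  · exact ⟨P.boundary, subset_union_left, P.vert_mem_boundary 0, hy, P.isPreconnected_boundary⟩
  set C := connectedComponentIn P.boundaryᶜ y with hC
  have hyC : y ∈ C := mem_connectedComponentIn hy
  have hCs : C ⊆ P.boundaryᶜ := connectedComponentIn_subset _ _
  have hCp : IsPreconnected C := isPreconnected_connectedComponentIn
  have hCo : IsOpen C := P.isClosed_boundary.isOpen_compl.connectedComponentIn
  obtain ⟨z, hz, hzC⟩ : ∃ z ∈ closure C, z ∉ C := by
    by_contra! h
    have hcl : IsClosed C := isClosed_of_closure_subset h
    rcases isClopen_iff.1 ⟨hcl, hCo⟩ with h0 | h0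
    · simp [h0] at hyC
    · rw [h0] at hb
      exact NormedSpace.unbounded_univ ℝ (ℝ × ℝ) hb
  have hp : IsPreconnected (insert z C) :=
    hCp.subset_closure (subset_insert _ _) (insert_subset hz subset_closure)
  have hzb : z ∈ P.boundary := by
    by_contra hzb
    exact hzC (hp.subset_connectedComponentIn (mem_insert_of_mem _ hyC)
      (insert_subset hzb hCs) (mem_insert _ _))
  refine ⟨P.boundary ∪ insert z C, union_subset subset_union_left
    (insert_subset (Or.inl hzb) fun w hw => Or.inr ⟨hCs hw, ?_⟩),
    Or.inl (P.vert_mem_boundary 0), Or.inr (mem_insert_of_mem _ hyC),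
    P.isPreconnected_boundary.union z hzb (mem_insert _ _) hp⟩
  rwa [← connectedComponentIn_eq hw]

end SimplePolygon

end

section

namespace CrossDrawing
open Set

variable {A B V κ ι : Type}

theorem representable_of_family [Fintype ι] [Nonempty ι] {h : ℕ} (hι : Fintype.card ι ≤ h)
    {G : Finset (A × B)} {P : A ⊕ B → ℝ × ℝ} (hP : Good P) {O : ι → Set (ℝ × ℝ)}
    (hcon : ∀ j, IsPreconnected (O j)) (hne : ∀ j, (O j).Nonempty)
    (hG : ∀ e, e ∈ G ↔ ∀ j, Disjoint (seg P e) (O j)) : Representable h G := by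
  obtain ⟨f⟩ : Nonempty (ι ↪ Fin h) :=
    Function.Embedding.nonempty_of_card_le (by simpa using hι)
  have hs : Function.Surjective (Function.invFun f) := Function.invFun_surjective f.injective
  exact ⟨P, hP, fun j => O (Function.invFun f j), fun j => hcon _, fun j => hne _,
    fun e => (hG e).trans (hs.forall (p := fun j => Disjoint (seg P e) (O j)))⟩

/-- The pattern of a graph between two groups of vertices. -/
def crossPattern [Fintype A] [Fintype B] (G : SimpleGraph V) (u : A ⊕ B → V) : Finset (A × B) :=
  Finset.univ.filter fun e => G.Adj (u (Sum.inl e.1)) (u (Sum.inr e.2))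

theorem representable_crossPattern [Fintype A] [Fintype B] [Fintype κ] {G : SimpleGraph V}
    {p : V → ℝ × ℝ} (hx : Function.Injective fun v => (p v).1)
    (ho : ∀ a b c, a ≠ b → a ≠ c → b ≠ c → orient (p a) (p b) (p c) ≠ 0)
    {O : κ → Set (ℝ × ℝ)} (hcon : ∀ i, IsPreconnected (O i)) (hne : ∀ i, (O i).Nonempty)
    (hadj : ∀ a b, a ≠ b → (G.Adj a b ↔ ∀ i, Disjoint (segment ℝ (p a) (p b)) (O i)))
    {u : A ⊕ B → V} (hu : Function.Injective u) (hlr : LeftRight (p ∘ u)) {c₀ c₁ : ℝ}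
    (hc : ∀ v, (p (u v)).1 ∈ Icc c₀ c₁) {h : ℕ}
    (hh : (Finset.univ.filter fun i => O i ⊆ Icc c₀ c₁ ×ˢ univ).card + 1 ≤ h) :
    Representable h (crossPattern G u) := by
  obtain ⟨Y, hY⟩ : ∃ Y, ∀ v, (p (u v)).2 ≤ Y := by
    obtain ⟨Y, hY⟩ := (Set.finite_range fun v => (p (u v)).2).bddAbove
    exact ⟨Y, fun v => hY ⟨v, rfl⟩⟩
  have hP : Good (p ∘ u) := by
    refine ⟨hlr, fun v w hvw => hu (hx hvw), fun e v h1 h2 => ?_⟩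
    rw [lineFn_eq_orient]
    exact ho _ _ _ (fun h => by simpa using hu h) (fun h => h1 (hu h).symm)
      (fun h => h2 (hu h).symm)
  set base : Set (ℝ × ℝ) := (Iio c₀ ×ˢ univ ∪ univ ×ˢ Ioi Y) ∪ Ioi c₁ ×ˢ univ with hbase
  have hbp : IsPreconnected base := by
    refine IsPreconnected.union' ⟨(c₁ + 1, Y + 1), by simp [mem_prod], by simp [mem_prod]⟩
      (IsPreconnected.union' ⟨(c₀ - 1, Y + 1), by simp [mem_prod], by simp [mem_prod]⟩ ?_ ?_) ?_
    · exact ((convex_Iio c₀).prod convex_univ).isPreconnected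
    · exact (convex_univ.prod (convex_Ioi Y)).isPreconnected
    · exact ((convex_Ioi c₁).prod convex_univ).isPreconnected
  set M : Set (ℝ × ℝ) := base ∪ ⋃ i ∈ {i | ¬ O i ⊆ Icc c₀ c₁ ×ˢ univ}, O i with hM
  have hb0 : ((c₀ - 1, 0) : ℝ × ℝ) ∈ base := by simp [hbase, mem_prod]
  have hMp : IsPreconnected M := by
    refine isPreconnected_of_forall (c₀ - 1, 0) fun y hy => ?_
    rcases hy with hy | hy
    · exact ⟨base, subset_union_left, hb0, hy, hbp⟩
    · obtain ⟨i, hi, hyi⟩ := mem_iUnion₂.1 hy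
      refine ⟨base ∪ O i, union_subset_union_right _ (subset_biUnion_of_mem hi), Or.inl hb0,
        Or.inr hyi, hbp.union' ?_ (hcon i)⟩
      obtain ⟨z, hz, hz'⟩ := not_subset.1 hi
      refine ⟨z, ?_, hz⟩
      have : z.1 < c₀ ∨ c₁ < z.1 := by
        by_contra! hcon
        exact hz' ⟨hcon, trivial⟩
      rcases this with h | h
      · exact Or.inl (Or.inl ⟨h, trivial⟩)
      · exact Or.inr ⟨h, trivial⟩
  have hsegb : ∀ e, Disjoint (seg (p ∘ u) e) base := by
    intro e
    have : seg (p ∘ u) e ⊆ Icc c₀ c₁ ×ˢ Iic Y :=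
      ((convex_Icc c₀ c₁).prod (convex_Iic Y)).segment_subset ⟨hc _, hY _⟩ ⟨hc _, hY _⟩
    refine (disjoint_left.2 fun z hz hz' => ?_ : Disjoint (Icc c₀ c₁ ×ˢ Iic Y) base).mono_left this
    obtain ⟨⟨h1, h2⟩, h3⟩ := hz
    rcases hz' with (h | h) | h
    · exact absurd h.1 (not_lt.2 h1)
    · exact not_lt.2 h3 (mem_Ioi.1 h.2)
    · exact absurd h.1 (not_lt.2 h2)
  refine representable_of_family (ι := Option {i // O i ⊆ Icc c₀ c₁ ×ˢ univ}) ?_ hP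
    (O := fun j => j.elim M fun i => O i) ?_ ?_ ?_
  · rw [Fintype.card_option, Fintype.card_subtype]
    exact hh
  · rintro (_ | i)
    · exact hMp
    · exact hcon i
  · rintro (_ | i)
    · exact ⟨_, Or.inl hb0⟩
    · exact hne i
  · intro e
    have hee : u (Sum.inl e.1) ≠ u (Sum.inr e.2) := fun h => by simpa using hu h
    rw [crossPattern, Finset.mem_filter, hadj _ _ hee]
    simp only [Finset.mem_univ, true_and]
    change (∀ i, Disjoint (seg (p ∘ u) e) (O i)) ↔ _
    constructor
    · rintro h (_ | i)
      · refine disjoint_union_right.2 ⟨hsegb e, ?_⟩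
        simp only [disjoint_iUnion_right]
        exact fun i _ => h i
      · exact h i
    · intro h i
      by_cases hi : O i ⊆ Icc c₀ c₁ ×ˢ univ
      · exact h (some ⟨i, hi⟩)
      · exact (h none).mono_right (subset_union_of_subset_right
          (subset_biUnion_of_mem (u := fun i => O i) hi) _)

end CrossDrawing

end

section

namespace CrossDrawing
open Set

theorem mul_le_card_of_not_representable {κ : Type} [Fintype κ] {n m q h : ℕ} (hq : 0 < q)
    (hm : m * (q + q) ≤ n) {G : SimpleGraph (Fin n)}
    (hG : ∀ u : Fin q ⊕ Fin q → Fin n, Function.Injective u → ¬ Representable h (crossPattern G u))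
    {p : Fin n → ℝ × ℝ} (hx : Function.Injective fun v => (p v).1)
    (ho : ∀ a b c, a ≠ b → a ≠ c → b ≠ c → orient (p a) (p b) (p c) ≠ 0)
    {O : κ → Set (ℝ × ℝ)} (hcon : ∀ i, IsPreconnected (O i)) (hne : ∀ i, (O i).Nonempty)
    (hadj : ∀ a b, a ≠ b → (G.Adj a b ↔ ∀ i, Disjoint (segment ℝ (p a) (p b)) (O i))) :
    m * h ≤ Fintype.card κ := by
  set σ := Tuple.sort fun v => (p v).1 with hσ
  set y : Fin n → ℝ := fun i => (p (σ i)).1 with hy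
  have hmono : StrictMono y :=
    (Tuple.monotone_sort fun v => (p v).1).strictMono_of_injective (hx.comp σ.injective)
  have hlt : ∀ (i : Fin m) (t : Fin (q + q)), i.1 * (q + q) + t.1 < n := by
    intro i t
    have h1 : (i.1 + 1) * (q + q) ≤ m * (q + q) := Nat.mul_le_mul_right _ i.2
    have h2 := t.2
    rw [add_mul, one_mul] at h1
    omega
  set idx : Fin m → Fin (q + q) → Fin n := fun i t => ⟨i.1 * (q + q) + t.1, hlt i t⟩ with hidx
  have hidx_inj : ∀ i, Function.Injective (idx i) := by
    intro i s t hst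
    have := congrArg Fin.val hst
    simp only [hidx, add_right_inj] at this
    exact Fin.ext this
  set u : Fin m → Fin q ⊕ Fin q → Fin n := fun i v => σ (idx i (finSumFinEquiv v)) with hu
  set c₀ : Fin m → ℝ := fun i => y (idx i ⟨0, by omega⟩) with hc₀
  set c₁ : Fin m → ℝ := fun i => y (idx i ⟨q + q - 1, by omega⟩) with hc₁
  set F : Fin m → Finset κ := fun i =>
    Finset.univ.filter fun j => O j ⊆ Icc (c₀ i) (c₁ i) ×ˢ univ with hF
  have hcard : ∀ i, h ≤ (F i).card := by
    intro i
    by_contra! hlt'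
    refine hG (u i) (fun v w hvw => finSumFinEquiv.injective (hidx_inj i (σ.injective hvw)))
      (representable_crossPattern hx ho hcon hne hadj
        (fun v w hvw => finSumFinEquiv.injective (hidx_inj i (σ.injective hvw)))
        (c₀ := c₀ i) (c₁ := c₁ i) ?_ ?_ hlt')
    · intro a b
      refine hmono (show idx i _ < idx i _ from ?_)
      simp only [hidx, Fin.mk_lt_mk, finSumFinEquiv_apply_left, finSumFinEquiv_apply_right,
        Fin.val_castAdd, Fin.val_natAdd]
      omega
    · intro v
      refine ⟨hmono.monotone (show idx i _ ≤ idx i _ from ?_),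
        hmono.monotone (show idx i _ ≤ idx i _ from ?_)⟩
      · simp only [hidx, Fin.mk_le_mk]
        omega
      · have := (finSumFinEquiv v).2
        simp only [hidx, Fin.mk_le_mk]
        omega
  have hlt2 : ∀ i j : Fin m, i < j → c₁ i < c₀ j := by
    intro i j hij
    refine hmono (show idx i _ < idx j _ from ?_)
    simp only [hidx, Fin.mk_lt_mk]
    have h1 : (i.1 + 1) * (q + q) ≤ j.1 * (q + q) := Nat.mul_le_mul_right _ hij
    rw [add_mul, one_mul] at h1
    omega
  have hdisj : ∀ i j : Fin m, i < j → Disjoint (F i) (F j) := by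
    intro i j hij
    refine Finset.disjoint_left.2 fun k hi hj => ?_
    obtain ⟨z, hz⟩ := hne k
    have h1 := ((Finset.mem_filter.1 hi).2 hz).1.2
    have h2 := ((Finset.mem_filter.1 hj).2 hz).1.1
    linarith [hlt2 i j hij]
  calc m * h = ∑ _i : Fin m, h := by simp
    _ ≤ ∑ i, (F i).card := Finset.sum_le_sum fun i _ => hcard i
    _ = (Finset.univ.biUnion F).card := by
        refine (Finset.card_biUnion fun i _ j _ hij => ?_).symm
        rcases lt_or_gt_of_ne hij with h | h
        · exact hdisj i j h
        · exact (hdisj j i h).symm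
    _ ≤ Fintype.card κ := Finset.card_le_univ _

/-- A horizontal shear of the plane. -/
def shear (ε : ℝ) : (ℝ × ℝ) →L[ℝ] (ℝ × ℝ) :=
  (ContinuousLinearMap.fst ℝ ℝ ℝ + ε • ContinuousLinearMap.snd ℝ ℝ ℝ).prod
    (ContinuousLinearMap.snd ℝ ℝ ℝ)

theorem shear_apply (ε : ℝ) (x : ℝ × ℝ) : shear ε x = (x.1 + ε * x.2, x.2) := by
  simp [shear]

theorem shear_injective (ε : ℝ) : Function.Injective (shear ε) := by
  intro x y h
  rw [shear_apply, shear_apply, Prod.mk.injEq] at h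
  obtain ⟨h1, h2⟩ := h
  rw [h2] at h1
  exact Prod.ext (by linarith) h2

theorem orient_shear (ε : ℝ) (u v p : ℝ × ℝ) :
    orient (shear ε u) (shear ε v) (shear ε p) = orient u v p := by
  simp only [shear_apply, orient]
  ring

theorem exists_shear_injective {V : Type} [Finite V] {p : V → ℝ × ℝ} (hp : Function.Injective p) :
    ∃ ε : ℝ, Function.Injective fun v => (shear ε (p v)).1 := by
  obtain ⟨ε, hε⟩ := (Set.finite_range fun e : V × V =>
    -((p e.1).1 - (p e.2).1) / ((p e.1).2 - (p e.2).2)).exists_notMem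
  refine ⟨ε, fun v w hvw => hp ?_⟩
  simp only [shear_apply] at hvw
  by_cases h2 : (p v).2 = (p w).2
  · rw [h2] at hvw
    exact Prod.ext (by linarith) h2
  · refine absurd ⟨(v, w), ?_⟩ hε
    have : (p v).2 - (p w).2 ≠ 0 := sub_ne_zero.2 h2
    dsimp only
    field_simp
    linarith

theorem collinear_of_orient_eq_zero {u v p : ℝ × ℝ} (huv : u ≠ v) (h : orient u v p = 0) :
    Collinear ℝ ({u, v, p} : Set (ℝ × ℝ)) := by
  rw [collinear_iff_of_mem (p₀ := u) (by simp)]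
  refine ⟨v - u, ?_⟩
  simp only [Set.mem_insert_iff, Set.mem_singleton_iff, forall_eq_or_imp, forall_eq, vadd_eq_add]
  refine ⟨⟨0, by simp⟩, ⟨1, by simp⟩, ?_⟩
  unfold orient at h
  by_cases h1 : v.1 - u.1 = 0
  · have h2 : v.2 - u.2 ≠ 0 := by
      intro h2
      exact huv (Prod.ext (by linarith) (by linarith))
    refine ⟨(p.2 - u.2) / (v.2 - u.2), Prod.ext ?_ ?_⟩
    · have : p.1 - u.1 = 0 := by
        rw [h1, zero_mul, zero_sub, neg_eq_zero] at h
        exact (mul_eq_zero.1 h).resolve_left h2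
      simp only [Prod.fst_add, Prod.smul_fst, Prod.fst_sub, smul_eq_mul, h1]
      linarith
    · simp only [Prod.snd_add, Prod.smul_snd, Prod.snd_sub, smul_eq_mul]
      field_simp
      ring
  · refine ⟨(p.1 - u.1) / (v.1 - u.1), Prod.ext ?_ ?_⟩
    · simp only [Prod.fst_add, Prod.smul_fst, Prod.fst_sub, smul_eq_mul]
      field_simp
      ring
    · simp only [Prod.snd_add, Prod.smul_snd, Prod.snd_sub, smul_eq_mul]
      field_simp
      linarith

theorem mul_le_numObs {n m q h : ℕ} (hq : 0 < q) (hm : m * (q + q) ≤ n) {G : SimpleGraph (Fin n)}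
    (hG : ∀ u : Fin q ⊕ Fin q → Fin n, Function.Injective u → ¬ Representable h (crossPattern G u))
    (R : ObstacleRep G) : m * h ≤ R.numObs := by
  obtain ⟨ε, hε⟩ := exists_shear_injective R.posInj
  have key := mul_le_card_of_not_representable (κ := Fin R.numObs) hq hm hG
    (p := fun v => shear ε (R.pos v)) (O := fun i => shear ε '' (R.obs i).toSet) hε ?_ ?_ ?_ ?_
  · simpa using key
  · intro a b c hab hac hbc h
    rw [orient_shear] at h
    exact R.genPos a b c hab hac hbc (collinear_of_orient_eq_zero (R.posInj.ne hab) h)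
  · exact fun i => (R.obs i).isPreconnected_toSet.image _ (shear ε).continuous.continuousOn
  · exact fun i => (R.obs i).nonempty_toSet.image _
  · intro a b hab
    have himg : segment ℝ (shear ε (R.pos a)) (shear ε (R.pos b)) =
        shear ε '' segment ℝ (R.pos a) (R.pos b) :=
      (image_segment ℝ (shear ε).toLinearMap.toAffineMap _ _).symm
    simp only [himg, Set.disjoint_image_iff (shear_injective ε)]
    refine ⟨fun h => R.edges_clear a b h, fun h => ?_⟩
    by_contra hn
    obtain ⟨i, hi⟩ := R.nonedges_blocked a b hab hn
    exact Set.not_disjoint_iff_nonempty_inter.2 hi (h i)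

end CrossDrawing

end

namespace CrossDrawing

theorem card_filter_comp_mem_mul_le {S T : Type} [Fintype S] [Fintype T] {w : T → S}
    (hw : Function.Injective w) (Q : Finset (T → Bool)) :
    ((Finset.univ : Finset (S → Bool)).filter fun f => f ∘ w ∈ Q).card * 2 ^ Fintype.card T ≤
      Q.card * 2 ^ Fintype.card S := by
  have key := Finset.card_le_card_of_injOn
    (s := ((Finset.univ : Finset (S → Bool)).filter fun f => f ∘ w ∈ Q) ×ˢ
      (Finset.univ : Finset (T → Bool)))
    (t := Q ×ˢ (Finset.univ : Finset (S → Bool)))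
    (fun x => (x.1 ∘ w, Function.extend w x.2 x.1)) ?_ ?_
  · simpa [Finset.card_product] using key
  · rintro ⟨f, t⟩ hx
    simpa using hx
  · rintro ⟨f, t⟩ - ⟨f', t'⟩ - h
    obtain ⟨h1, h2⟩ := Prod.mk.inj h
    dsimp only at h1 h2
    refine Prod.ext (funext fun s => ?_) (funext fun x => ?_)
    · by_cases hs : ∃ x, w x = s
      · obtain ⟨x, rfl⟩ := hs
        exact congrFun h1 x
      · have := congrFun h2 s
        rwa [Function.extend_apply' _ _ _ hs, Function.extend_apply' _ _ _ hs] at this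
    · have := congrFun h2 (w x)
      rwa [hw.extend_apply, hw.extend_apply] at this

/-- The graph whose edges are the pairs coloured `true`. -/
def graphOf {V : Type} (f : Sym2 V → Bool) : SimpleGraph V where
  Adj a b := a ≠ b ∧ f s(a, b) = true
  symm := ⟨fun a b h => ⟨h.1.symm, by rw [Sym2.eq_swap]; exact h.2⟩⟩
  loopless := ⟨fun a h => h.1 rfl⟩

theorem exists_graph {n k h L : ℕ} (hh : 1 ≤ h) (hk : 1024 * (k + 1) * h ≤ 2 ^ k)
    (hn : n ≤ 2 ^ L) (hL : 4 * L < 2 ^ k) :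
    ∃ G : SimpleGraph (Fin n), ∀ u : Fin (2 ^ k) ⊕ Fin (2 ^ k) → Fin n, Function.Injective u →
      ¬ Representable h (crossPattern G u) := by
  have hbase := card_representable_fin_le hh hk
  set q := 2 ^ k with hq
  set Q : Finset (Fin q × Fin q → Bool) := Finset.univ.filter fun g =>
    Representable h (Finset.univ.filter fun e => g e = true) with hQ
  have hQc : Q.card ≤ 2 ^ (q * q / 2) := by
    refine le_trans (Finset.card_le_card_of_injOn
      (fun g => Finset.univ.filter fun e => g e = true) ?_ ?_) hbase
    · intro g hg
      have hg' : g ∈ Q := hg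
      rw [hQ, Finset.mem_filter] at hg'
      exact Finset.mem_filter.2 ⟨Finset.mem_univ _, hg'.2⟩
    · intro g _ g' _ h
      funext e
      have := Finset.ext_iff.1 h e
      simp only [Finset.mem_filter, Finset.mem_univ, true_and] at this
      exact Bool.eq_iff_iff.2 this
  by_contra! hcon
  set pr : (Fin q ⊕ Fin q → Fin n) → Fin q × Fin q → Sym2 (Fin n) := fun u e =>
    s(u (Sum.inl e.1), u (Sum.inr e.2)) with hpr
  have hpr_inj : ∀ u, Function.Injective u → Function.Injective (pr u) := by
    rintro u hu ⟨a, b⟩ ⟨a', b'⟩ h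
    rcases Sym2.eq_iff.1 h with ⟨h1, h2⟩ | ⟨h1, -⟩
    · have h3 := hu h1
      have h4 := hu h2
      simp only [Sum.inl.injEq, Sum.inr.injEq] at h3 h4
      rw [h3, h4]
    · exact absurd (hu h1) (by simp)
  have hpat : ∀ u, Function.Injective u → ∀ f : Sym2 (Fin n) → Bool,
      crossPattern (graphOf f) u = Finset.univ.filter fun e => (f ∘ pr u) e = true := by
    intro u hu f
    refine Finset.filter_congr fun e _ => ?_
    exact and_iff_right fun h => by simpa using hu h
  set I : Finset (Fin q ⊕ Fin q → Fin n) := Finset.univ.filter Function.Injective with hI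
  have hcover : (Finset.univ : Finset (Sym2 (Fin n) → Bool)) ⊆
      I.biUnion fun u => Finset.univ.filter fun f => f ∘ pr u ∈ Q := by
    intro f _
    obtain ⟨u, hu, hr⟩ := hcon (graphOf f)
    rw [hpat u hu] at hr
    refine Finset.mem_biUnion.2 ⟨u, Finset.mem_filter.2 ⟨Finset.mem_univ _, hu⟩,
      Finset.mem_filter.2 ⟨Finset.mem_univ _, Finset.mem_filter.2 ⟨Finset.mem_univ _, hr⟩⟩⟩
  have hcount : 2 ^ Fintype.card (Sym2 (Fin n)) * 2 ^ (q * q) ≤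
      I.card * (2 ^ (q * q / 2) * 2 ^ Fintype.card (Sym2 (Fin n))) := by
    calc 2 ^ Fintype.card (Sym2 (Fin n)) * 2 ^ (q * q)
        = (Finset.univ : Finset (Sym2 (Fin n) → Bool)).card * 2 ^ (q * q) := by simp
      _ ≤ (∑ u ∈ I, (Finset.univ.filter fun f : Sym2 (Fin n) → Bool => f ∘ pr u ∈ Q).card) *
          2 ^ (q * q) :=
        Nat.mul_le_mul_right _ ((Finset.card_le_card hcover).trans Finset.card_biUnion_le)
      _ = ∑ u ∈ I, (Finset.univ.filter fun f : Sym2 (Fin n) → Bool => f ∘ pr u ∈ Q).card *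
          2 ^ (q * q) := Finset.sum_mul _ _ _
      _ ≤ ∑ u ∈ I, 2 ^ (q * q / 2) * 2 ^ Fintype.card (Sym2 (Fin n)) := by
        refine Finset.sum_le_sum fun u hu => ?_
        have := card_filter_comp_mem_mul_le (hpr_inj u (Finset.mem_filter.1 hu).2) Q
        rw [Fintype.card_prod, Fintype.card_fin] at this
        convert this.trans (Nat.mul_le_mul_right _ hQc)
      _ = _ := by rw [Finset.sum_const, smul_eq_mul]
  have hIc : I.card ≤ 2 ^ (L * (q + q)) := by
    refine (Finset.card_le_univ _).trans ?_
    rw [Fintype.card_fun, Fintype.card_sum, Fintype.card_fin, Fintype.card_fin, pow_mul]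
    exact Nat.pow_le_pow_left hn _
  have h1 : 2 ^ Fintype.card (Sym2 (Fin n)) * 2 ^ (q * q) ≤
      2 ^ Fintype.card (Sym2 (Fin n)) * 2 ^ (L * (q + q) + q * q / 2) := by
    refine hcount.trans ((Nat.mul_le_mul_right _ hIc).trans (le_of_eq ?_))
    rw [pow_add]; ring
  have h2 := (Nat.pow_le_pow_iff_right (by norm_num)).1
    (Nat.le_of_mul_le_mul_left h1 (by positivity))
  have h3 : 2 * (L * (q + q)) < q * q := by nlinarith
  omega

theorem one_le_log_log {n : ℕ} (hn : 16 ≤ n) : 1 ≤ Real.log (Real.log n) := by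
  have h1 : (16 : ℝ) ≤ n := by exact_mod_cast hn
  have h2 : Real.log 16 = 4 * Real.log 2 := by
    rw [show (16 : ℝ) = 2 ^ 4 by norm_num, Real.log_pow]; norm_num
  have h3 : Real.log 16 ≤ Real.log n := Real.log_le_log (by norm_num) h1
  have h4 := Real.log_two_gt_d9
  have h5 := Real.exp_one_lt_d9
  rw [Real.le_log_iff_exp_le (by linarith)]
  linarith

theorem numObs_pos_of_bot {n : ℕ} (hn : 2 ≤ n) (R : ObstacleRep (⊥ : SimpleGraph (Fin n))) :
    1 ≤ R.numObs := by
  obtain ⟨i, -⟩ := R.nonedges_blocked ⟨0, by omega⟩ ⟨1, by omega⟩ (by simp) (by simp)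
  exact i.pos

theorem exists_graph_log {n : ℕ} (hn : 2048 ≤ Nat.log 2 n) :
    ∃ G : SimpleGraph (Fin n), ∃ k, 14 ≤ k ∧ 2 ^ k ≤ 8 * (Nat.log 2 n + 1) ∧
      ∀ R : ObstacleRep G, n ≤ 8192 * (k + 1) * R.numObs := by
  set L := Nat.log 2 n + 1 with hL
  set k := Nat.log 2 (4 * L) + 1 with hk
  have hk1 : 4 * L < 2 ^ k := Nat.lt_pow_succ_log_self (by norm_num) _
  have hk2 : 2 ^ k ≤ 8 * L := by
    have := Nat.pow_log_le_self 2 (x := 4 * L) (by omega)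
    rw [hk, pow_succ]
    omega
  have hn0 : n ≠ 0 := by
    rintro rfl
    simp at hn
  have hnL : n < 2 ^ L := Nat.lt_pow_succ_log_self (by norm_num) _
  have hk14 : 14 ≤ k := by
    by_contra! h
    have : 2 ^ k ≤ 2 ^ 13 := Nat.pow_le_pow_right (by norm_num) (by omega)
    omega
  have hbig : 1024 * (k + 1) ≤ 2 ^ k := by
    clear_value k
    clear hk hk1 hk2
    induction k, hk14 using Nat.le_induction with
    | base => norm_num
    | succ k hk ih => rw [pow_succ]; omega
  have h0 : 0 < 1024 * (k + 1) := by omega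
  set h := 2 ^ k / (1024 * (k + 1)) with hh
  have hh1 : 1 ≤ h := (Nat.one_le_div_iff h0).2 hbig
  have hh2 : 1024 * (k + 1) * h ≤ 2 ^ k := Nat.mul_div_le _ _
  have hh3 : 2 ^ k < 1024 * (k + 1) * (h + 1) := Nat.lt_mul_div_succ _ h0
  obtain ⟨G, hG⟩ := exists_graph hh1 hh2 hnL.le hk1
  refine ⟨G, k, hk14, hk2, fun R => ?_⟩
  have hq : 0 < 2 ^ k := by positivity
  set q := 2 ^ k with hqd
  set m := n / (q + q) with hm
  have hR := mul_le_numObs hq (Nat.div_mul_le_self n (q + q)) hG R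
  have hqn : q + q ≤ n := by
    have h1 : 2 ^ Nat.log 2 n ≤ n := Nat.pow_log_le_self 2 hn0
    have h2 : ∀ x, 2048 ≤ x → 16 * (x + 1) ≤ 2 ^ x := by
      intro x hx
      have h3 : 8 ≤ x := by omega
      clear hx
      induction x, h3 using Nat.le_induction with
      | base => norm_num
      | succ x hx ih => rw [pow_succ]; omega
    have := h2 _ hn
    omega
  have hm1 : 1 ≤ m := (Nat.one_le_div_iff (by omega)).2 hqn
  have hm2 : n < (q + q) * (m + 1) := Nat.lt_mul_div_succ _ (by omega)
  have e1 : n ≤ 4 * q * m := by nlinarith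
  have e2 : q ≤ 2048 * (k + 1) * h := by nlinarith
  calc n ≤ 4 * q * m := e1
    _ ≤ 4 * (2048 * (k + 1) * h) * m := by gcongr
    _ = 8192 * (k + 1) * (m * h) := by ring
    _ ≤ _ := by gcongr

theorem le_log_log {n k : ℕ} (hn : 2048 ≤ Nat.log 2 n) (hk : 14 ≤ k)
    (hk2 : 2 ^ k ≤ 8 * (Nat.log 2 n + 1)) : ((k : ℝ) + 1) / 8 ≤ Real.log (Real.log n) := by
  have hn0 : n ≠ 0 := by
    rintro rfl
    simp at hn
  have h2 := Real.log_two_gt_d9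
  have h1 : (2 : ℝ) ^ Nat.log 2 n ≤ n := by exact_mod_cast Nat.pow_log_le_self 2 hn0
  have h3 : (Nat.log 2 n : ℝ) * Real.log 2 ≤ Real.log n := by
    rw [← Real.log_pow]
    exact Real.log_le_log (by positivity) h1
  have hn' : (2048 : ℝ) ≤ Nat.log 2 n := by exact_mod_cast hn
  have hk2' : (2 : ℝ) ^ k ≤ 8 * (Nat.log 2 n + 1) := by exact_mod_cast hk2
  obtain ⟨j, rfl⟩ : ∃ j, k = j + 5 := ⟨k - 5, by omega⟩
  have h4 : (2 : ℝ) ^ j ≤ Real.log n := by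
    rw [pow_add] at hk2'
    nlinarith
  have h5 : (j : ℝ) * Real.log 2 ≤ Real.log (Real.log n) := by
    rw [← Real.log_pow]
    exact Real.log_le_log (by positivity) h4
  have hj : (9 : ℝ) ≤ j := by
    have : 9 ≤ j := by omega
    exact_mod_cast this
  push_cast
  nlinarith

end CrossDrawing

/-- There is a constant `β > 0` such that every `n ≥ 16` admits an `n`-vertex graph
whose every obstacle representation uses at least `β·n / log log n` obstacles. -/
theorem obstacle_number_lower_bound :
    ∃ β : ℝ, 0 < β ∧ ∀ n : ℕ, 16 ≤ n →
      ∃ G : SimpleGraph (Fin n), ∀ R : ObstacleRep G,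
        β * (n : ℝ) / Real.log (Real.log (n : ℝ)) ≤ (R.numObs : ℝ) := by
  obtain ⟨K, hK⟩ : ∃ K, K = 2048 := ⟨_, rfl⟩
  have hβ : (65536 : ℝ) ≤ 2 ^ K := by
    calc (65536 : ℝ) = 2 ^ 16 := by norm_num
      _ ≤ 2 ^ K := pow_le_pow_right₀ (by norm_num) (by omega)
  refine ⟨(2 ^ K)⁻¹, by positivity, fun n hn => ?_⟩
  have hll := CrossDrawing.one_le_log_log hn
  by_cases hlog : K ≤ Nat.log 2 n
  · rw [hK] at hlog
    obtain ⟨G, k, hk, hk2, hG⟩ := CrossDrawing.exists_graph_log hlog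
    refine ⟨G, fun R => ?_⟩
    have h1 : (n : ℝ) ≤ 8192 * (k + 1) * R.numObs := by exact_mod_cast hG R
    have h2 := CrossDrawing.le_log_log hlog hk hk2
    have h3 : ((2 : ℝ) ^ K)⁻¹ ≤ 65536⁻¹ := inv_anti₀ (by norm_num) hβ
    have h4 : (0 : ℝ) ≤ R.numObs := Nat.cast_nonneg _
    rw [div_le_iff₀ (by linarith)]
    calc ((2 : ℝ) ^ K)⁻¹ * n ≤ 65536⁻¹ * (8192 * (k + 1) * R.numObs) := by gcongr
      _ = R.numObs * ((k + 1) / 8) := by ring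
      _ ≤ _ := by gcongr
  · refine ⟨⊥, fun R => ?_⟩
    have h1 : n < 2 ^ K := Nat.lt_pow_of_log_lt (by norm_num) (by omega)
    have h2 : (n : ℝ) ≤ 2 ^ K := by exact_mod_cast h1.le
    have h3 : (1 : ℝ) ≤ R.numObs := by
      exact_mod_cast CrossDrawing.numObs_pos_of_bot (by omega) R
    rw [div_le_iff₀ (by linarith)]
    calc ((2 : ℝ) ^ K)⁻¹ * n ≤ (2 ^ K)⁻¹ * 2 ^ K := by gcongr
      _ = 1 := inv_mul_cancel₀ (by positivity)
      _ ≤ _ := by nlinarith
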